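/- arXiv:1402.1726 — 6 statements merged into one kernel-verified Lean document; each statement's English description precedes it below -/
import Mathlib

section
/- Main Theorem (measurement bound): For every constant γ > 0 there exist constants C, c > 0 such that for all positive integers N, k ≥ 2 and every ε ∈ (0, 1/4) with N ≥ C·max{k², k/ε²}, there exist a positive integer m ≤ C·(k/ε)·log(N/k)·((log N/log k)^γ + 1/ε), an m×N real matrix Φ, and a function D : ℝ^m → ℝ^N such that for every x ∈ ℝ^N, ‖D(Φx) − x‖₁ ≤ (1+ε)·‖x_[k] − x‖₁. Moreover, if in addition ε ≤ c·(log k/log N)^γ, then m can be taken to satisfy m ≤ C·(k/ε²)·log(N/k). -/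
noncomputable def l1 {n : ℕ} (x : Fin n → ℝ) : ℝ := ∑ i, |x i|

open Classical in
/-- The support of a vector, as a finset. -/
noncomputable def fsupp {n : ℕ} (x : Fin n → ℝ) : Finset (Fin n) :=
  Finset.univ.filter (fun i => x i ≠ 0)

lemma sum_update {N q : ℕ} (G : (Fin N → Fin q) → ℝ) (i : Fin N) :
    ∑ f : Fin N → Fin q, ∑ b : Fin q, G (Function.update f i b) = q * ∑ f, G f := by
  classical
  have e : ∀ b : Fin q, ∑ f : Fin N → Fin q, G (Function.update f i b)
      = ∑ f : Fin N → Fin q, ∑ c : Fin q, if f i = b then G f else 0 := by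
    intro b
    have h1 : ∀ f : Fin N → Fin q, (∑ c : Fin q, if f i = b then G f else 0)
        = ∑ c : Fin q, if f i = b then G f else 0 := fun _ => rfl
    have : ∑ f : Fin N → Fin q, ∑ c : Fin q, (if f i = b then G f else 0)
        = ∑ p ∈ (Finset.univ : Finset ((Fin N → Fin q) × Fin q)).filter (fun p => p.1 i = b),
            G p.1 := by
      rw [Finset.sum_filter, Fintype.sum_prod_type]
    rw [this]
    refine Finset.sum_bij' (fun f _ => (Function.update f i b, f i))
      (fun p _ => Function.update p.1 i p.2) ?_ ?_ ?_ ?_ ?_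
    · intro f _; simp
    · intro p _; simp
    · intro f _; simp
    · intro p hp
      simp only [Finset.mem_filter, Finset.mem_univ, true_and] at hp
      ext1
      · simp [← hp]
      · simp
    · intro f _; rfl
  rw [Finset.sum_comm, Finset.sum_congr rfl (fun b _ => e b), Finset.sum_comm, Finset.mul_sum]
  refine Finset.sum_congr rfl (fun f _ => ?_)
  simp

lemma mgf {N q : ℕ} (hq : 0 < q) (z : ℝ) (hz : 1 ≤ z) (K : ℕ) (S : Finset (Fin N))
    (hS : S.card ≤ K) :
    ∑ f : Fin N → Fin q, z ^ (S.card - (S.image f).card)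
      ≤ (q : ℝ) ^ N * (1 + z * K / q) ^ S.card := by
  classical
  have hq' : (0 : ℝ) < q := by exact_mod_cast hq
  induction S using Finset.induction_on with
  | empty => simp
  | insert i S hi ih =>
    rw [Finset.card_insert_of_notMem hi] at hS ⊢
    have ih := ih (by omega)
    have key : ∀ f : Fin N → Fin q,
        ∑ b : Fin q, z ^ (S.card + 1 - ((insert i S).image (Function.update f i b)).card)
          ≤ z ^ (S.card - (S.image f).card) * (q + z * K) := by
      intro f
      have him : ∀ b, ((insert i S).image (Function.update f i b)) = insert b (S.image f) := by
        intro b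
        rw [Finset.image_insert, Function.update_self]
        congr 1
        refine Finset.image_congr (fun j hj => ?_)
        have : j ≠ i := by rintro rfl; exact hi hj
        simp [this]
      have hle : (S.image f).card ≤ S.card := Finset.card_image_le
      have hb : ∀ b, z ^ (S.card + 1 - ((insert i S).image (Function.update f i b)).card)
          ≤ z ^ (S.card - (S.image f).card) * (1 + if b ∈ S.image f then z else 0) := by
        intro b
        rw [him]
        by_cases hbm : b ∈ S.image f
        · rw [Finset.insert_eq_of_mem hbm, if_pos hbm, Nat.sub_add_comm hle, pow_succ]
          have : 0 ≤ z ^ (S.card - (S.image f).card) := by positivity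
          nlinarith
        · rw [Finset.card_insert_of_notMem hbm, if_neg hbm, Nat.add_sub_add_right]
          simp
      refine (Finset.sum_le_sum (fun b _ => hb b)).trans ?_
      rw [← Finset.mul_sum]
      refine mul_le_mul_of_nonneg_left ?_ (by positivity)
      rw [Finset.sum_add_distrib, ← Finset.sum_filter]
      simp only [Finset.sum_const, Finset.card_univ, Fintype.card_fin, nsmul_eq_mul, mul_one,
        Finset.filter_univ_mem]
      have : ((S.image f).card : ℝ) ≤ K := by exact_mod_cast hle.trans (by omega)
      nlinarith
    have h2 := sum_update (fun f : Fin N → Fin q =>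
      z ^ (S.card + 1 - ((insert i S).image f).card)) i
    have h3 : (q : ℝ) * ∑ f : Fin N → Fin q, z ^ (S.card + 1 - ((insert i S).image f).card)
        ≤ (∑ f : Fin N → Fin q, z ^ (S.card - (S.image f).card)) * (q + z * K) := by
      rw [← h2, Finset.sum_mul]
      exact Finset.sum_le_sum (fun f _ => key f)
    have h4 : (q : ℝ) * ∑ f : Fin N → Fin q, z ^ (S.card + 1 - ((insert i S).image f).card)
        ≤ q * ((q : ℝ) ^ N * (1 + z * K / q) ^ (S.card + 1)) := by
      refine h3.trans ((mul_le_mul_of_nonneg_right ih (by positivity)).trans (le_of_eq ?_))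
      rw [pow_succ]; field_simp
    exact le_of_mul_le_mul_left h4 hq'

lemma exists_expander {N d q K : ℕ} (hN : 0 < N) (hq : 0 < q) (δ : ℝ) (hδ : 0 < δ)
    (hqK : Real.exp 2 * K ≤ δ * q) (hd : Real.log N + 1 ≤ δ * d) :
    ∃ F : Fin d → Fin N → Fin q, ∀ S : Finset (Fin N), S.card ≤ K →
      (1 - δ) * d * S.card ≤ ∑ t, ((S.image (F t)).card : ℝ) := by
  classical
  have hq' : (0 : ℝ) < q := by exact_mod_cast hq
  have hN' : (0 : ℝ) < N := by exact_mod_cast hN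
  set z : ℝ := Real.exp 2 with hzdef
  have hz : 1 ≤ z := Real.one_le_exp (by norm_num)
  have hz0 : 0 < z := Real.exp_pos 2
  let cc : (Fin d → Fin N → Fin q) → Finset (Fin N) → ℕ :=
    fun F S => ∑ t, (S.card - (S.image (F t)).card)
  let A : Finset (Finset (Fin N)) :=
    Finset.univ.filter (fun S => S.Nonempty ∧ S.card ≤ K)
  let tot : (Fin d → Fin N → Fin q) → ℝ := fun F =>
    ∑ S ∈ A, z ^ (cc F S) * Real.exp (-(2 * (δ * d * S.card)))
  have hbound : ∑ F, tot F < ∑ F : Fin d → Fin N → Fin q, (1 : ℝ) := by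
    have hS : ∀ S ∈ A, ∑ F : Fin d → Fin N → Fin q,
        z ^ (cc F S) * Real.exp (-(2 * (δ * d * S.card)))
        ≤ ((q : ℝ) ^ N) ^ d * Real.exp (-(δ * d)) ^ S.card := by
      intro S hSA
      have hcard : S.card ≤ K := (Finset.mem_filter.1 hSA).2.2
      rw [← Finset.sum_mul]
      have h1 : ∑ F : Fin d → Fin N → Fin q, z ^ (cc F S)
          = (∑ f : Fin N → Fin q, z ^ (S.card - (S.image f).card)) ^ d := by
        rw [Fintype.sum_pow]
        refine Finset.sum_congr rfl (fun F _ => ?_)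
        rw [Finset.prod_pow_eq_pow_sum]
      have h2 : (1 + z * K / q) ^ S.card ≤ Real.exp (δ * S.card) := by
        have : 1 + z * K / q ≤ Real.exp δ := by
          have h5 : z * K / q ≤ δ := by rw [div_le_iff₀ hq']; exact hqK
          have := Real.add_one_le_exp δ
          linarith
        calc _ ≤ Real.exp δ ^ S.card := by gcongr
          _ = _ := by rw [← Real.exp_nat_mul, mul_comm]
      have h3 := (mgf hq z hz K S hcard).trans
        (mul_le_mul_of_nonneg_left h2 (by positivity : (0:ℝ) ≤ (q:ℝ)^N))
      rw [h1]
      calc _ ≤ ((q : ℝ) ^ N * Real.exp (δ * S.card)) ^ d * Real.exp (-(2 * (δ * d * S.card))) := by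
            gcongr
        _ = _ := by
            rw [mul_pow, mul_assoc, ← Real.exp_nat_mul, ← Real.exp_nat_mul, ← Real.exp_add]
            congr 2; ring
    have hx : Real.exp (-(δ * d)) ≤ 1 / (2 * N) := by
      have h1 : Real.exp (-(δ * d)) ≤ Real.exp (-(Real.log N + 1)) :=
        Real.exp_le_exp.2 (by linarith)
      rw [Real.exp_neg (Real.log N + 1), Real.exp_add, Real.exp_log hN'] at h1
      refine h1.trans ?_
      rw [one_div]
      have : (2:ℝ) ≤ Real.exp 1 := by have := Real.add_one_le_exp (1:ℝ); linarith
      gcongr ?_⁻¹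
      nlinarith
    have hsum : ∑ S ∈ A, Real.exp (-(δ * d)) ^ S.card < 1 := by
      set x := Real.exp (-(δ * d))
      have hx0 : 0 < x := Real.exp_pos _
      have hall : ∑ S : Finset (Fin N), x ^ S.card = (1 + x) ^ N := by
        have := Finset.sum_pow_mul_eq_add_pow x 1 (Finset.univ : Finset (Fin N))
        simp only [one_pow, mul_one, Finset.powerset_univ, Finset.card_univ,
          Fintype.card_fin] at this
        rw [this, add_comm]
      have hsub : ∑ S ∈ A, x ^ S.card + 1 ≤ ∑ S : Finset (Fin N), x ^ S.card := by
        have hne : (∅ : Finset (Fin N)) ∉ A := by simp [A]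
        have : ∑ S ∈ insert ∅ A, x ^ S.card ≤ ∑ S : Finset (Fin N), x ^ S.card :=
          Finset.sum_le_sum_of_subset_of_nonneg (Finset.subset_univ _)
            (fun _ _ _ => by positivity)
        rw [Finset.sum_insert hne] at this
        simp at this
        linarith
      have hfin : (1 + x) ^ N < 2 := by
        have h1 : (1 + x) ^ N ≤ Real.exp (1/2) := by
          calc (1 + x) ^ N ≤ (Real.exp x) ^ N := by
                have := Real.add_one_le_exp x
                gcongr; linarith
            _ = Real.exp (N * x) := by rw [← Real.exp_nat_mul]
            _ ≤ _ := by
                apply Real.exp_le_exp.2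
                calc (N : ℝ) * x ≤ N * (1 / (2 * N)) := by gcongr
                  _ = 1/2 := by field_simp
        have h2 : Real.exp (1/2) ^ 2 = Real.exp 1 := by rw [← Real.exp_nat_mul]; norm_num
        have h3 := Real.exp_one_lt_d9
        have h4 := Real.exp_pos (1/2)
        nlinarith
      linarith
    have hswap : ∑ F, tot F = ∑ S ∈ A, ∑ F : Fin d → Fin N → Fin q,
        z ^ (cc F S) * Real.exp (-(2 * (δ * d * S.card))) := Finset.sum_comm
    rw [hswap]
    calc _ ≤ ∑ S ∈ A, ((q : ℝ) ^ N) ^ d * Real.exp (-(δ * d)) ^ S.card := Finset.sum_le_sum hS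
      _ = ((q : ℝ) ^ N) ^ d * ∑ S ∈ A, Real.exp (-(δ * d)) ^ S.card := by rw [Finset.mul_sum]
      _ < ((q : ℝ) ^ N) ^ d * 1 := by gcongr
      _ = _ := by simp
  obtain ⟨F, -, hF⟩ := Finset.exists_lt_of_sum_lt hbound
  refine ⟨F, fun S hSK => ?_⟩
  rcases S.eq_empty_or_nonempty with rfl | hne
  · simp
  have hmem : S ∈ A := Finset.mem_filter.2 ⟨Finset.mem_univ _, hne, hSK⟩
  have hterm : z ^ (cc F S) * Real.exp (-(2 * (δ * d * S.card))) < 1 :=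
    (Finset.single_le_sum (f := fun S => z ^ (cc F S) * Real.exp (-(2 * (δ * d * S.card))))
      (fun _ _ => by positivity) hmem).trans_lt hF
  rw [hzdef, ← Real.exp_nat_mul, ← Real.exp_add, Real.exp_lt_one_iff] at hterm
  have hcc : (cc F S : ℝ) = d * S.card - ∑ t, ((S.image (F t)).card : ℝ) := by
    simp only [cc, Nat.cast_sum]
    have : ∀ t, ((S.card - (S.image (F t)).card : ℕ) : ℝ)
        = (S.card : ℝ) - (S.image (F t)).card := fun t => Nat.cast_sub Finset.card_image_le
    simp [this]
  rw [hcc] at hterm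
  linarith

lemma layer {N d q K : ℕ} (δ : ℝ) (F : Fin d → Fin N → Fin q)
    (hF : ∀ S : Finset (Fin N), S.card ≤ K →
      (1 - δ) * d * S.card ≤ ∑ t, ((S.image (F t)).card : ℝ)) :
    ∀ (n : ℕ) (S : Finset (Fin N)), S.card = n → n ≤ K → ∀ (a : Fin N → ℝ) (M : Fin d → Fin q → ℝ),
      (∀ i ∈ S, 0 ≤ a i) → (∀ t, ∀ i ∈ S, a i ≤ M t (F t i)) →
      (1 - δ) * d * ∑ i ∈ S, a i ≤ ∑ t, ∑ b ∈ S.image (F t), M t b := by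
  classical
  intro n
  induction n with
  | zero =>
    intro S hS _ a M _ _
    rw [Finset.card_eq_zero] at hS
    simp [hS]
  | succ n ih =>
    intro S hS hn a M ha hM
    have hne : S.Nonempty := by rw [← Finset.card_pos]; omega
    obtain ⟨i0, hi0, hmin⟩ := Finset.exists_min_image S a hne
    have h1 := ih (S.erase i0) (by rw [Finset.card_erase_of_mem hi0]; omega) (by omega)
      (fun i => a i - a i0) (fun t b => M t b - a i0)
      (fun i hi => sub_nonneg.2 (hmin i (Finset.mem_of_mem_erase hi)))
      (fun t i hi => by have := hM t i (Finset.mem_of_mem_erase hi); simpa using this)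
    have h2 : ∀ t, ∑ b ∈ (S.erase i0).image (F t), (M t b - a i0)
        ≤ ∑ b ∈ S.image (F t), M t b - (S.image (F t)).card * a i0 := by
      intro t
      have : ∑ b ∈ S.image (F t), M t b - (S.image (F t)).card * a i0
          = ∑ b ∈ S.image (F t), (M t b - a i0) := by
        rw [Finset.sum_sub_distrib]; simp
      rw [this]
      refine Finset.sum_le_sum_of_subset_of_nonneg
        (Finset.image_subset_image (Finset.erase_subset _ _)) ?_
      intro b hb _
      obtain ⟨j, hj, rfl⟩ := Finset.mem_image.1 hb
      have := hM t j hj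
      have := hmin j hj
      linarith
    have h3 := h1.trans (Finset.sum_le_sum (fun t _ => h2 t))
    have h4 : ∑ i ∈ S.erase i0, (a i - a i0) = ∑ i ∈ S, a i - S.card * a i0 := by
      rw [Finset.sum_erase]
      · rw [Finset.sum_sub_distrib]; simp
      · simp
    rw [h4, Finset.sum_sub_distrib, ← Finset.sum_mul] at h3
    have h5 := mul_le_mul_of_nonneg_right (hF S (by omega)) (ha i0 hi0)
    linarith

lemma coll {N q : ℕ} (f : Fin N → Fin q) (T U : Finset (Fin N)) (hTU : Disjoint T U) :
    ((U.filter (fun i => f i ∈ T.image f)).card : ℝ)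
      ≤ ((T ∪ U).card : ℝ) - ((T ∪ U).image f).card := by
  classical
  have h1 : (T ∪ U).image f ⊆ T.image f ∪ (U.filter (fun i => ¬ f i ∈ T.image f)).image f := by
    intro b hb
    obtain ⟨i, hi, rfl⟩ := Finset.mem_image.1 hb
    by_cases h : f i ∈ T.image f
    · exact Finset.mem_union_left _ h
    · apply Finset.mem_union_right
      refine Finset.mem_image_of_mem f (Finset.mem_filter.2 ⟨?_, h⟩)
      rcases Finset.mem_union.1 hi with h' | h'
      · exact absurd (Finset.mem_image_of_mem f h') h
      · exact h'
  have h2 := (Finset.card_le_card h1).trans (Finset.card_union_le _ _)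
  have h3 : (T.image f).card ≤ T.card := Finset.card_image_le
  have h4 : ((U.filter (fun i => ¬ f i ∈ T.image f)).image f).card
      ≤ (U.filter (fun i => ¬ f i ∈ T.image f)).card := Finset.card_image_le
  have h5 := Finset.card_filter_add_card_filter_not (s := U) (fun i => f i ∈ T.image f)
  have h6 := Finset.card_union_of_disjoint hTU
  have : (U.filter (fun i => f i ∈ T.image f)).card + ((T ∪ U).image f).card ≤ (T ∪ U).card := by
    omega
  have : ((U.filter (fun i => f i ∈ T.image f)).card : ℝ) + ((T ∪ U).image f).card
      ≤ (T ∪ U).card := by exact_mod_cast this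
  linarith

lemma exists_top {N : ℕ} (a : Fin N → ℝ) (s : ℕ) (hs : s ≤ N) :
    ∃ T : Finset (Fin N), T.card = s ∧ ∀ T' : Finset (Fin N), T'.card = s →
      ∑ i ∈ T', a i ≤ ∑ i ∈ T, a i := by
  obtain ⟨T, hT, hmax⟩ := Finset.exists_max_image
    (Finset.powersetCard s (Finset.univ : Finset (Fin N))) (fun T => ∑ i ∈ T, a i)
    (Finset.powersetCard_nonempty.2 (by simpa using hs))
  refine ⟨T, (Finset.mem_powersetCard.1 hT).2, fun T' h => hmax T' ?_⟩
  exact Finset.mem_powersetCard.2 ⟨Finset.subset_univ _, h⟩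

lemma exists_top_le {N : ℕ} (a : Fin N → ℝ) (ha : ∀ i, 0 ≤ a i) (s : ℕ) (hs : s ≤ N) :
    ∃ T : Finset (Fin N), T.card = s ∧ ∀ T' : Finset (Fin N), T'.card ≤ s →
      ∑ i ∈ T', a i ≤ ∑ i ∈ T, a i := by
  obtain ⟨T, hT, h⟩ := exists_top a s hs
  refine ⟨T, hT, fun T' hT' => ?_⟩
  obtain ⟨T'', hsub, hc⟩ := Finset.exists_superset_card_eq hT' (by simpa using hs)
  exact (Finset.sum_le_sum_of_subset_of_nonneg hsub (fun i _ _ => ha i)).trans (h T'' hc)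

lemma nsp {N d q s : ℕ} (hd : 0 < d) (hs : 0 < s) (hsN : s ≤ N) (δ : ℝ) (hδ : 0 < δ)
    (hδ' : δ ≤ 1/8)
    (F : Fin d → Fin N → Fin q)
    (hF : ∀ S : Finset (Fin N), S.card ≤ 2 * s →
      (1 - δ) * d * S.card ≤ ∑ t, ((S.image (F t)).card : ℝ))
    (h : Fin N → ℝ) (hker : ∀ t b, ∑ i with F t i = b, h i = 0)
    (T' : Finset (Fin N)) (hT' : T'.card ≤ s) :
    ∑ i ∈ T', |h i| ≤ 4 * δ * ∑ i, |h i| := by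
  classical
  have hd' : (0 : ℝ) < d := by exact_mod_cast hd
  have hs' : (0 : ℝ) < s := by exact_mod_cast hs
  obtain ⟨T, hTc, hT⟩ := exists_top_le (fun i => |h i|) (fun i => abs_nonneg _) s hsN
  refine (hT T' hT').trans ?_
  have hsmall : ∀ i, i ∉ T → s * |h i| ≤ ∑ j ∈ T, |h j| := by
    intro i hi
    have : ∀ j ∈ T, |h i| ≤ |h j| := by
      intro j hj
      have hc : (insert i (T.erase j)).card ≤ s := by
        refine (Finset.card_insert_le _ _).trans ?_
        rw [Finset.card_erase_of_mem hj]; omega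
      have h1 := hT _ hc
      rw [Finset.sum_insert (by simp [hi])] at h1
      have h2 := Finset.add_sum_erase T (fun i => |h i|) hj
      simp only at h1 h2
      linarith
    have := Finset.sum_le_sum this
    simpa [hTc] using this
  let e : Fin N → ℝ := fun i => ((Finset.univ.filter (fun t => F t i ∈ T.image (F t))).card : ℝ)
  have he : ∀ U : Finset (Fin N), Disjoint T U → U.card ≤ s → ∑ i ∈ U, e i ≤ 2 * δ * d * s := by
    intro U hTU hU
    have h1 : ∑ i ∈ U, e i = ∑ t, ((U.filter (fun i => F t i ∈ T.image (F t))).card : ℝ) := by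
      simp only [e, Finset.card_filter, Nat.cast_sum]
      rw [Finset.sum_comm]
    rw [h1]
    have h2 := Finset.sum_le_sum (fun t (_ : t ∈ Finset.univ) => coll (F t) T U hTU)
    refine h2.trans ?_
    have hc : (T ∪ U).card ≤ 2 * s := (Finset.card_union_le _ _).trans (by omega)
    have h3 := hF (T ∪ U) hc
    have h4 : ((T ∪ U).card : ℝ) ≤ 2 * s := by exact_mod_cast hc
    rw [Finset.sum_sub_distrib]
    simp only [Finset.sum_const, Finset.card_univ, Fintype.card_fin, nsmul_eq_mul]
    have h5 : δ * d * ((T ∪ U).card : ℝ) ≤ δ * d * (2 * s) := by gcongr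
    linarith
  have hmain : (1 - δ) * d * ∑ i ∈ T, |h i|
      ≤ ∑ t, ∑ b ∈ T.image (F t), (1/2) * ∑ i with F t i = b, |h i| := by
    refine layer δ F hF s T hTc (by omega) (fun i => |h i|)
      (fun t b => (1/2) * ∑ i with F t i = b, |h i|) (fun i _ => abs_nonneg _) ?_
    intro t i _
    have hi : i ∈ Finset.univ.filter (fun j => F t j = F t i) := by simp
    have h1 := hker t (F t i)
    rw [← Finset.add_sum_erase _ _ hi] at h1
    have h2 : h i = -(∑ j ∈ (Finset.univ.filter (fun j => F t j = F t i)).erase i, h j) := by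
      linarith
    have h3 : |h i| ≤ ∑ j ∈ (Finset.univ.filter (fun j => F t j = F t i)).erase i, |h j| := by
      conv_lhs => rw [h2, abs_neg]
      exact Finset.abs_sum_le_sum_abs _ _
    have h4 := Finset.add_sum_erase _ (fun j => |h j|) hi
    linarith
  have hrew : ∑ t, ∑ b ∈ T.image (F t), (1/2) * ∑ i with F t i = b, |h i|
      = (1/2) * ∑ i, |h i| * e i := by
    have : ∀ t, ∑ b ∈ T.image (F t), (1/2) * ∑ i with F t i = b, |h i|
        = (1/2) * ∑ i, if F t i ∈ T.image (F t) then |h i| else 0 := by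
      intro t
      rw [← Finset.mul_sum]
      congr 1
      simp only [Finset.sum_filter]
      rw [Finset.sum_comm]
      refine Finset.sum_congr rfl (fun i _ => ?_)
      rw [Finset.sum_ite_eq]
    rw [Finset.sum_congr rfl (fun t _ => this t), ← Finset.mul_sum, Finset.sum_comm]
    congr 1
    refine Finset.sum_congr rfl (fun i _ => ?_)
    rw [← Finset.sum_filter]
    simp [e, mul_comm]
  rw [hrew, ← Finset.sum_add_sum_compl T] at hmain
  have hTe : ∑ i ∈ T, |h i| * e i = d * ∑ i ∈ T, |h i| := by
    rw [Finset.mul_sum]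
    refine Finset.sum_congr rfl (fun i hi => ?_)
    have : e i = d := by
      simp only [e]
      rw [Finset.filter_true_of_mem (fun t _ => Finset.mem_image_of_mem _ hi)]
      simp
    rw [this, mul_comm]
  rw [hTe] at hmain
  let U : Finset (Fin N) := Tᶜ.filter (fun i => 2 * δ * d < e i)
  have hdis : Disjoint T U := by
    refine Finset.disjoint_left.2 (fun i hi hU => ?_)
    exact (Finset.mem_compl.1 (Finset.mem_filter.1 hU).1) hi
  have hUc : U.card ≤ s := by
    by_contra hcon
    obtain ⟨V, hVU, hV⟩ := Finset.exists_subset_card_eq (show s ≤ U.card by omega)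
    have h1 := he V (Finset.disjoint_of_subset_right hVU hdis) hV.le
    have hVne : V.Nonempty := by rw [← Finset.card_pos]; omega
    have h2 : ∑ i ∈ V, (2 * δ * d : ℝ) < ∑ i ∈ V, e i :=
      Finset.sum_lt_sum_of_nonempty hVne (fun i hi => (Finset.mem_filter.1 (hVU hi)).2)
    rw [Finset.sum_const, hV, nsmul_eq_mul] at h2
    linarith
  have hW : ∑ i ∈ Tᶜ, |h i| * e i
      ≤ 2 * δ * d * (∑ i ∈ T, |h i|) + 2 * δ * d * ∑ i, |h i| := by
    rw [← Finset.sum_filter_add_sum_filter_not Tᶜ (fun i => 2 * δ * d < e i)]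
    refine add_le_add ?_ ?_
    · have h1 : ∀ i ∈ U, |h i| * e i ≤ ((∑ j ∈ T, |h j|) / s) * e i := by
        intro i hi
        have h2 := hsmall i (Finset.mem_compl.1 (Finset.mem_filter.1 hi).1)
        have h3 : 0 ≤ e i := Nat.cast_nonneg _
        refine mul_le_mul_of_nonneg_right ?_ h3
        rw [le_div_iff₀ hs']; linarith
      refine (Finset.sum_le_sum h1).trans ?_
      rw [← Finset.mul_sum]
      have h2 := he U hdis hUc
      have h3 : 0 ≤ (∑ j ∈ T, |h j|) / s := by positivity
      refine (mul_le_mul_of_nonneg_left h2 h3).trans (le_of_eq ?_)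
      field_simp
    · rw [Finset.mul_sum]
      refine (Finset.sum_le_sum (g := fun i => 2 * δ * d * |h i|) ?_).trans
        (Finset.sum_le_sum_of_subset_of_nonneg (Finset.subset_univ _)
          (fun _ _ _ => by positivity))
      intro i hi
      have h1 := not_lt.1 (Finset.mem_filter.1 hi).2
      rw [mul_comm]
      exact mul_le_mul_of_nonneg_right h1 (abs_nonneg _)
  have hT0 : 0 ≤ ∑ i ∈ T, |h i| := by positivity
  have hfin : d * ((1 - 4 * δ) * ∑ i ∈ T, |h i|) ≤ d * (2 * δ * ∑ i, |h i|) := by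
    linarith
  have hfin := le_of_mul_le_mul_left hfin hd'
  nlinarith
lemma exists_l1_min {m N : ℕ} (Φ : Matrix (Fin m) (Fin N) ℝ) (x1 : Fin N → ℝ) :
    ∃ x0 : Fin N → ℝ, Φ.mulVec x0 = Φ.mulVec x1 ∧
      ∀ x, Φ.mulVec x = Φ.mulVec x1 → l1 x0 ≤ l1 x := by
  have hcont : Continuous (l1 : (Fin N → ℝ) → ℝ) := by unfold l1; fun_prop
  have hcl : IsClosed {x : Fin N → ℝ | Φ.mulVec x = Φ.mulVec x1} :=
    isClosed_eq (Continuous.matrix_mulVec continuous_const continuous_id) continuous_const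
  have hcpt : IsCompact ({x : Fin N → ℝ | Φ.mulVec x = Φ.mulVec x1}
      ∩ {x | l1 x ≤ l1 x1}) := by
    refine Metric.isCompact_of_isClosed_isBounded
      (hcl.inter (isClosed_le hcont continuous_const)) ?_
    refine (Metric.isBounded_closedBall (x := (0 : Fin N → ℝ)) (r := l1 x1)).subset ?_
    rintro x ⟨-, hx⟩
    have h0 : 0 ≤ l1 x1 := Finset.sum_nonneg (fun _ _ => abs_nonneg _)
    rw [mem_closedBall_zero_iff, pi_norm_le_iff_of_nonneg h0]
    intro i
    refine le_trans ?_ hx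
    exact Finset.single_le_sum (f := fun i => |x i|) (fun _ _ => abs_nonneg _)
      (Finset.mem_univ i)
  obtain ⟨x0, ⟨h1, h2⟩, h3⟩ := hcpt.exists_isMinOn ⟨x1, rfl, le_refl (l1 x1)⟩ hcont.continuousOn
  refine ⟨x0, h1, fun x hx => ?_⟩
  by_cases hle : l1 x ≤ l1 x1
  · exact h3 ⟨hx, hle⟩
  · exact le_trans h2 (not_le.1 hle).le


lemma decode {m N k : ℕ} (hk : k ≤ N) (Φ : Matrix (Fin m) (Fin N) ℝ) (ρ : ℝ)
    (hρ : ρ ≤ 1/4) (hρ0 : 0 ≤ ρ)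
    (hnsp : ∀ h : Fin N → ℝ, Φ.mulVec h = 0 → ∀ T : Finset (Fin N), T.card ≤ 2 * k →
      ∑ i ∈ T, |h i| ≤ ρ * ∑ i, |h i|) :
    ∃ D : (Fin m → ℝ) → (Fin N → ℝ), ∀ x w : Fin N → ℝ, (fsupp w).card ≤ k →
      l1 (D (Φ.mulVec x) - x) ≤ (1 + 8 * ρ) * l1 (w - x) := by
  classical
  have hz : ∀ y : Fin m → ℝ, ∃ z : Fin N → ℝ, ∀ x w : Fin N → ℝ, Φ.mulVec x = y →
      (fsupp w).card ≤ k → l1 (z - x) ≤ (1 + 8 * ρ) * l1 (w - x) := by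
    intro y
    by_cases hy : ∃ x1, Φ.mulVec x1 = y
    swap
    · exact ⟨0, fun x w hx _ => absurd ⟨x, hx⟩ hy⟩
    obtain ⟨x1, rfl⟩ := hy
    obtain ⟨x0, hx0, hmin⟩ := exists_l1_min Φ x1
    obtain ⟨H0, hH0c, hH0⟩ := exists_top_le (fun i => |x0 i|) (fun i => abs_nonneg _) k hk
    refine ⟨fun i => if i ∈ H0 then x0 i else 0, fun x w hx hw => ?_⟩
    set H := fsupp w with hH
    have hwH : ∀ i, i ∉ H → w i = 0 := by
      intro i hi
      by_contra hne
      exact hi (by simp [hH, fsupp, hne])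
    have hker : Φ.mulVec (x - x0) = 0 := by rw [Matrix.mulVec_sub, hx, hx0, sub_self]
    have hle := hmin x hx
    have hTc : (H ∪ H0).card ≤ 2 * k := (Finset.card_union_le _ _).trans (by omega)
    have hT := hnsp _ hker (H ∪ H0) hTc
    have hHn := hnsp _ hker H (by omega)
    set T := H ∪ H0 with hTdef
    set σ := ∑ i ∈ Hᶜ, |x i| with hσ
    have hσw : σ ≤ l1 (w - x) := by
      unfold l1
      rw [← Finset.sum_add_sum_compl H]
      have h1 : ∑ i ∈ Hᶜ, |(w - x) i| = σ := by
        refine Finset.sum_congr rfl (fun i hi => ?_)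
        simp [hwH i (Finset.mem_compl.1 hi)]
      have h2 : 0 ≤ ∑ i ∈ H, |(w - x) i| := by positivity
      linarith
    have hσ0 : 0 ≤ σ := by positivity
    set n := ∑ i, |(x - x0) i| with hn
    have hbp : n ≤ 4 * σ := by
      unfold l1 at hle
      rw [← Finset.sum_add_sum_compl H, ← Finset.sum_add_sum_compl H (fun i => |x i|)] at hle
      have h1 : ∑ i ∈ H, |x i| ≤ ∑ i ∈ H, |x0 i| + ∑ i ∈ H, |(x - x0) i| := by
        rw [← Finset.sum_add_distrib]
        refine Finset.sum_le_sum (fun i _ => ?_)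
        have := abs_add_le (x0 i) (x i - x0 i)
        simpa using this
      have h2 : ∑ i ∈ Hᶜ, |(x - x0) i| ≤ ∑ i ∈ Hᶜ, |x i| + ∑ i ∈ Hᶜ, |x0 i| := by
        rw [← Finset.sum_add_distrib]
        exact Finset.sum_le_sum (fun i _ => abs_sub (x i) (x0 i))
      have h3 : n = ∑ i ∈ H, |(x - x0) i| + ∑ i ∈ Hᶜ, |(x - x0) i| :=
        (Finset.sum_add_sum_compl H _).symm
      have h4 : 0 ≤ n := by positivity
      have h5 : ρ * n ≤ 1/4 * n := by gcongr
      linarith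
    have hsplit : l1 ((fun i => if i ∈ H0 then x0 i else 0) - x)
        ≤ ∑ i ∈ T, |(x - x0) i| + ∑ i ∈ H \ H0, |x0 i| + ∑ i ∈ Tᶜ, |x i| := by
      unfold l1
      rw [← Finset.sum_add_sum_compl T]
      have h1 : ∑ i ∈ Tᶜ, |((fun i => if i ∈ H0 then x0 i else 0) - x) i| = ∑ i ∈ Tᶜ, |x i| := by
        refine Finset.sum_congr rfl (fun i hi => ?_)
        have : i ∉ H0 := fun h => Finset.mem_compl.1 hi (Finset.mem_union_right _ h)
        simp [this]
      have h2 : ∑ i ∈ T, |((fun i => if i ∈ H0 then x0 i else 0) - x) i|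
          ≤ ∑ i ∈ T, |(x - x0) i| + ∑ i ∈ T, (if i ∈ H \ H0 then |x0 i| else 0) := by
        rw [← Finset.sum_add_distrib]
        refine Finset.sum_le_sum (fun i hi => ?_)
        by_cases hi0 : i ∈ H0
        · simp [hi0, abs_sub_comm]
        · have hiH : i ∈ H := (Finset.mem_union.1 hi).resolve_right hi0
          simp only [Pi.sub_apply, hi0, if_false, zero_sub, abs_neg, Finset.mem_sdiff, hiH,
            not_false_eq_true, and_self, if_true]
          have := abs_add_le (x i - x0 i) (x0 i)
          simpa using this
      have h3 : ∑ i ∈ T, (if i ∈ H \ H0 then |x0 i| else 0) = ∑ i ∈ H \ H0, |x0 i| := by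
        rw [Finset.sum_ite_mem, Finset.inter_eq_right.2]
        exact Finset.sdiff_subset.trans Finset.subset_union_left
      linarith
    have hswap : ∑ i ∈ H \ H0, |x0 i| ≤ ∑ i ∈ H0 \ H, |x0 i| := by
      have h1 := hH0 H hw
      have h2 := Finset.sum_inter_add_sum_sdiff H H0 (fun i => |x0 i|)
      have h3 := Finset.sum_inter_add_sum_sdiff H0 H (fun i => |x0 i|)
      rw [Finset.inter_comm] at h3
      linarith
    have hx0x : ∑ i ∈ H0 \ H, |x0 i| ≤ ∑ i ∈ H0 \ H, |x i| + ∑ i ∈ T, |(x - x0) i| := by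
      have h1 : ∑ i ∈ H0 \ H, |(x - x0) i| ≤ ∑ i ∈ T, |(x - x0) i| :=
        Finset.sum_le_sum_of_subset_of_nonneg
          (Finset.sdiff_subset.trans Finset.subset_union_right) (fun _ _ _ => abs_nonneg _)
      have h2 : ∑ i ∈ H0 \ H, |x0 i| ≤ ∑ i ∈ H0 \ H, |x i| + ∑ i ∈ H0 \ H, |(x - x0) i| := by
        rw [← Finset.sum_add_distrib]
        refine Finset.sum_le_sum (fun i _ => ?_)
        have := abs_sub (x i) (x i - x0 i)
        simpa using this
      linarith
    have hlast : ∑ i ∈ H0 \ H, |x i| + ∑ i ∈ Tᶜ, |x i| = σ := by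
      rw [hσ, ← Finset.sum_union]
      · congr 1
        ext i
        simp only [hTdef, Finset.mem_union, Finset.mem_sdiff, Finset.mem_compl]
        tauto
      · refine Finset.disjoint_left.2 (fun i hi hi' => ?_)
        exact Finset.mem_compl.1 hi' (Finset.mem_union_right _ (Finset.mem_sdiff.1 hi).1)
    have h8 : ρ * n ≤ ρ * (4 * σ) := by gcongr
    calc _ ≤ (1 + 8 * ρ) * σ := by linarith
      _ ≤ _ := by gcongr
  choose D hD using hz
  exact ⟨D, fun x w hw => hD _ x w rfl hw⟩

lemma core {N k : ℕ} (hk : 2 ≤ k) (ε : ℝ) (hε : 0 < ε) (hε' : ε < 1/4)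
    (hN : 4 * (k : ℝ) ^ 2 ≤ N) :
    ∃ m : ℕ, 0 < m ∧ (m : ℝ) ≤ 300000 * ((k : ℝ) / ε ^ 2) * Real.log ((N : ℝ) / k) ∧
      ∃ (Φ : Matrix (Fin m) (Fin N) ℝ) (D : (Fin m → ℝ) → (Fin N → ℝ)),
          ∀ x : Fin N → ℝ, ∀ w : Fin N → ℝ, (fsupp w).card ≤ k →
            l1 (D (Φ.mulVec x) - x) ≤ (1 + ε) * l1 (w - x) := by
  classical
  have hk' : (2 : ℝ) ≤ k := by exact_mod_cast hk
  have hN2 : 4 * k ^ 2 ≤ N := by exact_mod_cast hN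
  have hkN : 2 * k ≤ N := by nlinarith
  have hN0 : 0 < N := by omega
  have hNr : (16 : ℝ) ≤ N := by nlinarith
  have hN0r : (0 : ℝ) < N := by linarith
  have hk0 : (0 : ℝ) < k := by linarith
  set δ : ℝ := ε / 32 with hδ
  have hδ0 : 0 < δ := by positivity
  have hδ8 : δ ≤ 1/128 := by rw [hδ]; linarith
  have hlog1 : 1 ≤ Real.log N := by
    rw [Real.le_log_iff_exp_le hN0r]
    have := Real.exp_one_lt_d9
    linarith
  have hlog2 : Real.log N ≤ 2 * Real.log ((N : ℝ) / k) := by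
    rw [Real.log_div hN0r.ne' hk0.ne']
    have : Real.log ((k : ℝ) ^ 2) ≤ Real.log N := Real.log_le_log (by positivity) (by nlinarith)
    rw [Real.log_pow] at this
    push_cast at this
    linarith
  have hexp2 : Real.exp 2 ≤ 8 := by
    have h1 : Real.exp 2 = Real.exp 1 ^ 2 := by rw [← Real.exp_nat_mul]; norm_num
    rw [h1]
    have := Real.exp_one_lt_d9
    have := Real.exp_pos 1
    nlinarith
  set d : ℕ := ⌈(Real.log N + 1) / δ⌉₊ with hddef
  set q : ℕ := ⌈32 * (k : ℝ) / δ⌉₊ with hqdef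
  have hd0 : 0 < d := Nat.ceil_pos.2 (by positivity)
  have hq0 : 0 < q := Nat.ceil_pos.2 (by positivity)
  have hdl : Real.log N + 1 ≤ δ * d := by
    have := Nat.le_ceil ((Real.log N + 1) / δ)
    rw [div_le_iff₀ hδ0] at this
    linarith
  have hql : 32 * (k : ℝ) ≤ δ * q := by
    have := Nat.le_ceil (32 * (k : ℝ) / δ)
    rw [div_le_iff₀ hδ0] at this
    linarith
  have hdu : δ * d ≤ 3 * Real.log N := by
    have := Nat.ceil_lt_add_one (a := (Real.log N + 1) / δ) (by positivity)
    have h2 : δ * d ≤ δ * ((Real.log N + 1) / δ + 1) := by gcongr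
    rw [mul_add, mul_div_cancel₀ _ hδ0.ne'] at h2
    linarith
  have hqu : δ * q ≤ 33 * k := by
    have := Nat.ceil_lt_add_one (a := 32 * (k : ℝ) / δ) (by positivity)
    have h2 : δ * q ≤ δ * (32 * (k : ℝ) / δ + 1) := by gcongr
    rw [mul_add, mul_div_cancel₀ _ hδ0.ne'] at h2
    linarith
  obtain ⟨F, hF⟩ := exists_expander (N := N) (d := d) (q := q) (K := 2 * (2 * k)) hN0 hq0 δ hδ0
    (by push_cast; nlinarith) hdl
  let Φ : Matrix (Fin (d * q)) (Fin N) ℝ := fun r i =>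
    if F (finProdFinEquiv.symm r).1 i = (finProdFinEquiv.symm r).2 then 1 else 0
  have hnsp : ∀ h : Fin N → ℝ, Φ.mulVec h = 0 → ∀ T : Finset (Fin N), T.card ≤ 2 * k →
      ∑ i ∈ T, |h i| ≤ (4 * δ) * ∑ i, |h i| := by
    intro h hh T hT
    refine nsp hd0 (by omega) hkN δ hδ0 (by linarith) F hF h ?_ T hT
    intro t b
    have h1 := congrFun hh (finProdFinEquiv (t, b))
    simp only [Matrix.mulVec, dotProduct, Φ, Equiv.symm_apply_apply, Pi.zero_apply, ite_mul,
      one_mul, zero_mul] at h1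
    rw [Finset.sum_filter]
    exact h1
  obtain ⟨D, hD⟩ := decode (k := k) (by omega) Φ (4 * δ) (by linarith) (by positivity) hnsp
  refine ⟨d * q, Nat.mul_pos hd0 hq0, ?_, Φ, D, fun x w hw => ?_⟩
  · have h1 : (δ * d) * (δ * q) ≤ (3 * Real.log N) * (33 * k) := by gcongr
    have h2 : (3 * Real.log N) * (33 * k) ≤ 198 * k * Real.log ((N : ℝ) / k) := by nlinarith
    have h3 : (300000 : ℝ) * ((k : ℝ) / ε ^ 2) * Real.log ((N : ℝ) / k)
        = (300000 / 1024) * k * Real.log ((N : ℝ) / k) / δ ^ 2 := by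
      rw [hδ]; field_simp; norm_num
    rw [h3, le_div_iff₀ (by positivity)]
    push_cast
    have h4 : 0 ≤ k * Real.log ((N : ℝ) / k) := by
      have : 0 ≤ Real.log ((N : ℝ) / k) := by linarith
      positivity
    nlinarith
  · have h1 := hD x w hw
    have h2 : 8 * (4 * δ) = ε := by rw [hδ]; ring
    rwa [h2] at h1

/-- Main Theorem (measurement bound).  `x_[k]` is characterized as the minimizer of
`‖w - x‖₁` over all `k`-sparse `w`, so the `ℓ₁/ℓ₁` guarantee is stated as a bound
against every `k`-sparse vector `w`. -/
theorem main_theorem_measurement_bound :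
    ∀ γ : ℝ, 0 < γ →
    ∃ C c : ℝ, 0 < C ∧ 0 < c ∧
      ∀ N k : ℕ, 0 < N → 2 ≤ k →
      ∀ ε : ℝ, 0 < ε → ε < 1/4 →
      (N : ℝ) ≥ C * max ((k : ℝ)^2) ((k : ℝ) / ε^2) →
      ∃ m : ℕ, 0 < m ∧
        (m : ℝ) ≤ C * ((k : ℝ) / ε) * Real.log ((N : ℝ) / k) *
            ((Real.log N / Real.log k) ^ γ + 1/ε) ∧
        (ε ≤ c * (Real.log k / Real.log N) ^ γ →
          (m : ℝ) ≤ C * ((k : ℝ) / ε^2) * Real.log ((N : ℝ) / k)) ∧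
        ∃ (Φ : Matrix (Fin m) (Fin N) ℝ) (D : (Fin m → ℝ) → (Fin N → ℝ)),
          ∀ x : Fin N → ℝ, ∀ w : Fin N → ℝ, (fsupp w).card ≤ k →
            l1 (D (Φ.mulVec x) - x) ≤ (1 + ε) * l1 (w - x) := by
  intro γ _
  refine ⟨300000, 1, by norm_num, one_pos, ?_⟩
  intro N k hN0 hk ε hε hε' hN
  have hk' : (2 : ℝ) ≤ k := by exact_mod_cast hk
  have hN4 : 4 * (k : ℝ) ^ 2 ≤ N := by
    have := le_max_left ((k : ℝ)^2) ((k : ℝ) / ε^2)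
    nlinarith [sq_nonneg (k : ℝ)]
  obtain ⟨m, hm, hmb, hΦ⟩ := core hk ε hε hε' hN4
  refine ⟨m, hm, hmb.trans ?_, fun _ => hmb, hΦ⟩
  have hNk : (1 : ℝ) ≤ (N : ℝ) / k := by
    rw [le_div_iff₀ (by linarith)]
    nlinarith
  have hlog : 0 ≤ Real.log ((N : ℝ) / k) := Real.log_nonneg hNk
  have hX : 0 ≤ (Real.log N / Real.log k) ^ γ :=
    Real.rpow_nonneg (div_nonneg (Real.log_natCast_nonneg N) (Real.log_natCast_nonneg k)) γ
  calc 300000 * ((k : ℝ) / ε ^ 2) * Real.log ((N : ℝ) / k)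
      = 300000 * ((k : ℝ) / ε) * Real.log ((N : ℝ) / k) * (0 + 1 / ε) := by
        field_simp; ring
    _ ≤ _ := by gcongr
end

section
/- Weak system correctness: For every ζ ∈ (0,1/4) there exist constants c₁, c₂, C > 0 such that the following holds for all positive integers N, s, m, d and every η ∈ (0,1). Let Φ ∈ {0,1}^{m×N} be the adjacency matrix of a d-left-regular bipartite graph G with left part [N] and m right nodes that is an (N, m, d, 4s, c₁·η)-bipartite expander and satisfies the (⌈9s/η⌉, c₂·η, 1/4)-isolation property. For i ∈ [N] let x'_i be the median over the d neighbours u ∈ Γ({i}) of the bucket sums (Φx)_u, and given a set I ⊆ [N], let x̂ be x' restricted to the (at most) C·s entries i ∈ I of largest magnitude |x'_i| and zero elsewhere. Then for every x ∈ ℝ^N admitting a decomposition x = y + z with |supp(y)| ≤ s and ‖z‖₁ ≤ 3/2, and every I ⊆ [N] with |I ∩ supp(y)| ≥ (1 − ζ/2)·|supp(y)|, there exist ŷ, ẑ ∈ ℝ^N with x = x̂ + ŷ + ẑ, |supp(ŷ)| ≤ ζ·s, and ‖ẑ‖₁ ≤ ‖z‖₁ + η. -/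
open Classical in
noncomputable def nbrSet {L R D : Type*} [Fintype D] (nbr : L → D → R) (S : Finset L) :
    Finset R :=
  S.biUnion (fun i => Finset.image (nbr i) Finset.univ)

/-- The `(ℓ, ε)`-bipartite-expander property for the `|D|`-left-regular bipartite graph
whose left vertex `i` has neighbours `nbr i j`, `j : D`. -/
def IsExpander {L R D : Type*} [Fintype D] (ℓ ε : ℝ) (nbr : L → D → R) : Prop :=
  ∀ S : Finset L, (S.card : ℝ) ≤ ℓ →
    (1 - ε) * (Fintype.card D) * S.card ≤ ((nbrSet nbr S).card : ℝ)

open Classical in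
/-- `U_S({x})`: right nodes adjacent to `x` but to no other element of `S`. -/
noncomputable def isolNbrs {L R D : Type*} [Fintype D] (nbr : L → D → R) (S : Finset L)
    (x : L) : Finset R :=
  (Finset.image (nbr x) Finset.univ).filter (fun u => ∀ z ∈ S, z ≠ x → ∀ j, nbr z j ≠ u)

/-- The `(L₀, η, ζ)`-isolation property. -/
def HasIsolation {L R D : Type*} [Fintype D] (L₀ : ℕ) (η ζ : ℝ) (nbr : L → D → R) : Prop :=
  ∀ S : Finset L, S.card ≤ L₀ →
    ∃ S' ⊆ S, (1 - η) * S.card ≤ (S'.card : ℝ) ∧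
      ∀ x ∈ S', (1 - ζ) * (Fintype.card D) ≤ ((isolNbrs nbr S x).card : ℝ)

open Classical in
/-- `(Φx)_u`, the sum of `x` over the left vertices adjacent to the right node `u`. -/
noncomputable def bucketSum {L R D : Type*} [Fintype L] [Fintype D] (nbr : L → D → R)
    (x : L → ℝ) (u : R) : ℝ :=
  ∑ i ∈ Finset.univ.filter (fun i => ∃ j, nbr i j = u), x i

/-- The `⌈d/2⌉`-th smallest of `d` reals. -/
noncomputable def medianVal {d : ℕ} (v : Fin d → ℝ) : ℝ :=
  ((Multiset.map v Finset.univ.val).sort (· ≤ ·)).getD ((d + 1) / 2 - 1) 0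

lemma exists_top_s1 {ι : Type*} [DecidableEq ι] (b : ι → ℝ) (W : Finset ι) (k : ℕ) (hk : k ≤ W.card) :
    ∃ K ⊆ W, K.card = k ∧ ∀ i ∈ K, ∀ j ∈ W \ K, b j ≤ b i := by
  induction k with
  | zero => exact ⟨∅, by simp, by simp, by simp⟩
  | succ k ih =>
    obtain ⟨K, hKW, hKc, hK⟩ := ih (by omega)
    have hne : (W \ K).Nonempty := by
      rw [← Finset.card_pos, Finset.card_sdiff_of_subset hKW]; omega
    obtain ⟨m, hm, hmax⟩ := Finset.exists_max_image (W \ K) b hne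
    have hm' := Finset.mem_sdiff.1 hm
    refine ⟨insert m K, ?_, ?_, ?_⟩
    · intro i hi
      rcases Finset.mem_insert.1 hi with rfl | h
      · exact hm'.1
      · exact hKW h
    · rw [Finset.card_insert_of_notMem hm'.2, hKc]
    · intro i hi j hj
      have hj' : j ∈ W \ K := by
        simp only [Finset.mem_sdiff, Finset.mem_insert, not_or] at hj ⊢
        exact ⟨hj.1, hj.2.2⟩
      rcases Finset.mem_insert.1 hi with rfl | h
      · exact hmax j hj'
      · exact hK i h j hj'

lemma weighted_bound {ι : Type*} [DecidableEq ι] (a b : ι → ℝ) (W : Finset ι) (s : ℕ) (hs : 0 < s)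
    (ha : ∀ i ∈ W, 0 ≤ a i) (hb : ∀ i, 0 ≤ b i) (τ M : ℝ) (hτ0 : 0 ≤ τ) (hτ : ∀ i ∈ W, a i ≤ τ)
    (hM : ∀ K ⊆ W, K.card ≤ s → ∑ i ∈ K, b i ≤ M) :
    ∑ i ∈ W, a i * b i ≤ τ * M + M / s * ∑ i ∈ W, a i := by
  have hM0 : 0 ≤ M := by simpa using hM ∅ (by simp) (by simp)
  have hs' : (0:ℝ) < s := by exact_mod_cast hs
  have key : ∀ K ⊆ W, K.card ≤ s → ∑ i ∈ K, a i * b i ≤ τ * M := by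
    intro K hK hc
    calc ∑ i ∈ K, a i * b i ≤ ∑ i ∈ K, τ * b i :=
          Finset.sum_le_sum fun i hi => mul_le_mul_of_nonneg_right (hτ i (hK hi)) (hb i)
      _ = τ * ∑ i ∈ K, b i := by rw [Finset.mul_sum]
      _ ≤ τ * M := mul_le_mul_of_nonneg_left (hM K hK hc) hτ0
  by_cases hW : W.card ≤ s
  · have h1 := key W (Finset.Subset.refl _) hW
    have h2 : 0 ≤ M / s * ∑ i ∈ W, a i :=
      mul_nonneg (div_nonneg hM0 hs'.le) (Finset.sum_nonneg ha)
    linarith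
  · push Not at hW
    obtain ⟨K, hKW, hKc, hK⟩ := exists_top_s1 b W s hW.le
    have h1 := key K hKW hKc.le
    rw [← Finset.sum_sdiff hKW]
    have h2 : ∑ i ∈ W \ K, a i * b i ≤ ∑ i ∈ W \ K, M / s * a i := by
      refine Finset.sum_le_sum fun j hj => ?_
      have hbj : b j ≤ M / s := by
        rw [le_div_iff₀ hs']
        calc b j * s = ∑ i ∈ K, b j := by simp [hKc, mul_comm]
          _ ≤ ∑ i ∈ K, b i := Finset.sum_le_sum fun i hi => hK i hi j hj
          _ ≤ M := hM K hKW hKc.le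
      have := ha j (Finset.mem_sdiff.1 hj).1
      nlinarith
    have h3 : ∑ i ∈ W \ K, M / s * a i ≤ M / s * ∑ i ∈ W, a i := by
      rw [← Finset.mul_sum]
      exact mul_le_mul_of_nonneg_left
        (Finset.sum_le_sum_of_subset_of_nonneg Finset.sdiff_subset fun i hi _ => ha i hi)
        (div_nonneg hM0 hs'.le)
    linarith

lemma median_close {d : ℕ} (hd : 0 < d) (v : Fin d → ℝ) (a δ : ℝ)
    (h : d < 2 * (Finset.univ.filter (fun j => |v j - a| ≤ δ)).card) :
    |medianVal v - a| ≤ δ := by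
  set l := (Multiset.map v Finset.univ.val).sort (· ≤ ·) with hl
  have hlen : l.length = d := by simp [hl]
  have hsort : l.Pairwise (· ≤ ·) := Multiset.pairwise_sort _ _
  have hcoe : (l : Multiset ℝ) = Multiset.map v Finset.univ.val := Multiset.sort_eq _ _
  have hcount : (Finset.univ.filter (fun j => |v j - a| ≤ δ)).card
      = l.countP (fun t => decide (|t - a| ≤ δ)) := by
    have h1 : Multiset.countP (fun t => |t - a| ≤ δ) (l : Multiset ℝ)
        = l.countP (fun t => decide (|t - a| ≤ δ)) := Multiset.coe_countP _ _
    rw [← h1, hcoe, Multiset.countP_map]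
    rfl
  rw [hcount] at h
  set p := (d + 1) / 2 - 1 with hp
  have hpl : p < l.length := by omega
  have hmed : medianVal v = l[p] := by
    unfold medianVal
    rw [← hl, ← hp, List.getD_eq_getElem _ _ hpl]
  rw [hmed]
  have hmono : ∀ i j (hi : i < l.length) (hj : j < l.length), i ≤ j → l[i] ≤ l[j] := by
    intro i j hi hj hij
    rcases hij.eq_or_lt with rfl | hlt
    · exact le_rfl
    · exact List.pairwise_iff_getElem.1 hsort i j hi hj hlt
  by_contra hcon
  rw [abs_le, not_and_or] at hcon
  rcases hcon with hc | hc
  · -- the median is too small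
    have hsplit : l.countP (fun t => decide (|t - a| ≤ δ)) =
        (l.take (p+1)).countP (fun t => decide (|t - a| ≤ δ)) +
        (l.drop (p+1)).countP (fun t => decide (|t - a| ≤ δ)) := by
      rw [← List.countP_append, List.take_append_drop]
    have h0 : (l.take (p+1)).countP (fun t => decide (|t - a| ≤ δ)) = 0 := by
      rw [List.countP_eq_zero]
      intro t ht
      obtain ⟨i, hi, rfl⟩ := List.getElem_of_mem ht
      simp only [List.length_take] at hi
      have := hmono i p (by omega) hpl (by omega)
      simp only [List.getElem_take, decide_eq_true_eq, abs_le, not_and_or]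
      left
      linarith
    have h1 := List.countP_le_length (p := fun t => decide (|t - a| ≤ δ)) (l := l.drop (p+1))
    rw [List.length_drop] at h1
    omega
  · have hsplit : l.countP (fun t => decide (|t - a| ≤ δ)) =
        (l.take p).countP (fun t => decide (|t - a| ≤ δ)) +
        (l.drop p).countP (fun t => decide (|t - a| ≤ δ)) := by
      rw [← List.countP_append, List.take_append_drop]
    have h0 : (l.drop p).countP (fun t => decide (|t - a| ≤ δ)) = 0 := by
      rw [List.countP_eq_zero]
      intro t ht
      obtain ⟨i, hi, rfl⟩ := List.getElem_of_mem ht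
      simp only [List.length_drop] at hi
      have := hmono p (p + i) hpl (by omega) (by omega)
      simp only [List.getElem_drop, decide_eq_true_eq, abs_le, not_and_or]
      right
      linarith
    have h1 := List.countP_le_length (p := fun t => decide (|t - a| ≤ δ)) (l := l.take p)
    rw [List.length_take] at h1
    omega

section
open Classical

lemma card_nb_le {L R D : Type*} [Fintype D] (nbr : L → D → R) (k : L) :
    (Finset.image (nbr k) Finset.univ).card ≤ Fintype.card D := Finset.card_image_le

lemma expand_noise {L R D : Type*} [Fintype D] (nbr : L → D → R) (s : ℕ) (ε : ℝ) (hε : 0 ≤ ε)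
    (hexp : IsExpander (4 * s : ℝ) ε nbr) (B K : Finset L) (hB : B.card ≤ 3 * s)
    (hK : K.card ≤ s) (hdis : Disjoint K B) :
    ∑ k ∈ K, (((nbrSet nbr B).filter (fun u => ∃ j, nbr k j = u)).card : ℝ)
      ≤ 4 * ε * Fintype.card D * s := by
  have hcard : (K ∪ B).card = K.card + B.card := Finset.card_union_of_disjoint hdis
  have h1 := hexp (K ∪ B) (by rw [hcard]; exact_mod_cast (by omega : K.card + B.card ≤ 4 * s))
  have h2 : nbrSet nbr (K ∪ B) ⊆ nbrSet nbr B ∪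
      K.biUnion (fun k => (Finset.image (nbr k) Finset.univ).filter (fun u => u ∉ nbrSet nbr B)) := by
    intro u hu
    simp only [nbrSet, Finset.mem_biUnion, Finset.mem_union, Finset.mem_filter] at hu ⊢
    obtain ⟨i, hi, hu⟩ := hu
    by_cases hb : ∃ a ∈ B, u ∈ Finset.image (nbr a) Finset.univ
    · exact Or.inl hb
    · rcases hi with hi | hi
      · exact Or.inr ⟨i, hi, hu, hb⟩
      · exact Or.inl ⟨i, hi, hu⟩
  have h3 := (Finset.card_le_card h2).trans (Finset.card_union_le _ _)
  have h4 : (nbrSet nbr B).card ≤ B.card * Fintype.card D :=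
    Finset.card_biUnion_le_card_mul _ _ _ fun k _ => card_nb_le nbr k
  have h5 : (K.biUnion (fun k => (Finset.image (nbr k) Finset.univ).filter
      (fun u => u ∉ nbrSet nbr B))).card +
      ∑ k ∈ K, ((nbrSet nbr B).filter (fun u => ∃ j, nbr k j = u)).card
      ≤ K.card * Fintype.card D := by
    refine (Nat.add_le_add_right Finset.card_biUnion_le _).trans ?_
    rw [← Finset.sum_add_distrib, ← smul_eq_mul, ← Finset.sum_const]
    refine Finset.sum_le_sum fun k _ => ?_
    have he : (nbrSet nbr B).filter (fun u => ∃ j, nbr k j = u) =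
        (Finset.image (nbr k) Finset.univ).filter (fun u => u ∈ nbrSet nbr B) := by
      ext u; simp [and_comm]
    rw [he, add_comm, Finset.card_filter_add_card_filter_not]
    exact card_nb_le nbr k
  have h6 : ((nbrSet nbr (K ∪ B)).card : ℝ) +
      ∑ k ∈ K, (((nbrSet nbr B).filter (fun u => ∃ j, nbr k j = u)).card : ℝ)
      ≤ (K.card + B.card) * Fintype.card D := by
    exact_mod_cast (by nlinarith : (nbrSet nbr (K ∪ B)).card +
      ∑ k ∈ K, ((nbrSet nbr B).filter (fun u => ∃ j, nbr k j = u)).card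
      ≤ (K.card + B.card) * Fintype.card D)
  rw [hcard] at h1
  push_cast at h1
  have h7 : ((K.card : ℝ) + B.card) ≤ 4 * s := by
    exact_mod_cast (by omega : K.card + B.card ≤ 4 * s)
  have h8 : ε * Fintype.card D * (K.card + B.card) ≤ ε * Fintype.card D * (4 * s) :=
    mul_le_mul_of_nonneg_left h7 (by positivity)
  linarith

/-- noise mass in a bucket coming from outside of `S` -/
noncomputable def noiseAt {L R D : Type*} [Fintype L] [Fintype D] (nbr : L → D → R) (S : Finset L)
    (z : L → ℝ) (u : R) : ℝ := ∑ k ∈ Sᶜ.filter (fun k => ∃ j, nbr k j = u), |z k|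

lemma noise_bad_card {L R D : Type*} [Fintype L] [Fintype D] [Nonempty D]
    (nbr : L → D → R) (s : ℕ) (hs : 0 < s)
    (ε : ℝ) (hε : 0 ≤ ε) (hε' : ε ≤ 1/16)
    (hexp : IsExpander (4 * s : ℝ) ε nbr) (S B : Finset L) (hB : B.card ≤ 3 * s) (hBS : B ⊆ S)
    (z : L → ℝ) (hz : ∑ i, |z i| ≤ 3/2) (τ δ : ℝ) (hδ : 0 < δ) (hτ0 : 0 ≤ τ) (hτ1 : τ * s ≤ 1/4)
    (hτ : ∀ k, k ∉ S → |z k| ≤ τ)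
    (hbad : ∀ i ∈ B, (Fintype.card D : ℝ) / 8 <
      ((Finset.image (nbr i) Finset.univ).filter (fun u => δ < noiseAt nbr S z u)).card) :
    δ * B.card ≤ 112 * ε := by
  have hs' : (0:ℝ) < s := by exact_mod_cast hs
  have hd : (0:ℝ) < Fintype.card D := by exact_mod_cast Fintype.card_pos
  have hw0 : ∀ u, 0 ≤ noiseAt nbr S z u := fun u => Finset.sum_nonneg fun _ _ => abs_nonneg _
  -- upper bound
  have hup : ∑ u ∈ nbrSet nbr B, noiseAt nbr S z u ≤ 7 * ε * Fintype.card D := by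
    have e1 : ∑ u ∈ nbrSet nbr B, noiseAt nbr S z u =
        ∑ k ∈ Sᶜ, |z k| * (((nbrSet nbr B).filter (fun u => ∃ j, nbr k j = u)).card : ℝ) := by
      unfold noiseAt
      simp_rw [Finset.sum_filter]
      rw [Finset.sum_comm]
      refine Finset.sum_congr rfl fun k _ => ?_
      rw [← Finset.sum_filter, Finset.sum_const, nsmul_eq_mul, mul_comm]
    rw [e1]
    have h := weighted_bound (fun k => |z k|)
      (fun k => (((nbrSet nbr B).filter (fun u => ∃ j, nbr k j = u)).card : ℝ)) Sᶜ s hs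
      (fun _ _ => abs_nonneg _) (fun _ => by positivity) τ (4 * ε * Fintype.card D * s) hτ0
      (fun k hk => hτ k (by simpa using hk))
      (fun K hK hKc => expand_noise nbr s ε hε hexp B K hB hKc (by
        rw [Finset.disjoint_left]
        intro k hk hkB
        exact (Finset.mem_compl.1 (hK hk)) (hBS hkB)))
    refine h.trans ?_
    have h2 : ∑ k ∈ Sᶜ, |z k| ≤ 3/2 :=
      (Finset.sum_le_sum_of_subset_of_nonneg (Finset.subset_univ _)
        fun _ _ _ => abs_nonneg _).trans hz
    have h3 : 4 * ε * Fintype.card D * s / s = 4 * ε * Fintype.card D := by field_simp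
    rw [h3]
    have h4 : 0 ≤ 4 * ε * (Fintype.card D : ℝ) := by positivity
    nlinarith [mul_le_mul_of_nonneg_left h2 h4, mul_le_mul_of_nonneg_left hτ1 h4]
  -- lower bound
  set F := (nbrSet nbr B).filter (fun u => δ < noiseAt nbr S z u) with hF
  have hlow : δ * F.card ≤ ∑ u ∈ nbrSet nbr B, noiseAt nbr S z u := by
    calc δ * F.card = ∑ u ∈ F, δ := by simp [mul_comm]
      _ ≤ ∑ u ∈ F, noiseAt nbr S z u :=
        Finset.sum_le_sum fun u hu => (Finset.mem_filter.1 hu).2.le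
      _ ≤ _ := Finset.sum_le_sum_of_subset_of_nonneg (Finset.filter_subset _ _) fun u _ _ => hw0 u
  have hFc : (Fintype.card D : ℝ) * B.card / 16 ≤ F.card := by
    have h1 := hexp B (by
      have : (B.card : ℝ) ≤ 3 * s := by exact_mod_cast hB
      linarith)
    have h2 : nbrSet nbr B ⊆ F ∪ B.biUnion (fun i => (Finset.image (nbr i) Finset.univ).filter
        (fun u => ¬ δ < noiseAt nbr S z u)) := by
      intro u hu
      by_cases hb : δ < noiseAt nbr S z u
      · exact Finset.mem_union_left _ (Finset.mem_filter.2 ⟨hu, hb⟩)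
      · apply Finset.mem_union_right
        simp only [nbrSet, Finset.mem_biUnion] at hu
        obtain ⟨i, hi, hu⟩ := hu
        exact Finset.mem_biUnion.2 ⟨i, hi, Finset.mem_filter.2 ⟨hu, hb⟩⟩
    have h3 : ((nbrSet nbr B).card : ℝ) ≤ F.card + ∑ i ∈ B,
        (((Finset.image (nbr i) Finset.univ).filter
          (fun u => ¬ δ < noiseAt nbr S z u)).card : ℝ) := by
      exact_mod_cast (Finset.card_le_card h2).trans ((Finset.card_union_le _ _).trans
        (Nat.add_le_add_left Finset.card_biUnion_le _))
    have h4 : ∑ i ∈ B, (((Finset.image (nbr i) Finset.univ).filter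
          (fun u => ¬ δ < noiseAt nbr S z u)).card : ℝ) ≤
          ∑ i ∈ B, (7/8 * Fintype.card D : ℝ) := by
      refine Finset.sum_le_sum fun i hi => ?_
      have h5 := hbad i hi
      have h6 : ((((Finset.image (nbr i) Finset.univ).filter
          (fun u => δ < noiseAt nbr S z u)).card : ℝ) +
          ((Finset.image (nbr i) Finset.univ).filter
          (fun u => ¬ δ < noiseAt nbr S z u)).card) ≤ Fintype.card D := by
        exact_mod_cast (Finset.card_filter_add_card_filter_not _).le.trans (card_nb_le nbr i)
      linarith
    rw [Finset.sum_const, nsmul_eq_mul] at h4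
    have h7 : ε * (Fintype.card D * B.card : ℝ) ≤ 1/16 * (Fintype.card D * B.card) :=
      mul_le_mul_of_nonneg_right hε' (by positivity)
    nlinarith
  have h8 : δ * (Fintype.card D * B.card / 16) ≤ 7 * ε * Fintype.card D :=
    (mul_le_mul_of_nonneg_left hFc hδ.le).trans (hlow.trans hup)
  have h9 : (δ * B.card) * (Fintype.card D : ℝ) ≤ (112 * ε) * Fintype.card D := by linarith
  exact le_of_mul_le_mul_right h9 hd

lemma good_estimate {L R : Type*} [Fintype L] {d : ℕ} (hd : 0 < d) (nbr : L → Fin d → R)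
    (S : Finset L) (x z : L → ℝ) (hxz : ∀ k, k ∉ S → x k = z k) (δ : ℝ) (i : L)
    (hi : i ∈ S)
    (hiso : (1 - 1/4) * (d : ℝ) ≤ (isolNbrs nbr S i).card)
    (hgood : ¬ (d : ℝ) / 8 <
      ((Finset.image (nbr i) Finset.univ).filter (fun u => δ < noiseAt nbr S z u)).card) :
    |medianVal (fun jj => bucketSum nbr x (nbr i jj)) - x i| ≤ δ := by
  apply median_close hd
  set J := Finset.univ.filter (fun j => |bucketSum nbr x (nbr i j) - x i| ≤ δ) with hJ
  have hsub : isolNbrs nbr S i ⊆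
      ((Finset.image (nbr i) Finset.univ).filter (fun u => δ < noiseAt nbr S z u)) ∪
        J.image (nbr i) := by
    intro u hu
    simp only [isolNbrs, Finset.mem_filter, Finset.mem_image, Finset.mem_univ, true_and] at hu
    obtain ⟨⟨j, rfl⟩, hu⟩ := hu
    by_cases hb : δ < noiseAt nbr S z (nbr i j)
    · exact Finset.mem_union_left _ (Finset.mem_filter.2 ⟨by simp, hb⟩)
    · refine Finset.mem_union_right _ (Finset.mem_image.2 ⟨j, ?_, rfl⟩)
      simp only [hJ, Finset.mem_filter, Finset.mem_univ, true_and]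
      refine le_trans ?_ (not_lt.1 hb)
      have hset : Finset.univ.filter (fun k => ∃ j', nbr k j' = nbr i j) =
          insert i (Sᶜ.filter (fun k => ∃ j', nbr k j' = nbr i j)) := by
        ext k
        simp only [Finset.mem_filter, Finset.mem_univ, true_and, Finset.mem_insert,
          Finset.mem_compl]
        constructor
        · rintro ⟨j', h⟩
          by_cases hk : k = i
          · exact Or.inl hk
          · exact Or.inr ⟨fun hkS => hu k hkS hk j' h, j', h⟩
        · rintro (rfl | h)
          · exact ⟨j, rfl⟩
          · exact h.2
      have he : bucketSum nbr x (nbr i j) - x i =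
          ∑ k ∈ Sᶜ.filter (fun k => ∃ j', nbr k j' = nbr i j), z k := by
        have hbs : bucketSum nbr x (nbr i j) =
            ∑ k ∈ Finset.univ.filter (fun k => ∃ j', nbr k j' = nbr i j), x k := by
          unfold bucketSum
          congr!
        rw [hbs, hset, Finset.sum_insert (by simp [hi]), add_sub_cancel_left]
        refine Finset.sum_congr rfl fun k hk => hxz k ?_
        simpa using (Finset.mem_filter.1 hk).1
      rw [he]
      refine (Finset.abs_sum_le_sum_abs _ _).trans (le_of_eq ?_)
      unfold noiseAt
      congr!
  have h1 : (isolNbrs nbr S i).card ≤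
      ((Finset.image (nbr i) Finset.univ).filter (fun u => δ < noiseAt nbr S z u)).card +
        J.card := (Finset.card_le_card hsub).trans ((Finset.card_union_le _ _).trans
          (Nat.add_le_add_left Finset.card_image_le _))
  have h2 : ((isolNbrs nbr S i).card : ℝ) ≤
      ((Finset.image (nbr i) Finset.univ).filter (fun u => δ < noiseAt nbr S z u)).card +
        J.card := by exact_mod_cast h1
  have hd' : (0:ℝ) < d := by exact_mod_cast hd
  have h3 : (d : ℝ) < 2 * J.card := by linarith
  exact_mod_cast h3

end

lemma match_sum {ι : Type*} (M G : Finset ι) (f g : ι → ℝ) (c : ℝ) (hMG : M.card ≤ G.card)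
    (hg : ∀ i ∈ G, 0 ≤ g i) (h : ∀ i ∈ G, ∀ j ∈ M, f j ≤ g i + c) :
    ∑ j ∈ M, f j ≤ ∑ i ∈ G, g i + M.card * c := by
  obtain ⟨G', hG', hc⟩ := Finset.exists_subset_card_eq hMG
  let e := Finset.equivOfCardEq hc
  have h1 : ∑ j ∈ M, f j = ∑ i ∈ G'.attach, f (e i) := by
    rw [← Finset.sum_coe_sort M, ← Finset.univ_eq_attach]
    exact (Equiv.sum_comp e (fun j : M => f j)).symm
  rw [h1]
  calc ∑ i ∈ G'.attach, f (e i) ≤ ∑ i ∈ G'.attach, (g i + c) :=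
        Finset.sum_le_sum fun i _ => h i (hG' i.2) _ (e i).2
    _ = ∑ i ∈ G', (g i + c) := Finset.sum_attach G' (fun i => g i + c)
    _ = ∑ i ∈ G', g i + M.card * c := by rw [Finset.sum_add_distrib]; simp [hc]
    _ ≤ _ := by
      have := Finset.sum_le_sum_of_subset_of_nonneg hG' (fun i hi _ => hg i hi)
      linarith

/-- The deterministic accounting, given a small set `Bad` outside of which the estimates
are accurate. -/
lemma accounting {N : ℕ} (ζ η : ℝ) (hζ : 0 < ζ) (hζ1 : ζ < 1/4) (hη : 0 < η) (s : ℕ) (hs : 0 < s)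
    (x y z x' : Fin N → ℝ) (hx : x = y + z) (hy : (fsupp y).card ≤ s)
    (I T Bad : Finset (Fin N))
    (hI : (1 - ζ/2) * ((fsupp y).card : ℝ) ≤ ((I ∩ fsupp y).card : ℝ))
    (hTI : T ⊆ I) (hT : T.card = min I.card (2 * s))
    (htop : ∀ i ∈ T, ∀ j ∈ I \ T, |x' j| ≤ |x' i|)
    (hBad : (Bad.card : ℝ) ≤ ζ / 2 * s)
    (hgood : ∀ i ∈ T ∪ fsupp y, i ∉ Bad → |x' i - x i| ≤ η / (4 * s)) :
    ∃ yh zh : Fin N → ℝ, x = (fun i => if i ∈ T then x' i else 0) + yh + zh ∧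
      ((fsupp yh).card : ℝ) ≤ ζ * s ∧ l1 zh ≤ l1 z + η := by
  have hs' : (0:ℝ) < s := by exact_mod_cast hs
  set δ := η / (4 * s) with hδ
  have hδ0 : 0 < δ := by positivity
  have hδs : δ * s = η / 4 := by rw [hδ]; field_simp
  have hyz : ∀ i, i ∉ fsupp y → x i = z i := by
    intro i hi
    have : y i = 0 := by simpa [fsupp] using hi
    simp [hx, this]
  set Q := Bad ∪ (fsupp y \ I) with hQ
  set M := ((I ∩ fsupp y) \ T) \ Bad with hM
  set G := (T \ fsupp y) \ Bad with hG
  have hMG : M.card ≤ G.card := by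
    by_cases hTc : T.card = I.card
    · have : T = I := Finset.eq_of_subset_of_card_le hTI hTc.ge
      have : M = ∅ := by rw [hM, this]; ext i; simp; tauto
      simp [this]
    · have hT2 : T.card = 2 * s := by omega
      have hb : Bad.card ≤ s := by
        have : (Bad.card : ℝ) ≤ s := by nlinarith
        exact_mod_cast this
      have h1 : M.card ≤ (fsupp y \ T).card := by
        apply Finset.card_le_card
        intro i; simp [hM]; tauto
      have h2 := Finset.card_sdiff_add_card_inter (fsupp y) T
      have h3 := Finset.card_sdiff_add_card_inter T (fsupp y)
      have h4 := Finset.le_card_sdiff Bad (T \ fsupp y)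
      rw [Finset.inter_comm] at h3
      rw [← hG] at h4
      omega
  have hMs : (M.card : ℝ) ≤ s := by
    have : M.card ≤ (fsupp y).card := by
      apply Finset.card_le_card
      intro i; simp [hM]; tauto
    exact_mod_cast this.trans hy
  have hTs : (T.card : ℝ) ≤ 2 * s := by
    have : T.card ≤ 2 * s := by omega
    exact_mod_cast this
  have hmatch := match_sum M G (fun i => |x i|) (fun i => |z i|) (2 * δ) hMG
    (fun _ _ => abs_nonneg _) (by
      intro i hi j hj
      simp only [hG, hM, Finset.mem_sdiff, Finset.mem_inter] at hi hj
      have h1 := hgood i (Finset.mem_union_left _ hi.1.1) hi.2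
      have h2 := hgood j (Finset.mem_union_right _ hj.1.1.2) hj.2
      have h3 := htop i hi.1.1 j (Finset.mem_sdiff.2 ⟨hj.1.1.1, hj.1.2⟩)
      rw [hyz i hi.1.2] at h1
      have h4 := abs_sub_abs_le_abs_sub (x' i) (z i)
      have h5 := abs_sub_abs_le_abs_sub (x j) (x' j)
      rw [abs_sub_comm] at h5
      show |x j| ≤ |z i| + 2 * δ
      linarith)
  set r : Fin N → ℝ := fun i => x i - (if i ∈ T then x' i else 0) with hr
  refine ⟨fun i => if i ∈ Q then r i else 0, fun i => if i ∈ Q then 0 else r i, ?_, ?_, ?_⟩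
  · funext i
    simp only [Pi.add_apply, hr]
    by_cases hiQ : i ∈ Q <;> simp [hiQ]
  · have h1 : (fsupp (fun i => if i ∈ Q then r i else 0)).card ≤ Q.card := by
      apply Finset.card_le_card
      intro i hi
      by_contra h
      simp [fsupp, h] at hi
    have h2 : (Q.card : ℝ) ≤ Bad.card + (fsupp y \ I).card := by
      exact_mod_cast Finset.card_union_le _ _
    have h3 : ((fsupp y \ I).card : ℝ) + (I ∩ fsupp y).card = (fsupp y).card := by
      rw [Finset.inter_comm]
      exact_mod_cast Finset.card_sdiff_add_card_inter (fsupp y) I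
    have h1' : ((fsupp (fun i => if i ∈ Q then r i else 0)).card : ℝ) ≤ Q.card := by
      exact_mod_cast h1
    have hy' : ((fsupp y).card : ℝ) ≤ s := by exact_mod_cast hy
    nlinarith
  · have hpt : ∀ i, |if i ∈ Q then 0 else r i| ≤ (if i ∈ T then δ else 0) +
        (if i ∈ M then |x i| else 0) + (if i ∈ (T ∪ fsupp y)ᶜ then |z i| else 0) := by
      intro i
      have n1 : 0 ≤ (if i ∈ T then δ else 0) := by split_ifs <;> positivity
      have n2 : 0 ≤ (if i ∈ M then |x i| else 0) := by split_ifs <;> positivity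
      have n3 : 0 ≤ (if i ∈ (T ∪ fsupp y)ᶜ then |z i| else 0) := by split_ifs <;> positivity
      by_cases hiQ : i ∈ Q
      · simp only [hiQ, if_true, abs_zero]; positivity
      · simp only [hiQ, if_false]
        have hq : i ∉ Bad ∧ (i ∈ fsupp y → i ∈ I) := by
          simp only [hQ, Finset.mem_union, Finset.mem_sdiff] at hiQ; tauto
        by_cases hiT : i ∈ T
        · have := hgood i (Finset.mem_union_left _ hiT) hq.1
          rw [abs_sub_comm] at this
          simp only [hr, hiT, if_true] at n1 ⊢
          linarith
        · by_cases hiy : i ∈ fsupp y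
          · have hiM : i ∈ M := by simp [hM, hiT, hiy, hq.1, hq.2 hiy]
            simp only [hr, hiT, hiM, if_true, if_false, sub_zero] at n3 ⊢
            linarith
          · have hic : i ∈ (T ∪ fsupp y)ᶜ := by simp [hiT, hiy]
            simp only [hr, hiT, hic, if_true, if_false, sub_zero, hyz i hiy] at n2 ⊢
            linarith
    have hsum : l1 (fun i => if i ∈ Q then 0 else r i) ≤
        T.card * δ + ∑ i ∈ M, |x i| + ∑ i ∈ (T ∪ fsupp y)ᶜ, |z i| := by
      unfold l1
      refine (Finset.sum_le_sum fun i _ => hpt i).trans ?_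
      rw [Finset.sum_add_distrib, Finset.sum_add_distrib, Finset.sum_ite_mem, Finset.sum_ite_mem,
        Finset.sum_ite_mem]
      simp
    have hGz : ∑ i ∈ G, |z i| + ∑ i ∈ (T ∪ fsupp y)ᶜ, |z i| ≤ l1 z := by
      rw [← Finset.sum_union (by
        rw [Finset.disjoint_left]
        intro i hi hi'
        simp only [hG, Finset.mem_sdiff, Finset.mem_compl, Finset.mem_union] at hi hi'
        tauto)]
      exact Finset.sum_le_sum_of_subset_of_nonneg (Finset.subset_univ _) fun _ _ _ => abs_nonneg _
    nlinarith [mul_le_mul_of_nonneg_right hMs hδ0.le, mul_le_mul_of_nonneg_right hTs hδ0.le]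

/-- Weak system correctness.  `x'_i` is the median of the bucket sums over the `d`
neighbours of `i`, and `x̂` (the estimate) is `x'` restricted to any set `T ⊆ I` of the
(at most) `C·s` entries of `I` of largest magnitude `|x'_i|`. -/
theorem weak_system_correct :
    ∀ ζ : ℝ, 0 < ζ → ζ < 1/4 →
    ∃ (c₁ c₂ : ℝ) (C : ℕ), 0 < c₁ ∧ 0 < c₂ ∧ 0 < C ∧
      ∀ N s m d : ℕ, 0 < N → 0 < s → 0 < m → 0 < d →
      ∀ η : ℝ, 0 < η → η < 1 →
      ∀ nbr : Fin N → Fin d → Fin m,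
        IsExpander (4 * s : ℝ) (c₁ * η) nbr →
        HasIsolation (Nat.ceil ((9 * s : ℝ) / η)) (c₂ * η) (1/4) nbr →
        ∀ x y z : Fin N → ℝ, x = y + z → (fsupp y).card ≤ s → l1 z ≤ 3/2 →
        ∀ I : Finset (Fin N),
          (1 - ζ/2) * ((fsupp y).card : ℝ) ≤ ((I ∩ fsupp y).card : ℝ) →
        ∀ T : Finset (Fin N), T ⊆ I → T.card = min I.card (C * s) →
          (∀ i ∈ T, ∀ j ∈ I \ T,
            |medianVal (fun jj => bucketSum nbr x (nbr j jj))| ≤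
              |medianVal (fun jj => bucketSum nbr x (nbr i jj))|) →
        ∃ yh zh : Fin N → ℝ,
          x = (fun i => if i ∈ T then medianVal (fun jj => bucketSum nbr x (nbr i jj)) else 0)
                + yh + zh ∧
          ((fsupp yh).card : ℝ) ≤ ζ * s ∧
          l1 zh ≤ l1 z + η := by
  classical
  intro ζ hζ hζ1
  refine ⟨ζ / 1792, ζ / 36, 2, by positivity, by positivity, by norm_num, ?_⟩
  intro N s m d hN hs hm hd η hη hη1 nbr hexp hisol x y z hx hy hz I hI T hTI hT htop
  have hs' : (0:ℝ) < s := by exact_mod_cast hs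
  have : Nonempty (Fin d) := ⟨⟨0, hd⟩⟩
  set δ := η / (4 * s) with hδ
  have hδ0 : 0 < δ := by positivity
  have hδs : δ * s = η / 4 := by rw [hδ]; field_simp
  set H := Finset.univ.filter (fun i => δ < |z i|) with hH
  set S := (T ∪ fsupp y) ∪ H with hS
  have hTy : (T ∪ fsupp y).card ≤ 3 * s := by
    have := Finset.card_union_le T (fsupp y)
    omega
  have hHc : (H.card : ℝ) ≤ 6 * s / η := by
    have h1 : δ * H.card ≤ 3 / 2 := by
      calc δ * H.card = ∑ i ∈ H, δ := by simp [mul_comm]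
        _ ≤ ∑ i ∈ H, |z i| := Finset.sum_le_sum fun i hi => (Finset.mem_filter.1 hi).2.le
        _ ≤ l1 z := Finset.sum_le_sum_of_subset_of_nonneg (Finset.subset_univ _)
            fun _ _ _ => abs_nonneg _
        _ ≤ 3 / 2 := hz
    rw [le_div_iff₀ hη]
    have h2 : η = 4 * (δ * s) := by linarith
    rw [h2]
    nlinarith
  have hSc : (S.card : ℝ) ≤ 9 * s / η := by
    have h1 : (S.card : ℝ) ≤ (T ∪ fsupp y).card + H.card := by
      exact_mod_cast Finset.card_union_le _ _
    have h2 : ((T ∪ fsupp y).card : ℝ) ≤ 3 * s := by exact_mod_cast hTy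
    have h3 : (3 * s : ℝ) ≤ 3 * s / η := by
      rw [le_div_iff₀ hη]; nlinarith
    have h4 : (9 * s / η : ℝ) = 3 * s / η + 6 * s / η := by ring
    linarith
  obtain ⟨S', hS'S, hS'c, hS'⟩ := hisol S (by
    have : (S.card : ℝ) ≤ (Nat.ceil ((9 * s : ℝ) / η) : ℕ) := hSc.trans (Nat.le_ceil _)
    exact_mod_cast this)
  set B2 := (T ∪ fsupp y).filter (fun i => (d : ℝ) / 8 <
      ((Finset.image (nbr i) Finset.univ).filter (fun u => δ < noiseAt nbr S z u)).card) with hB2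
  have hB2c : δ * B2.card ≤ 112 * (ζ / 1792 * η) := by
    refine noise_bad_card nbr s hs (ζ / 1792 * η) (by positivity) (by nlinarith) hexp S B2
      ((Finset.card_le_card (Finset.filter_subset _ _)).trans hTy)
      ((Finset.filter_subset _ _).trans Finset.subset_union_left) z hz δ δ hδ0 hδ0.le
      (by linarith) ?_ ?_
    · intro k hk
      by_contra h
      exact hk (Finset.mem_union_right _ (Finset.mem_filter.2 ⟨Finset.mem_univ _, not_le.1 h⟩))
    · intro i hi
      have h := (Finset.mem_filter.1 hi).2
      rw [Fintype.card_fin]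
      convert h
  have hB2s : (B2.card : ℝ) ≤ ζ / 4 * s := by
    have h1 : δ * B2.card ≤ δ * (ζ / 4 * s) := by
      have : δ * (ζ / 4 * s) = ζ / 4 * (δ * s) := by ring
      rw [this, hδs]
      linarith
    exact le_of_mul_le_mul_left h1 hδ0
  have hB1s : ((S \ S').card : ℝ) ≤ ζ / 4 * s := by
    have h1 : ((S \ S').card : ℝ) + S'.card = S.card := by
      exact_mod_cast Finset.card_sdiff_add_card_eq_card hS'S
    have h2 : ζ / 36 * η * S.card ≤ ζ / 36 * η * (9 * s / η) :=
      mul_le_mul_of_nonneg_left hSc (by positivity)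
    have h3 : ζ / 36 * η * (9 * s / η) = ζ / 4 * s := by field_simp; norm_num
    linarith
  refine accounting ζ η hζ hζ1 hη s hs x y z
    (fun i => medianVal (fun jj => bucketSum nbr x (nbr i jj))) hx hy I T ((S \ S') ∪ B2)
    (by convert hI) hTI hT (fun i hi j hj => htop i hi j (by simpa using hj)) ?_ ?_
  · have : (((S \ S') ∪ B2).card : ℝ) ≤ (S \ S').card + B2.card := by
      exact_mod_cast Finset.card_union_le _ _
    linarith
  · intro i hi hib
    have hi' : i ∈ T ∪ fsupp y := by simpa using hi
    have hiS : i ∈ S := Finset.mem_union_left _ hi'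
    simp only [Finset.mem_union, Finset.mem_sdiff, not_or, not_and, not_not] at hib
    have hiS' : i ∈ S' := hib.1 hiS
    refine good_estimate hd nbr S x z ?_ δ i hiS ?_ ?_
    · intro k hk
      have : k ∉ fsupp y := fun h => hk (Finset.mem_union_left _ (Finset.mem_union_right _ h))
      have : y k = 0 := by simpa [fsupp] using this
      simp [hx, this]
    · have := hS' i hiS'
      rwa [Fintype.card_fin] at this
    · intro h
      refine hib.2 (Finset.mem_filter.2 ⟨hi', ?_⟩)
      convert h
end

section
/- Two-layer expanding property (Lemma 3.3): There exist constants C, c > 0 such that for every ε ∈ (0, 1/4), every integer k ≥ 1 and every N ≥ C·max{k/ε², k²}, if B₁ ≥ C·k/ε², d₁ ≥ C·(1/ε)·log(N/k)/log(B₁/k), B₂ ≥ C·k/ε and d₂ ≥ C·log(B₁/k), then a random (N,B₁,d₁,B₂,d₂) two-layer hashing scheme induces an (N, B₂d₁d₂, d₁d₂, 4k, ε)-bipartite expander with probability at least 1 − N^{−c}. -/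
/-- The `(d₁d₂)`-left-regular bipartite graph induced by an instance `(g, h)` of the
`(N,B₁,d₁,B₂,d₂)` two-layer hashing scheme: `x` is mapped to `(h_{i,j}(g_i(x)), i, j)`. -/
def twoLayerNbr {N B₁ d₁ B₂ d₂ : ℕ}
    (gh : (Fin N → Fin d₁ → Fin B₁) × (Fin d₁ → Fin d₂ → Fin B₁ → Fin B₂)) :
    Fin N → Fin d₁ × Fin d₂ → Fin B₂ × Fin d₁ × Fin d₂ :=
  fun x p => (gh.2 p.1 p.2 (gh.1 x p.1), p.1, p.2)

open Classical in
lemma moment_one {α : Type*} [Fintype α] [DecidableEq α] {B : ℕ} (hB : 0 < B) (l t : ℝ) (hl : 0 ≤ l)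
    (T : Finset α) (hT : (T.card : ℝ) ≤ t) :
    ∑ f : α → Fin B, l ^ (T.card - (T.image f).card)
      ≤ (Fintype.card (α → Fin B) : ℝ) * (1 + l * t / B) ^ T.card := by
  have hB' : (0 : ℝ) < B := by exact_mod_cast hB
  induction T using Finset.induction_on with
  | empty => simp
  | insert x T hx ih =>
    have hc : ((insert x T).card : ℝ) = T.card + 1 := by
      rw [Finset.card_insert_of_notMem hx]; push_cast; rfl
    have hT' : (T.card : ℝ) ≤ t := by linarith
    have ht : 0 ≤ t := le_trans (Nat.cast_nonneg _) hT'
    have ih := ih hT'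
    let e := (Equiv.funSplitAt x (Fin B)).symm
    have himg : ∀ (b b' : Fin B) (r : {j // j ≠ x} → Fin B),
        T.image (e (b, r)) = T.image (e (b', r)) := by
      intro b b' r
      apply Finset.image_congr
      intro y hy
      have : y ≠ x := by rintro rfl; exact hx hy
      simp [e, Equiv.funSplitAt, Equiv.piSplitAt, this]
    have hval : ∀ (b : Fin B) (r : {j // j ≠ x} → Fin B), e (b, r) x = b := by
      intro b r
      simp [e, Equiv.funSplitAt, Equiv.piSplitAt]
    have key : ∀ r : {j // j ≠ x} → Fin B,
        ∑ b : Fin B, l ^ ((insert x T).card - ((insert x T).image (e (b, r))).card)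
          ≤ (1 + l * t / B) * ∑ b : Fin B, l ^ (T.card - (T.image (e (b, r))).card) := by
      intro r
      let b0 : Fin B := ⟨0, hB⟩
      set I := T.image (e (b0, r)) with hI
      have hIc : I.card ≤ T.card := Finset.card_image_le
      have h1 : ∀ b : Fin B, l ^ ((insert x T).card - ((insert x T).image (e (b, r))).card)
          ≤ l ^ (T.card - I.card) * (1 + if b ∈ I then l else 0) := by
        intro b
        have hp : 0 ≤ l ^ (T.card - I.card) := pow_nonneg hl _
        rw [Finset.image_insert, hval, himg b b0 r, Finset.card_insert_of_notMem hx, ← hI]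
        by_cases hb : b ∈ I
        · rw [Finset.insert_eq_of_mem hb, if_pos hb,
            show T.card + 1 - I.card = (T.card - I.card) + 1 by omega, pow_succ]
          nlinarith
        · rw [Finset.card_insert_of_notMem hb, if_neg hb,
            show T.card + 1 - (I.card + 1) = (T.card - I.card) by omega]
          simp
      refine (Finset.sum_le_sum (fun b _ => h1 b)).trans ?_
      have h2 : ∀ b : Fin B, l ^ (T.card - (T.image (e (b, r))).card) = l ^ (T.card - I.card) := by
        intro b; rw [himg b b0 r]
      rw [Finset.sum_congr rfl (fun b _ => h2 b), ← Finset.mul_sum, Finset.sum_add_distrib,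
        Finset.sum_ite_mem]
      simp only [Finset.sum_const, Finset.card_univ, Fintype.card_fin, nsmul_eq_mul,
        Finset.univ_inter, mul_one]
      have h3 : (I.card : ℝ) ≤ t := le_trans (by exact_mod_cast hIc) hT'
      have hp : 0 ≤ l ^ (T.card - I.card) := pow_nonneg hl _
      have h4 : (1 + l * t / B) * (B * l ^ (T.card - I.card))
          = l ^ (T.card - I.card) * (B + t * l) := by field_simp
      rw [h4]
      apply mul_le_mul_of_nonneg_left _ hp
      nlinarith
    have hsplit : ∀ F : (α → Fin B) → ℝ, ∑ f, F f = ∑ r, ∑ b, F (e (b, r)) := by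
      intro F
      rw [← Equiv.sum_comp e F, Fintype.sum_prod_type_right]
    rw [hsplit] at ih ⊢
    refine (Finset.sum_le_sum (fun r _ => key r)).trans ?_
    rw [← Finset.mul_sum, Finset.card_insert_of_notMem hx, pow_succ]
    have : 0 ≤ 1 + l * t / B := by positivity
    calc _ ≤ (1 + l * t / B) * _ := mul_le_mul_of_nonneg_left ih this
      _ = _ := by ring

open Classical in
lemma markov_many {ι α : Type*} [Fintype ι] [Fintype α] [DecidableEq ι] [DecidableEq α] {B : ℕ} (hB : 0 < B) (θ t m : ℝ)
    (T : ι → Finset α) (hT : ∀ i, ((T i).card : ℝ) ≤ t) (hθ : 0 ≤ θ) :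
    ∑ F : ι → α → Fin B,
        (if m ≤ ∑ i, (((T i).card - ((T i).image (F i)).card : ℕ) : ℝ) then (1 : ℝ) else 0)
      ≤ (Fintype.card (ι → α → Fin B) : ℝ) *
          Real.exp (Real.exp θ * t / B * t * Fintype.card ι - θ * m) := by
  have hB' : (0 : ℝ) < B := by exact_mod_cast hB
  have h1 : ∀ F : ι → α → Fin B,
      (if m ≤ ∑ i, (((T i).card - ((T i).image (F i)).card : ℕ) : ℝ) then (1 : ℝ) else 0)
      ≤ Real.exp (-(θ * m)) * ∏ i, Real.exp θ ^ ((T i).card - ((T i).image (F i)).card) := by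
    intro F
    have : ∏ i, Real.exp θ ^ ((T i).card - ((T i).image (F i)).card)
        = Real.exp (θ * ∑ i, (((T i).card - ((T i).image (F i)).card : ℕ) : ℝ)) := by
      rw [Finset.mul_sum, Real.exp_sum]
      refine Finset.prod_congr rfl (fun i _ => ?_)
      rw [← Real.exp_nat_mul, mul_comm]
    rw [this, ← Real.exp_add]
    split_ifs with h
    · apply Real.one_le_exp
      nlinarith
    · positivity
  refine (Finset.sum_le_sum (fun F _ => h1 F)).trans ?_
  rw [← Finset.mul_sum]
  have h2 : ∑ F : ι → α → Fin B, ∏ i, Real.exp θ ^ ((T i).card - ((T i).image (F i)).card)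
      = ∏ i, ∑ f : α → Fin B, Real.exp θ ^ ((T i).card - ((T i).image f).card) := by
    rw [Finset.prod_univ_sum, Fintype.piFinset_univ]
  have h3 : ∏ i, ∑ f : α → Fin B, Real.exp θ ^ ((T i).card - ((T i).image f).card)
      ≤ ∏ _i : ι, ((Fintype.card (α → Fin B) : ℝ) * Real.exp (Real.exp θ * t / B * t)) := by
    refine Finset.prod_le_prod (fun i _ => Finset.sum_nonneg (fun f _ => by positivity))
      (fun i _ => ?_)
    refine (moment_one hB _ t (Real.exp_nonneg _) (T i) (hT i)).trans ?_
    have ht : 0 ≤ t := le_trans (Nat.cast_nonneg _) (hT i)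
    refine mul_le_mul_of_nonneg_left ?_ (Nat.cast_nonneg _)
    have hx : 0 ≤ Real.exp θ * t / B := by positivity
    calc (1 + Real.exp θ * t / B) ^ (T i).card
        ≤ Real.exp (Real.exp θ * t / B) ^ (T i).card := by
          apply pow_le_pow_left₀ (by positivity)
          linarith [Real.add_one_le_exp (Real.exp θ * t / B)]
      _ = Real.exp ((T i).card * (Real.exp θ * t / B)) := by rw [← Real.exp_nat_mul]
      _ ≤ _ := by
          apply Real.exp_le_exp.mpr
          nlinarith [hT i]
  rw [h2]
  refine (mul_le_mul_of_nonneg_left h3 (Real.exp_nonneg _)).trans (le_of_eq ?_)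
  rw [Finset.prod_const, mul_pow, Finset.card_univ, ← Real.exp_nat_mul, Fintype.card_fun (α := ι)]
  push_cast
  rw [mul_left_comm, ← Real.exp_add]
  congr 2
  ring

open Classical in
lemma nbr_card {N B₁ d₁ B₂ d₂ : ℕ}
    (gh : (Fin N → Fin d₁ → Fin B₁) × (Fin d₁ → Fin d₂ → Fin B₁ → Fin B₂)) (S : Finset (Fin N)) :
    ∑ p : Fin d₁ × Fin d₂, ((S.image (fun x => gh.1 x p.1)).image (gh.2 p.1 p.2)).card
      ≤ (nbrSet (twoLayerNbr gh) S).card := by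
  rw [Finset.card_eq_sum_card_fiberwise (f := fun r => r.2) (t := Finset.univ)
    (fun _ _ => by simp)]
  refine Finset.sum_le_sum (fun p _ => ?_)
  refine Finset.card_le_card_of_injOn (fun b => (b, p)) ?_ ?_
  · intro b hb
    simp only [Finset.coe_image, Set.mem_image, Finset.mem_coe] at hb
    obtain ⟨_, ⟨x, hx, rfl⟩, rfl⟩ := hb
    rw [Finset.mem_coe, Finset.mem_filter]
    simp only [nbrSet, Finset.mem_biUnion, Finset.mem_image]
    exact ⟨⟨x, hx, p, Finset.mem_univ _, rfl⟩, trivial⟩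
  · intro a _ b _ h
    exact (Prod.mk.inj h).1

open Classical in
lemma bad_split {N B₁ d₁ B₂ d₂ : ℕ} (ε : ℝ)
    (gh : (Fin N → Fin d₁ → Fin B₁) × (Fin d₁ → Fin d₂ → Fin B₁ → Fin B₂)) (S : Finset (Fin N))
    (h : ¬ (1 - ε) * (Fintype.card (Fin d₁ × Fin d₂)) * S.card
        ≤ ((nbrSet (twoLayerNbr gh) S).card : ℝ)) :
    (ε / 2 * d₁ * S.card ≤ ∑ i : Fin d₁, ((S.card - (S.image (fun x => gh.1 x i)).card : ℕ) : ℝ)) ∨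
    (ε / 2 * d₁ * d₂ * S.card ≤ ∑ p : Fin d₁ × Fin d₂,
      (((S.image (fun x => gh.1 x p.1)).card -
        ((S.image (fun x => gh.1 x p.1)).image (gh.2 p.1 p.2)).card : ℕ) : ℝ)) := by
  by_contra hcon
  push Not at hcon h
  obtain ⟨h1, h2⟩ := hcon
  have h0 : (∑ p : Fin d₁ × Fin d₂,
      (((S.image (fun x => gh.1 x p.1)).image (gh.2 p.1 p.2)).card : ℝ))
      ≤ (nbrSet (twoLayerNbr gh) S).card := by exact_mod_cast nbr_card gh S
  have e1 : ∑ i : Fin d₁, ((S.card - (S.image (fun x => gh.1 x i)).card : ℕ) : ℝ)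
      = d₁ * S.card - ∑ i : Fin d₁, ((S.image (fun x => gh.1 x i)).card : ℝ) := by
    rw [Finset.sum_congr rfl (fun i _ => Nat.cast_sub Finset.card_image_le),
      Finset.sum_sub_distrib]
    simp
  have e2 : ∑ p : Fin d₁ × Fin d₂,
      (((S.image (fun x => gh.1 x p.1)).card -
        ((S.image (fun x => gh.1 x p.1)).image (gh.2 p.1 p.2)).card : ℕ) : ℝ)
      = d₂ * (∑ i : Fin d₁, ((S.image (fun x => gh.1 x i)).card : ℝ)) - (∑ p : Fin d₁ × Fin d₂,
      (((S.image (fun x => gh.1 x p.1)).image (gh.2 p.1 p.2)).card : ℝ)) := by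
    rw [Finset.sum_congr rfl (fun i _ => Nat.cast_sub Finset.card_image_le),
      Finset.sum_sub_distrib]
    congr 1
    rw [Fintype.sum_prod_type]
    simp [Finset.mul_sum]
  rw [e1] at h1
  rw [e2] at h2
  simp only [Fintype.card_prod, Fintype.card_fin] at h
  push_cast at h
  have hd : (0 : ℝ) ≤ d₂ := Nat.cast_nonneg _
  have := mul_le_mul_of_nonneg_left h1.le hd
  nlinarith

open Classical in
lemma bad1_count {N B₁ d₁ B₂ d₂ : ℕ} (hB : 0 < B₁) (θ m : ℝ) (hθ : 0 ≤ θ) (S : Finset (Fin N)) :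
    ∑ gh : (Fin N → Fin d₁ → Fin B₁) × (Fin d₁ → Fin d₂ → Fin B₁ → Fin B₂),
      (if m ≤ ∑ i : Fin d₁, ((S.card - (S.image (fun x => gh.1 x i)).card : ℕ) : ℝ)
        then (1 : ℝ) else 0)
    ≤ (Fintype.card ((Fin N → Fin d₁ → Fin B₁) × (Fin d₁ → Fin d₂ → Fin B₁ → Fin B₂)) : ℝ) *
      Real.exp (Real.exp θ * S.card / B₁ * S.card * d₁ - θ * m) := by
  have := markov_many (ι := Fin d₁) (α := Fin N) hB θ S.card m (fun _ => S) (fun _ => le_rfl) hθ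
  rw [Fintype.sum_prod_type, Fintype.card_prod]
  simp only [Finset.sum_const, Finset.card_univ, nsmul_eq_mul]
  rw [← Finset.mul_sum, ← Equiv.sum_comp (Equiv.piComm (fun (_ : Fin d₁) (_ : Fin N) => Fin B₁))]
  have hc : Fintype.card (Fin N → Fin d₁ → Fin B₁) = Fintype.card (Fin d₁ → Fin N → Fin B₁) :=
    Fintype.card_congr (Equiv.piComm _)
  rw [hc]
  push_cast
  rw [mul_comm (Fintype.card (Fin d₁ → Fin N → Fin B₁) : ℝ), mul_assoc]
  refine mul_le_mul_of_nonneg_left ?_ (Nat.cast_nonneg _)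
  simpa [Function.swap] using this

open Classical in
lemma bad2_count {N B₁ d₁ B₂ d₂ : ℕ} (hB : 0 < B₂) (θ m : ℝ) (hθ : 0 ≤ θ) (S : Finset (Fin N)) :
    ∑ gh : (Fin N → Fin d₁ → Fin B₁) × (Fin d₁ → Fin d₂ → Fin B₁ → Fin B₂),
      (if m ≤ ∑ p : Fin d₁ × Fin d₂,
      (((S.image (fun x => gh.1 x p.1)).card -
        ((S.image (fun x => gh.1 x p.1)).image (gh.2 p.1 p.2)).card : ℕ) : ℝ)
        then (1 : ℝ) else 0)
    ≤ (Fintype.card ((Fin N → Fin d₁ → Fin B₁) × (Fin d₁ → Fin d₂ → Fin B₁ → Fin B₂)) : ℝ) *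
      Real.exp (Real.exp θ * S.card / B₂ * S.card * (d₁ * d₂) - θ * m) := by
  rw [Fintype.sum_prod_type, Fintype.card_prod]
  push_cast
  have hc : Fintype.card (Fin d₁ → Fin d₂ → Fin B₁ → Fin B₂)
      = Fintype.card (Fin d₁ × Fin d₂ → Fin B₁ → Fin B₂) :=
    Fintype.card_congr (Equiv.curry _ _ _).symm
  have key : ∀ g : Fin N → Fin d₁ → Fin B₁,
      ∑ h : Fin d₁ → Fin d₂ → Fin B₁ → Fin B₂, (if m ≤ ∑ p : Fin d₁ × Fin d₂,
      (((S.image (fun x => g x p.1)).card -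
        ((S.image (fun x => g x p.1)).image (h p.1 p.2)).card : ℕ) : ℝ)
        then (1 : ℝ) else 0) ≤ (Fintype.card (Fin d₁ → Fin d₂ → Fin B₁ → Fin B₂) : ℝ) *
      Real.exp (Real.exp θ * S.card / B₂ * S.card * (d₁ * d₂) - θ * m) := by
    intro g
    have := markov_many (ι := Fin d₁ × Fin d₂) (α := Fin B₁) hB θ S.card m
      (fun p => S.image (fun x => g x p.1)) (fun _ => by exact_mod_cast Finset.card_image_le) hθ
    rw [← Equiv.sum_comp (Equiv.curry (Fin d₁) (Fin d₂) (Fin B₁ → Fin B₂)), hc]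
    simpa [Function.curry] using this
  refine (Finset.sum_le_sum (fun g _ => key g)).trans (le_of_eq ?_)
  rw [Finset.sum_const, Finset.card_univ, nsmul_eq_mul]
  ring

lemma exp_bound1 (ε k N B d s : ℝ) (hε : 0 < ε) (hε4 : ε < 1 / 4) (hk : 1 ≤ k) (hs : 0 ≤ s)
    (hsk : s ≤ 4 * k) (hd0 : 0 ≤ d)
    (hN : 1024 * k ^ 2 ≤ N) (hB : B ≥ 1024 * k / ε ^ 2)
    (hd : d ≥ 1024 * (1 / ε) * Real.log (N / k) / Real.log (B / k)) :
    1 ≤ Real.log (B / k) ∧ Real.log N ≤ 2 * Real.log (N / k) ∧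
    Real.exp (Real.log (B / k) / 2) * s / B * s * d
      - Real.log (B / k) / 2 * (ε / 2 * d * s) ≤ - (64 * s * Real.log N) := by
  have hk0 : 0 < k := by linarith
  have hN0 : 0 < N := lt_of_lt_of_le (by positivity) hN
  have hBpos : 0 < B := lt_of_lt_of_le (by positivity) hB
  have hBk : (32 / ε) ^ 2 ≤ B / k := by
    rw [le_div_iff₀ hk0]
    refine le_trans (le_of_eq ?_) hB
    field_simp; norm_num
  have h32 : 32 ≤ 32 / ε := by
    rw [le_div_iff₀ hε]; linarith
  have hL1 : 1 ≤ Real.log (B / k) := by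
    rw [Real.le_log_iff_exp_le (by positivity)]
    have := Real.exp_one_lt_d9
    nlinarith
  have hlogN : Real.log N ≤ 2 * Real.log (N / k) := by
    rw [Real.log_div hN0.ne' hk0.ne']
    have : Real.log (k ^ 2) ≤ Real.log N := Real.log_le_log (by positivity) (by nlinarith)
    rw [Real.log_pow] at this
    push_cast at this
    linarith
  refine ⟨hL1, hlogN, ?_⟩
  set L := Real.log (B / k) with hL
  set q := Real.exp (L / 2) with hq
  have hqpos : 0 < q := Real.exp_pos _
  have hq2 : q ^ 2 = B / k := by
    rw [hq, ← Real.exp_nat_mul]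
    push_cast
    rw [mul_div_cancel₀ _ (by norm_num : (2 : ℝ) ≠ 0), hL, Real.exp_log (by positivity)]
  have hq32 : 32 / ε ≤ q := by
    refine (sq_le_sq₀ (by positivity) hqpos.le).mp ?_
    rw [hq2]; exact hBk
  have hq32' : 32 ≤ q * ε := by rwa [div_le_iff₀ hε] at hq32
  have hBq : B = q ^ 2 * k := by rw [hq2]; field_simp
  have h1 : q * s / B ≤ ε / 8 := by
    rw [div_le_iff₀ hBpos, hBq]
    have : 0 ≤ q * k := by positivity
    nlinarith [mul_le_mul_of_nonneg_left hsk hqpos.le]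
  have hdL : 1024 * Real.log (N / k) ≤ d * L * ε := by
    rw [ge_iff_le, div_le_iff₀ (by linarith)] at hd
    have := mul_le_mul_of_nonneg_right hd hε.le
    refine le_trans (le_of_eq ?_) this
    field_simp
  have hsd : 0 ≤ s * d := mul_nonneg hs hd0
  have h2 := mul_le_mul_of_nonneg_right h1 hsd
  have h3 : s * d * (ε / 8) ≤ s * d * (ε / 8) * L := by
    have : 0 ≤ s * d * (ε / 8) := by positivity
    nlinarith
  have h4 := mul_le_mul_of_nonneg_left hdL hs
  have h5 := mul_le_mul_of_nonneg_left hlogN hs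
  nlinarith

lemma exp_bound2 (ε k N B L d₁ d₂ s : ℝ) (hε : 0 < ε) (hk : 1 ≤ k)
    (hs : 0 ≤ s) (hsk : s ≤ 4 * k) (hL : 1 ≤ L) (hN0 : 0 ≤ Real.log (N / k))
    (hN : Real.log N ≤ 2 * Real.log (N / k)) (hB : B ≥ 1024 * k / ε)
    (hd : d₁ ≥ 1024 * (1 / ε) * Real.log (N / k) / L) (hd₂ : d₂ ≥ 1024 * L) :
    Real.exp 1 * s / B * s * (d₁ * d₂) - 1 * (ε / 2 * d₁ * d₂ * s) ≤ - (64 * s * Real.log N) := by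
  have hk0 : 0 < k := by linarith
  have hBpos : 0 < B := lt_of_lt_of_le (by positivity) hB
  have hd1 : 1024 * Real.log (N / k) ≤ d₁ * L * ε := by
    rw [ge_iff_le, div_le_iff₀ (by linarith)] at hd
    have := mul_le_mul_of_nonneg_right hd hε.le
    refine le_trans (le_of_eq ?_) this
    field_simp
  have hd10 : 0 ≤ d₁ := le_trans (by positivity) hd
  have hdd : 1024 * (1024 * Real.log (N / k)) ≤ d₁ * d₂ * ε := by
    have : 0 ≤ d₁ * ε := by positivity
    nlinarith [mul_le_mul_of_nonneg_left hd₂ this]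
  have h1 : Real.exp 1 * s / B ≤ ε / 4 := by
    rw [div_le_iff₀ hBpos]
    have he := Real.exp_one_lt_d9
    rw [ge_iff_le, div_le_iff₀ hε] at hB
    nlinarith
  have hsd : 0 ≤ s * (d₁ * d₂) := mul_nonneg hs (mul_nonneg hd10 (by linarith))
  have h2 := mul_le_mul_of_nonneg_right h1 hsd
  have h4 := mul_le_mul_of_nonneg_left hdd hs
  have h5 := mul_le_mul_of_nonneg_left hN hs
  have h6 : 0 ≤ s * Real.log (N / k) := mul_nonneg hs hN0
  nlinarith

lemma sum_sets (N : ℕ) (hN : 4 ≤ N) :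
    ∑ S ∈ (Finset.univ : Finset (Finset (Fin N))).erase ∅, 2 * (((N : ℝ) ^ 64)⁻¹) ^ S.card
      ≤ (N : ℝ)⁻¹ := by
  set x : ℝ := ((N : ℝ) ^ 64)⁻¹ with hx
  have hN4 : (4 : ℝ) ≤ N := by exact_mod_cast hN
  have hx0 : 0 ≤ x := by positivity
  have h1 : ∑ S : Finset (Fin N), x ^ S.card = (x + 1) ^ N := by
    have := Fintype.sum_pow_mul_eq_add_pow (Fin N) x 1
    simpa using this
  have h2 := Finset.add_sum_erase Finset.univ (fun S : Finset (Fin N) => x ^ S.card)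
    (Finset.mem_univ ∅)
  rw [h1] at h2
  simp only [Finset.card_empty, pow_zero] at h2
  rw [← Finset.mul_sum]
  have h3 : (x + 1) ^ N ≤ Real.exp (N * x) := by
    rw [Real.exp_nat_mul]
    exact pow_le_pow_left₀ (by positivity) (Real.add_one_le_exp x) _
  have h4 : N * x ≤ (N : ℝ)⁻¹ * (1 / 4) := by
    have hNp : (0 : ℝ) < N := by linarith
    rw [hx, ← div_eq_mul_inv, div_le_iff₀ (by positivity)]
    have : (N : ℝ)⁻¹ * (1 / 4) * N ^ 64 = 1 / 4 * N ^ 63 := by field_simp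
    rw [this]
    have h63 : (4 : ℝ) ≤ N ^ 62 := hN4.trans (le_self_pow₀ (by linarith) (by norm_num))
    have : (N : ℝ) ^ 63 = N ^ 62 * N := by ring
    rw [this]; nlinarith
  have h5 : (N : ℝ)⁻¹ ≤ 1 := inv_le_one_of_one_le₀ (by linarith)
  have h6 : 0 ≤ N * x := by positivity
  have h7 := Real.abs_exp_sub_one_le (x := N * x) (by rw [abs_of_nonneg h6]; linarith)
  rw [abs_of_nonneg h6] at h7
  have := le_abs_self (Real.exp (N * x) - 1)
  linarith

open Classical in
/-- Two-layer expanding property (Lemma 3.3).  The probability (uniform over all instances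
of the two-layer hashing scheme) of inducing a `(4k, ε)`-bipartite expander is at least
`1 - N^{-c}`, stated by counting instances. -/
theorem two_layer_expanding :
    ∃ C c : ℝ, 0 < C ∧ 0 < c ∧
      ∀ ε : ℝ, 0 < ε → ε < 1/4 →
      ∀ k : ℕ, 1 ≤ k →
      ∀ N : ℕ, (N : ℝ) ≥ C * max ((k : ℝ) / ε^2) ((k : ℝ)^2) →
      ∀ B₁ d₁ B₂ d₂ : ℕ,
        (B₁ : ℝ) ≥ C * k / ε^2 →
        (d₁ : ℝ) ≥ C * (1/ε) * Real.log ((N : ℝ) / k) / Real.log ((B₁ : ℝ) / k) →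
        (B₂ : ℝ) ≥ C * k / ε →
        (d₂ : ℝ) ≥ C * Real.log ((B₁ : ℝ) / k) →
        ((Finset.univ.filter
            (fun gh : (Fin N → Fin d₁ → Fin B₁) × (Fin d₁ → Fin d₂ → Fin B₁ → Fin B₂) =>
              IsExpander (4 * k : ℝ) ε (twoLayerNbr gh))).card : ℝ)
          ≥ (1 - (N : ℝ) ^ (-c)) *
            (Fintype.card ((Fin N → Fin d₁ → Fin B₁) × (Fin d₁ → Fin d₂ → Fin B₁ → Fin B₂))) := by
  refine ⟨1024, 1, by norm_num, by norm_num, ?_⟩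
  intro ε hε hε4 k hk N hN B₁ d₁ B₂ d₂ hB₁ hd₁ hB₂ hd₂
  have hk1 : (1 : ℝ) ≤ k := by exact_mod_cast hk
  have hk0 : (0 : ℝ) < k := by linarith
  have hNk : 1024 * (k : ℝ) ^ 2 ≤ N :=
    le_trans (mul_le_mul_of_nonneg_left (le_max_right _ _) (by norm_num)) hN
  have hN1024 : (1024 : ℝ) ≤ N := by nlinarith
  have hN4 : 4 ≤ N := by
    have : 1024 ≤ N := by exact_mod_cast hN1024
    omega
  have hNpos : (0 : ℝ) < N := by linarith
  have hB₁p : 0 < B₁ := by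
    have : (0 : ℝ) < B₁ := lt_of_lt_of_le (by positivity) hB₁
    exact_mod_cast this
  have hB₂p : 0 < B₂ := by
    have : (0 : ℝ) < B₂ := lt_of_lt_of_le (by positivity) hB₂
    exact_mod_cast this
  set M : ℝ := (Fintype.card ((Fin N → Fin d₁ → Fin B₁) × (Fin d₁ → Fin d₂ → Fin B₁ → Fin B₂)) : ℝ)
    with hM
  have hM0 : 0 ≤ M := Nat.cast_nonneg _
  have hlog0 : 0 ≤ Real.log ((N : ℝ) / k) := by
    apply Real.log_nonneg
    rw [le_div_iff₀ hk0]; nlinarith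
  have hexp : ∀ s : ℕ, Real.exp (-(64 * s * Real.log N)) = (((N : ℝ) ^ 64)⁻¹) ^ s := by
    intro s
    rw [Real.exp_neg, inv_pow, ← pow_mul, show (64 : ℝ) * s * Real.log N
      = ((64 * s : ℕ) : ℝ) * Real.log N by push_cast; ring, Real.exp_nat_mul, Real.exp_log hNpos]
  let P1 : Finset (Fin N) → (Fin N → Fin d₁ → Fin B₁) × (Fin d₁ → Fin d₂ → Fin B₁ → Fin B₂) →
      ℝ := fun S gh =>
    if ε / 2 * d₁ * S.card ≤ ∑ i : Fin d₁, ((S.card - (S.image (fun x => gh.1 x i)).card : ℕ) : ℝ)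
    then 1 else 0
  let P2 : Finset (Fin N) → (Fin N → Fin d₁ → Fin B₁) × (Fin d₁ → Fin d₂ → Fin B₁ → Fin B₂) →
      ℝ := fun S gh =>
    if ε / 2 * d₁ * d₂ * S.card ≤ ∑ p : Fin d₁ × Fin d₂,
      (((S.image (fun x => gh.1 x p.1)).card -
        ((S.image (fun x => gh.1 x p.1)).image (gh.2 p.1 p.2)).card : ℕ) : ℝ)
    then 1 else 0
  have hP1 : ∀ S gh, 0 ≤ P1 S gh := by
    intro S gh; simp only [P1]; split_ifs <;> norm_num
  have hP2 : ∀ S gh, 0 ≤ P2 S gh := by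
    intro S gh; simp only [P2]; split_ifs <;> norm_num
  let F : Finset (Finset (Fin N)) :=
    (Finset.univ.erase ∅).filter (fun S => (S.card : ℝ) ≤ 4 * k)
  have hpt : ∀ gh : (Fin N → Fin d₁ → Fin B₁) × (Fin d₁ → Fin d₂ → Fin B₁ → Fin B₂),
      1 - (if IsExpander (4 * k : ℝ) ε (twoLayerNbr gh) then (1 : ℝ) else 0)
        ≤ ∑ S ∈ F, (P1 S gh + P2 S gh) := by
    intro gh
    have hnn : ∀ S ∈ F, 0 ≤ P1 S gh + P2 S gh := fun S _ => add_nonneg (hP1 S gh) (hP2 S gh)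
    split_ifs with h
    · simpa using Finset.sum_nonneg hnn
    · unfold IsExpander at h
      push Not at h
      obtain ⟨S, hS, hlt⟩ := h
      have hSne : S ≠ ∅ := by
        rintro rfl
        simp only [Finset.card_empty, Nat.cast_zero, mul_zero] at hlt
        exact absurd hlt (not_lt.mpr (Nat.cast_nonneg _))
      have hmem : S ∈ F := by simp [F, hSne, hS]
      refine le_trans ?_ (Finset.single_le_sum hnn hmem)
      have hp1 := hP1 S gh
      have hp2 := hP2 S gh
      rcases bad_split ε gh S (not_le.mpr hlt) with hb | hb
      · have : P1 S gh = 1 := if_pos hb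
        linarith
      · have : P2 S gh = 1 := if_pos hb
        linarith
  have hS : ∀ S ∈ F, ∑ gh, (P1 S gh + P2 S gh) ≤ M * (2 * (((N : ℝ) ^ 64)⁻¹) ^ S.card) := by
    intro S hSF
    have hcard : (S.card : ℝ) ≤ 4 * k := (Finset.mem_filter.mp hSF).2
    obtain ⟨hL, hlN, he1⟩ := exp_bound1 ε k N B₁ d₁ S.card hε hε4 hk1 (Nat.cast_nonneg _) hcard
      (Nat.cast_nonneg _) hNk hB₁ hd₁
    have he2 := exp_bound2 ε k N B₂ _ d₁ d₂ S.card hε hk1 (Nat.cast_nonneg _) hcard hL hlog0 hlN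
      hB₂ hd₁ hd₂
    have c1 := bad1_count (d₁ := d₁) (B₂ := B₂) (d₂ := d₂) hB₁p (Real.log ((B₁ : ℝ) / k) / 2)
      (ε / 2 * d₁ * S.card) (by linarith) S
    have c2 := bad2_count (d₁ := d₁) (B₁ := B₁) (d₂ := d₂) hB₂p 1
      (ε / 2 * d₁ * d₂ * S.card) (by norm_num) S
    have e1 := mul_le_mul_of_nonneg_left (Real.exp_le_exp.mpr he1) hM0
    have e2 := mul_le_mul_of_nonneg_left (Real.exp_le_exp.mpr he2) hM0
    rw [hexp] at e1 e2
    rw [Finset.sum_add_distrib]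
    have c1' := c1.trans e1
    have c2' := c2.trans e2
    have := add_le_add c1' c2'
    refine this.trans (le_of_eq ?_)
    ring
  have htot := Finset.sum_le_sum (fun gh (_ : gh ∈ Finset.univ) => hpt gh)
  rw [Finset.sum_comm, Finset.sum_sub_distrib, Finset.sum_boole] at htot
  have h1 : ∑ _gh : (Fin N → Fin d₁ → Fin B₁) × (Fin d₁ → Fin d₂ → Fin B₁ → Fin B₂), (1 : ℝ)
      = M := by
    rw [Finset.sum_const, Finset.card_univ, nsmul_eq_mul, mul_one]
  rw [h1] at htot
  have h2 : ∑ S ∈ F, ∑ gh, (P1 S gh + P2 S gh) ≤ M * (N : ℝ)⁻¹ := by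
    refine (Finset.sum_le_sum hS).trans ?_
    rw [← Finset.mul_sum]
    refine mul_le_mul_of_nonneg_left ?_ hM0
    refine le_trans ?_ (sum_sets N hN4)
    exact Finset.sum_le_sum_of_subset_of_nonneg (Finset.filter_subset _ _)
      (fun _ _ _ => by positivity)
  rw [Real.rpow_neg_one]
  have h3 := htot.trans h2
  have h4 : (1 - (N : ℝ)⁻¹) * M = M - M * (N : ℝ)⁻¹ := by ring
  rw [ge_iff_le, h4]
  linarith
end

section
/- Two-layer isolation property (Lemma 3.4): For all constants ε₀ > 0, α > 1 and A ≥ 1 there exist constants C, c > 0 such that for every ε ∈ (0, ε₀), ζ ∈ (0,1), integer k ≥ 1 and all sufficiently large N, if B₁ ≥ C·k/(ζ^α·ε^{2α}), d₁ ≥ C·(α/(α−1))·(1/(ζε))·log(N/k)/log(B₁/k), B₂ ≥ C·k/(ζε) and d₂ ≥ C·(1/ζ)·log(B₁/k), then with probability at least 1 − N^{−c} the bipartite graph induced by a random (N,B₁,d₁,B₂,d₂) two-layer hashing scheme satisfies the (⌈A·k/ε⌉, ε, ζ)-isolation property. -/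
section Aux
open Finset

open Classical in
lemma tl_count {P B : Type*} [Fintype P] [Fintype B] (r : P → ℕ) (Q : P → Finset P) (s : ℕ)
    (hQ : ∀ w, ∀ q ∈ Q w, r q < r w) (hs : ∀ w, (Q w).card ≤ s) :
    ∀ (n : ℕ) (W : Finset P), W.card = n →
    (univ.filter (fun f : P → B => ∀ w ∈ W, ∃ q ∈ Q w, f q = f w)).card * Fintype.card B ^ n
      ≤ s ^ n * Fintype.card B ^ Fintype.card P := by
  intro n
  induction n with
  | zero =>
    intro W hW
    simp only [pow_zero, mul_one, one_mul]
    refine (card_le_univ _).trans ?_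
    rw [Fintype.card_fun]
  | succ n ih =>
    intro W hW
    have hne : W.Nonempty := by
      rw [← card_pos]; omega
    obtain ⟨w, hw, hmax⟩ := exists_max_image W r hne
    have hW' : (W.erase w).card = n := by rw [card_erase_of_mem hw]; omega
    have key : ((univ.filter (fun f : P → B => ∀ w ∈ W, ∃ q ∈ Q w, f q = f w)) ×ˢ
        (univ : Finset B)).card ≤
        ((univ.filter (fun f : P → B => ∀ v ∈ W.erase w, ∃ q ∈ Q v, f q = f v)) ×ˢ (Q w)).card := by
      let c : (P → B) → P := fun f => if h : ∃ q ∈ Q w, f q = f w then h.choose else w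
      have hc : ∀ f : P → B, (∃ q ∈ Q w, f q = f w) → c f ∈ Q w ∧ f (c f) = f w := by
        intro f h
        have := h.choose_spec
        simp only [c, dif_pos h]
        exact this
      refine card_le_card_of_injOn (fun p => (Function.update p.1 w p.2, c p.1)) ?_ ?_
      · rintro ⟨f, b⟩ hf
        simp only [coe_product, coe_filter, mem_univ, true_and, Set.mem_prod, Set.mem_ofPred_eq,
          coe_univ, Set.mem_univ, and_true] at hf
        simp only [coe_product, coe_filter, mem_univ, true_and, Set.mem_prod, Set.mem_ofPred_eq,
          mem_coe]
        refine ⟨?_, (hc f (hf w hw)).1⟩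
        intro v hv
        obtain ⟨hvw, hvW⟩ := mem_erase.1 hv
        obtain ⟨q, hq, hqe⟩ := hf v hvW
        refine ⟨q, hq, ?_⟩
        have h1 : q ≠ w := by
          rintro rfl
          have := hQ v q hq
          have := hmax v hvW
          omega
        rw [Function.update_of_ne h1, Function.update_of_ne hvw, hqe]
      · rintro ⟨f, b⟩ hf ⟨f', b'⟩ hf' heq
        simp only [coe_product, coe_filter, mem_univ, true_and, Set.mem_prod, Set.mem_ofPred_eq,
          coe_univ, Set.mem_univ, and_true] at hf hf'
        simp only [Prod.mk.injEq] at heq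
        obtain ⟨h1, h2⟩ := heq
        have hb : b = b' := by
          have := congrFun h1 w
          simpa using this
        have hcf := hc f (hf w hw)
        have hcf' := hc f' (hf' w hw)
        have hcw : c f ≠ w := by
          intro h
          have := hQ w _ hcf.1
          rw [h] at this
          omega
        have hff : f = f' := by
          funext x
          by_cases hx : x = w
          · subst hx
            rw [← hcf.2, ← hcf'.2, ← h2]
            have := congrFun h1 (c f)
            rwa [Function.update_of_ne hcw, Function.update_of_ne hcw] at this
          · have := congrFun h1 x
            rwa [Function.update_of_ne hx, Function.update_of_ne hx] at this
        rw [hff, hb]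
    rw [card_product, card_product, card_univ] at key
    have := ih _ hW'
    calc _ = ((univ.filter (fun f : P → B => ∀ w ∈ W, ∃ q ∈ Q w, f q = f w)).card *
            Fintype.card B) * Fintype.card B ^ n := by ring
      _ ≤ ((univ.filter (fun f : P → B => ∀ v ∈ W.erase w, ∃ q ∈ Q v, f q = f v)).card * s)
            * Fintype.card B ^ n := by
          exact Nat.mul_le_mul_right _ (key.trans (Nat.mul_le_mul_left _ (hs w)))
      _ = s * ((univ.filter (fun f : P → B => ∀ v ∈ W.erase w, ∃ q ∈ Q v, f q = f v)).card
            * Fintype.card B ^ n) := by ring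
      _ ≤ s * (s ^ n * Fintype.card B ^ Fintype.card P) := by gcongr
      _ = _ := by ring

open Classical in
lemma tl_tail {P B : Type*} [Fintype P] [Fintype B] (r : P → ℕ) (Q : P → Finset P) (s : ℕ)
    (hQ : ∀ w, ∀ q ∈ Q w, r q < r w) (hs : ∀ w, (Q w).card ≤ s) (Z : Finset P) (m : ℕ) :
    (univ.filter (fun f : P → B => m ≤ (Z.filter (fun w => ∃ q ∈ Q w, f q = f w)).card)).card
      * Fintype.card B ^ m
      ≤ Z.card.choose m * s ^ m * Fintype.card B ^ Fintype.card P := by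
  have hsub : (univ.filter (fun f : P → B => m ≤ (Z.filter (fun w => ∃ q ∈ Q w, f q = f w)).card))
      ⊆ (powersetCard m Z).biUnion
        (fun W => univ.filter (fun f : P → B => ∀ w ∈ W, ∃ q ∈ Q w, f q = f w)) := by
    intro f hf
    simp only [mem_filter, mem_univ, true_and] at hf
    obtain ⟨W, hW, hWm⟩ := exists_subset_card_eq hf
    simp only [mem_biUnion, mem_powersetCard, mem_filter, mem_univ, true_and]
    exact ⟨W, ⟨hW.trans (filter_subset _ _), hWm⟩, fun w hw => (mem_filter.1 (hW hw)).2⟩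
  calc _ ≤ (∑ W ∈ powersetCard m Z,
        (univ.filter (fun f : P → B => ∀ w ∈ W, ∃ q ∈ Q w, f q = f w)).card)
          * Fintype.card B ^ m := by
        gcongr
        exact (card_le_card hsub).trans card_biUnion_le
    _ = ∑ W ∈ powersetCard m Z,
        (univ.filter (fun f : P → B => ∀ w ∈ W, ∃ q ∈ Q w, f q = f w)).card
          * Fintype.card B ^ m := by rw [sum_mul]
    _ ≤ ∑ W ∈ powersetCard m Z, s ^ m * Fintype.card B ^ Fintype.card P := by
        refine sum_le_sum fun W hW => ?_
        exact tl_count r Q s hQ hs m W (mem_powersetCard.1 hW).2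
    _ = _ := by rw [sum_const, card_powersetCard, smul_eq_mul]; ring

open Classical in
lemma tl_tail_real {P B : Type*} [Fintype P] [Fintype B] (r : P → ℕ) (Q : P → Finset P) (s : ℕ)
    (hQ : ∀ w, ∀ q ∈ Q w, r q < r w) (hs : ∀ w, (Q w).card ≤ s) (Z : Finset P) (n : ℕ)
    (hZ : Z.card ≤ n) (τ ρ : ℝ) (hτ : 0 < τ) (hρ : 0 < ρ) (hρ1 : ρ ≤ 1)
    (hB : 0 < Fintype.card B)
    (h : Real.exp 1 * s ≤ ρ * τ * Fintype.card B) :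
    ((univ.filter (fun f : P → B =>
      τ * n ≤ ((Z.filter (fun w => ∃ q ∈ Q w, f q = f w)).card : ℝ))).card : ℝ)
      ≤ ρ ^ (τ * n) * Fintype.card (P → B) := by
  set m := ⌈τ * n⌉₊ with hm
  have hmn : τ * n ≤ m := Nat.le_ceil _
  have h0 := tl_tail (B := B) r Q s hQ hs Z m
  have hset : (univ.filter (fun f : P → B =>
      τ * n ≤ ((Z.filter (fun w => ∃ q ∈ Q w, f q = f w)).card : ℝ))) =
      (univ.filter (fun f : P → B => m ≤ (Z.filter (fun w => ∃ q ∈ Q w, f q = f w)).card)) := by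
    ext f
    simp only [mem_filter, mem_univ, true_and, hm, Nat.ceil_le]
  rw [hset]
  set K := (univ.filter (fun f : P → B =>
    m ≤ (Z.filter (fun w => ∃ q ∈ Q w, f q = f w)).card)).card
  have h0' : (K : ℝ) * (Fintype.card B : ℝ) ^ m ≤
      (Z.card.choose m : ℝ) * (s : ℝ) ^ m * (Fintype.card B : ℝ) ^ Fintype.card P := by
    exact_mod_cast h0
  have hBr : (0 : ℝ) < Fintype.card B := by exact_mod_cast hB
  have hch : (Z.card.choose m : ℝ) * (m : ℝ) ^ m ≤ (n * Real.exp 1) ^ m := by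
    have h1 : (Z.card.choose m : ℝ) ≤ (n : ℝ) ^ m / m.factorial := by
      refine (Nat.choose_le_pow_div m Z.card).trans ?_
      gcongr
    have h2 : (m : ℝ) ^ m / m.factorial ≤ Real.exp m :=
      Real.pow_div_factorial_le_exp _ (Nat.cast_nonneg m) m
    calc _ ≤ (n : ℝ) ^ m / m.factorial * (m : ℝ) ^ m := by gcongr
      _ = (n : ℝ) ^ m * ((m : ℝ) ^ m / m.factorial) := by ring
      _ ≤ (n : ℝ) ^ m * Real.exp m := by gcongr
      _ = _ := by rw [mul_pow, ← Real.exp_nat_mul, mul_one]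
  have hmm : (0 : ℝ) < (m : ℝ) ^ m := by
    rcases Nat.eq_zero_or_pos m with h | h
    · rw [h]; simp
    · positivity
  have hbase : (n * Real.exp 1 * s : ℝ) ≤ m * (ρ * Fintype.card B) := by
    have : τ * (n * Real.exp 1 * s : ℝ) ≤ τ * (m * (ρ * Fintype.card B)) := by
      calc τ * (n * Real.exp 1 * s : ℝ) = (τ * n) * (Real.exp 1 * s) := by ring
        _ ≤ m * (ρ * τ * Fintype.card B) := by gcongr
        _ = _ := by ring
    exact le_of_mul_le_mul_left this hτ
  have h3 : (Z.card.choose m : ℝ) * (s : ℝ) ^ m ≤ (ρ * Fintype.card B) ^ m := by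
    have : ((Z.card.choose m : ℝ) * (s : ℝ) ^ m) * (m : ℝ) ^ m ≤
        (ρ * Fintype.card B) ^ m * (m : ℝ) ^ m := by
      calc _ = ((Z.card.choose m : ℝ) * (m : ℝ) ^ m) * (s : ℝ) ^ m := by ring
        _ ≤ (n * Real.exp 1) ^ m * (s : ℝ) ^ m := by gcongr
        _ = (n * Real.exp 1 * s) ^ m := by rw [← mul_pow]
        _ ≤ (m * (ρ * Fintype.card B)) ^ m := by gcongr
        _ = _ := by rw [mul_pow]; ring
    exact le_of_mul_le_mul_right this hmm
  have h4 : (K : ℝ) ≤ ρ ^ m * (Fintype.card B : ℝ) ^ Fintype.card P := by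
    have : (K : ℝ) * (Fintype.card B : ℝ) ^ m ≤
        (ρ ^ m * (Fintype.card B : ℝ) ^ Fintype.card P) * (Fintype.card B : ℝ) ^ m := by
      refine h0'.trans ?_
      calc _ ≤ (ρ * Fintype.card B) ^ m * (Fintype.card B : ℝ) ^ Fintype.card P := by gcongr
        _ = _ := by rw [mul_pow]; ring
    exact le_of_mul_le_mul_right this (by positivity)
  rw [Fintype.card_fun]
  push_cast
  refine h4.trans ?_
  gcongr
  rw [← Real.rpow_natCast]
  exact Real.rpow_le_rpow_of_exponent_ge hρ hρ1 hmn

open Classical in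
lemma tl_noniso {L R : Type*} (f : L → R) (S X : Finset L) (hX : X ⊆ S) (o : L → ℕ)
    (ho : Function.Injective o) (hoX : ∀ x ∈ X, ∀ z ∈ S, z ∉ X → o z < o x) :
    (X.filter (fun x => ∃ z ∈ S, z ≠ x ∧ f z = f x)).card ≤
      2 * (X.filter (fun x => ∃ z ∈ S, o z < o x ∧ f z = f x)).card := by
  set A := X.filter (fun x => ∃ z ∈ S, z ≠ x ∧ f z = f x)
  set E := X.filter (fun x => ∃ z ∈ S, o z < o x ∧ f z = f x)
  have key : (A \ E).card ≤ E.card := by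
    have hex : ∀ x ∈ A \ E, ∃ z ∈ E, f z = f x := by
      intro x hx
      simp only [A, E, mem_sdiff, mem_filter, not_and, not_exists] at hx
      obtain ⟨⟨hxX, z, hzS, hzx, hf⟩, hn⟩ := hx
      have hlt : ¬ o z < o x := fun h => hn hxX z hzS h hf
      have hne : o z ≠ o x := fun h => hzx (ho h)
      have hzX : z ∈ X := by
        by_contra h
        exact hlt (hoX x hxX z hzS h)
      refine ⟨z, ?_, hf⟩
      simp only [E, mem_filter]
      exact ⟨hzX, x, hX hxX, by omega, hf.symm⟩
    choose! φ hφ hφf using hex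
    refine card_le_card_of_injOn φ (fun x hx => hφ x hx) ?_
    intro x hx y hy hxy
    have hx' := mem_coe.1 hx
    have hy' := mem_coe.1 hy
    have hfe : f x = f y := by rw [← hφf x hx', ← hφf y hy', hxy]
    simp only [A, E, mem_sdiff, mem_filter, not_and, not_exists] at hx' hy'
    have h1 : ¬ o y < o x := fun h => hx'.2 hx'.1.1 y (hX hy'.1.1) h hfe.symm
    have h2 : ¬ o x < o y := fun h => hy'.2 hy'.1.1 x (hX hx'.1.1) h hfe
    exact ho (by omega)
  have := card_le_card_sdiff_add_card (s := A) (t := E)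
  omega

open Classical in
/-- Rank putting the elements outside `X` before those of `X`. -/
noncomputable def tlo {N : ℕ} (X : Finset (Fin N)) (x : Fin N) : ℕ :=
  if x ∈ X then N + x else x

lemma tlo_inj {N : ℕ} (X : Finset (Fin N)) : Function.Injective (tlo X) := by
  intro x y h
  unfold tlo at h
  have hx := x.2
  have hy := y.2
  apply Fin.ext
  split_ifs at h <;> omega

lemma tlo_lt {N : ℕ} (X : Finset (Fin N)) (x z : Fin N) (hx : x ∈ X) (hz : z ∉ X) :
    tlo X z < tlo X x := by
  unfold tlo
  rw [if_pos hx, if_neg hz]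
  have := z.2
  omega

open Classical in
noncomputable def tlE1 {N B₁ d₁ : ℕ} (S X : Finset (Fin N)) (g : Fin N → Fin d₁ → Fin B₁) :
    Finset (Fin N × Fin d₁) :=
  (X ×ˢ univ).filter (fun p => ∃ y ∈ S, tlo X y < tlo X p.1 ∧ g y p.2 = g p.1 p.2)

open Classical in
noncomputable def tlE2 {N B₁ d₁ B₂ d₂ : ℕ} (S X : Finset (Fin N)) (g : Fin N → Fin d₁ → Fin B₁)
    (h : Fin d₁ → Fin d₂ → Fin B₁ → Fin B₂) :
    Finset (Fin N × Fin d₁ × Fin d₂) :=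
  (X ×ˢ univ).filter (fun p =>
    (¬ ∃ y ∈ S, tlo X y < tlo X p.1 ∧ g y p.2.1 = g p.1 p.2.1) ∧
    ∃ y ∈ S, tlo X y < tlo X p.1 ∧ h p.2.1 p.2.2 (g y p.2.1) = h p.2.1 p.2.2 (g p.1 p.2.1))

open Classical in
lemma tl_layer1 {N B₁ d₁ : ℕ} (S X : Finset (Fin N)) (τ ρ : ℝ) (hτ : 0 < τ) (hρ : 0 < ρ)
    (hρ1 : ρ ≤ 1) (hB : 0 < B₁) (h : Real.exp 1 * S.card ≤ ρ * τ * B₁) :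
    ((univ.filter (fun g : Fin N → Fin d₁ → Fin B₁ =>
      τ * (X.card * d₁ : ℕ) ≤ ((tlE1 S X g).card : ℝ))).card : ℝ) ≤
      ρ ^ (τ * (X.card * d₁ : ℕ)) * Fintype.card (Fin N → Fin d₁ → Fin B₁) := by
  have key := tl_tail_real (P := Fin N × Fin d₁) (B := Fin B₁) (fun p => tlo X p.1)
    (fun p => (S.filter (fun y => tlo X y < tlo X p.1)).image (fun y => (y, p.2))) S.card
    (by
      intro w q hq
      simp only [mem_image, mem_filter] at hq
      obtain ⟨y, ⟨_, hy⟩, rfl⟩ := hq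
      exact hy)
    (fun w => card_image_le.trans (card_filter_le _ _))
    (X ×ˢ univ) (X.card * d₁) (by simp) τ ρ hτ hρ hρ1 (by simpa using hB) (by simpa using h)
  rw [← Fintype.card_congr (Equiv.curry (Fin N) (Fin d₁) (Fin B₁))]
  refine le_trans ?_ (key.trans_eq (by congr!))
  rw [Nat.cast_le]
  refine card_le_card_of_injOn (fun g => Function.uncurry g) ?_ ?_
  · intro g hg
    simp only [coe_filter, mem_univ, true_and, Set.mem_ofPred_eq] at hg ⊢
    refine hg.trans_eq ?_
    congr 2
    unfold tlE1
    ext ⟨x, i⟩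
    simp [Function.uncurry, and_assoc]
  · intro g _ g' _ hgg
    exact (Equiv.curry (Fin N) (Fin d₁) (Fin B₁)).symm.injective hgg

open Classical in
lemma tl_layer2 {N B₁ d₁ B₂ d₂ : ℕ} (S X : Finset (Fin N)) (hXS : X ⊆ S)
    (g : Fin N → Fin d₁ → Fin B₁) (τ ρ : ℝ) (hτ : 0 < τ) (hρ : 0 < ρ)
    (hρ1 : ρ ≤ 1) (hB : 0 < B₂) (h : Real.exp 1 * S.card ≤ ρ * τ * B₂) :
    ((univ.filter (fun h : Fin d₁ → Fin d₂ → Fin B₁ → Fin B₂ =>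
      τ * (X.card * (d₁ * d₂) : ℕ) ≤ ((tlE2 S X g h).card : ℝ))).card : ℝ) ≤
      ρ ^ (τ * (X.card * (d₁ * d₂) : ℕ)) *
        Fintype.card (Fin d₁ → Fin d₂ → Fin B₁ → Fin B₂) := by
  let r : Fin d₁ × Fin d₂ × Fin B₁ → ℕ :=
    fun p => sInf {t | ∃ x ∈ S, g x p.1 = p.2.2 ∧ tlo X x = t}
  let Z : Finset (Fin d₁ × Fin d₂ × Fin B₁) :=
    (X ×ˢ (univ : Finset (Fin d₁ × Fin d₂))).image (fun p => (p.2.1, p.2.2, g p.1 p.2.1))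
  let Q : Fin d₁ × Fin d₂ × Fin B₁ → Finset (Fin d₁ × Fin d₂ × Fin B₁) := fun p =>
    (S.filter (fun y => tlo X y < r p)).image (fun y => (p.1, p.2.1, g y p.1))
  have key := tl_tail_real (P := Fin d₁ × Fin d₂ × Fin B₁) (B := Fin B₂) r Q S.card
    (by
      intro w q hq
      simp only [Q, mem_image, mem_filter] at hq
      obtain ⟨y, ⟨hyS, hy⟩, rfl⟩ := hq
      refine lt_of_le_of_lt ?_ hy
      exact Nat.sInf_le ⟨y, hyS, rfl, rfl⟩)
    (fun w => card_image_le.trans (card_filter_le _ _))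
    Z (X.card * (d₁ * d₂)) (card_image_le.trans (by simp)) τ ρ hτ hρ hρ1 (by simpa using hB)
    (by simpa using h)
  let e : ((Fin d₁ × Fin d₂ × Fin B₁) → Fin B₂) ≃ (Fin d₁ → Fin d₂ → Fin B₁ → Fin B₂) :=
    (Equiv.curry _ _ _).trans (Equiv.piCongrRight fun _ => Equiv.curry _ _ _)
  rw [← Fintype.card_congr e]
  refine le_trans ?_ (key.trans_eq (by congr!))
  rw [Nat.cast_le]
  refine card_le_card_of_injOn (fun h => e.symm h) ?_ (fun _ _ _ _ hh => e.symm.injective hh)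
  intro h hh
  simp only [coe_filter, mem_univ, true_and, Set.mem_ofPred_eq] at hh ⊢
  refine hh.trans ?_
  rw [Nat.cast_le]
  have he : ∀ i j b, e.symm h (i, j, b) = h i j b := fun i j b => rfl
  refine card_le_card_of_injOn (fun p => (p.2.1, p.2.2, g p.1 p.2.1)) ?_ ?_
  · rintro ⟨x, i, j⟩ hx
    simp only [tlE2, coe_filter, Set.mem_ofPred_eq, mem_product, mem_univ, and_true] at hx
    obtain ⟨hxX, hfresh, y, hyS, hyo, hyh⟩ := hx
    simp only [coe_filter, Set.mem_ofPred_eq]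
    refine ⟨mem_image.2 ⟨(x, i, j), by simp [hxX], rfl⟩, (i, j, g y i), ?_, ?_⟩
    · simp only [Q, mem_image, mem_filter]
      refine ⟨y, ⟨hyS, lt_of_lt_of_le hyo ?_⟩, rfl⟩
      have hmem : r (i, j, g x i) ∈ {t | ∃ x' ∈ S, g x' i = g x i ∧ tlo X x' = t} :=
        Nat.sInf_mem ⟨_, x, hXS hxX, rfl, rfl⟩
      obtain ⟨x', hx'S, hx'g, hx'o⟩ := hmem
      rw [← hx'o]
      by_contra hlt
      exact hfresh ⟨x', hx'S, not_le.1 hlt, hx'g⟩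
    · rw [he, he]; exact hyh
  · rintro ⟨x, i, j⟩ hx ⟨x', i', j'⟩ hx' heq
    simp only [tlE2, coe_filter, Set.mem_ofPred_eq, mem_product, mem_univ, and_true] at hx hx'
    simp only [Prod.mk.injEq] at heq
    obtain ⟨rfl, rfl, hg⟩ := heq
    have h1 : ¬ tlo X x' < tlo X x := fun hlt => hx.2.1 ⟨x', hXS hx'.1, hlt, hg.symm⟩
    have h2 : ¬ tlo X x < tlo X x' := fun hlt => hx'.2.1 ⟨x, hXS hx.1, hlt, hg⟩
    have : x = x' := tlo_inj X (by omega)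
    rw [this]

open Classical in
lemma tl_bad {N B₁ d₁ B₂ d₂ : ℕ} (L₀ : ℕ) (ε ζ : ℝ)
    (g : Fin N → Fin d₁ → Fin B₁) (h : Fin d₁ → Fin d₂ → Fin B₁ → Fin B₂)
    (hd₂ : 0 < d₂)
    (hbad : ¬ HasIsolation L₀ ε ζ (twoLayerNbr (g, h))) :
    ∃ S : Finset (Fin N), S.card ≤ L₀ ∧ ∃ X ⊆ S, ε * S.card < X.card ∧
      (ζ / 4 * (X.card * d₁ : ℕ) ≤ ((tlE1 S X g).card : ℝ) ∨
       ζ / 4 * (X.card * (d₁ * d₂) : ℕ) ≤ ((tlE2 S X g h).card : ℝ)) := by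
  unfold HasIsolation at hbad
  push Not at hbad
  obtain ⟨S, hS, hbad⟩ := hbad
  set nbr := twoLayerNbr (g, h) with hnbr
  set X := S.filter (fun x => ((isolNbrs nbr S x).card : ℝ) <
    (1 - ζ) * (Fintype.card (Fin d₁ × Fin d₂))) with hXdef
  have hXS : X ⊆ S := filter_subset _ _
  refine ⟨S, hS, X, hXS, ?_, ?_⟩
  · by_contra hle
    push Not at hle
    obtain ⟨x, hx, hlt⟩ := hbad (S \ X) sdiff_subset (by
      rw [cast_card_sdiff hXS]
      linarith)
    have := mem_sdiff.1 hx
    exact this.2 (mem_filter.2 ⟨this.1, hlt⟩)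
  · -- non-isolated pairs of `x`
    let bad : Fin N → Fin d₁ × Fin d₂ → Prop := fun x p =>
      ∃ z ∈ S, z ≠ x ∧ h p.1 p.2 (g z p.1) = h p.1 p.2 (g x p.1)
    have hiso : ∀ x, (d₁ * d₂ : ℕ) ≤ (isolNbrs nbr S x).card +
        (univ.filter (fun p => bad x p)).card := by
      intro x
      have h1 : (univ.filter (fun p => ¬ bad x p)).card ≤ (isolNbrs nbr S x).card := by
        refine card_le_card_of_injOn (fun p => nbr x p) ?_ ?_
        · intro p hp
          simp only [coe_filter, mem_univ, true_and, Set.mem_ofPred_eq] at hp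
          simp only [isolNbrs, coe_filter, Set.mem_ofPred_eq]
          refine ⟨by simp, ?_⟩
          intro z hz hzx q hq
          apply hp
          simp only [hnbr, twoLayerNbr, Prod.mk.injEq] at hq
          obtain ⟨hq0, hq1, hq2⟩ := hq
          rw [hq1, hq2] at hq0
          exact ⟨z, hz, hzx, hq0⟩
        · intro p _ q _ hpq
          simp only [hnbr, twoLayerNbr, Prod.mk.injEq] at hpq
          exact Prod.ext hpq.2.1 hpq.2.2
      have h2 := card_filter_add_card_filter_not (s := (univ : Finset (Fin d₁ × Fin d₂)))
        (fun p => bad x p)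
      rw [card_univ, Fintype.card_prod, Fintype.card_fin, Fintype.card_fin] at h2
      omega
    have hlow : ζ * (X.card * (d₁ * d₂) : ℕ) ≤
        ∑ x ∈ X, ((univ.filter (fun p => bad x p)).card : ℝ) := by
      have : ∑ x ∈ X, (ζ * (d₁ * d₂ : ℕ) : ℝ) ≤
          ∑ x ∈ X, ((univ.filter (fun p => bad x p)).card : ℝ) := by
        refine sum_le_sum fun x hx => ?_
        have h1 := (mem_filter.1 hx).2
        have h2 : ((d₁ * d₂ : ℕ) : ℝ) ≤ (isolNbrs nbr S x).card +
          (univ.filter (fun p => bad x p)).card := by exact_mod_cast hiso x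
        rw [Fintype.card_prod, Fintype.card_fin, Fintype.card_fin] at h1
        linarith
      refine le_trans (le_of_eq ?_) this
      rw [sum_const, nsmul_eq_mul]
      push_cast
      ring
    have hup : ∑ x ∈ X, (univ.filter (fun p => bad x p)).card ≤
        2 * ((tlE1 S X g).card * d₂ + (tlE2 S X g h).card) := by
      let hit : Fin N → Fin d₁ × Fin d₂ → Prop := fun x p =>
        ∃ z ∈ S, tlo X z < tlo X x ∧ h p.1 p.2 (g z p.1) = h p.1 p.2 (g x p.1)
      have hswap : ∑ x ∈ X, (univ.filter (fun p => bad x p)).card =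
          ∑ p, (X.filter (fun x => bad x p)).card := by
        simp only [card_filter]
        exact sum_comm
      have hswap2 : ∑ p, (X.filter (fun x => hit x p)).card =
          ((X ×ˢ univ).filter (fun q : Fin N × Fin d₁ × Fin d₂ => hit q.1 q.2)).card := by
        simp only [card_filter]
        rw [sum_product, sum_comm]
      have hnon : ∀ p, (X.filter (fun x => bad x p)).card ≤
          2 * (X.filter (fun x => hit x p)).card := by
        intro p
        convert tl_noniso (fun x => h p.1 p.2 (g x p.1)) S X hXS (tlo X) (tlo_inj X)
          (fun x hx z _ hz => tlo_lt X x z hx hz)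
      have hsub : ((X ×ˢ univ).filter (fun q : Fin N × Fin d₁ × Fin d₂ => hit q.1 q.2)) ⊆
          ((tlE1 S X g) ×ˢ (univ : Finset (Fin d₂))).image (fun q => (q.1.1, q.1.2, q.2)) ∪
            tlE2 S X g h := by
        rintro ⟨x, i, j⟩ hq
        simp only [mem_filter, mem_product, mem_univ, and_true] at hq
        by_cases hE : ∃ y ∈ S, tlo X y < tlo X x ∧ g y i = g x i
        · refine mem_union_left _ (mem_image.2 ⟨((x, i), j), ?_, rfl⟩)
          simp only [mem_product, mem_univ, and_true, tlE1, mem_filter]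
          exact ⟨hq.1, hE⟩
        · refine mem_union_right _ ?_
          simp only [tlE2, mem_filter, mem_product, mem_univ, and_true]
          exact ⟨hq.1, hE, hq.2⟩
      have hcard : ((X ×ˢ univ).filter
          (fun q : Fin N × Fin d₁ × Fin d₂ => hit q.1 q.2)).card ≤
          (tlE1 S X g).card * d₂ + (tlE2 S X g h).card := by
        refine (card_le_card hsub).trans ((card_union_le _ _).trans ?_)
        gcongr
        exact card_image_le.trans (by simp)
      rw [hswap]
      calc _ ≤ ∑ p, 2 * (X.filter (fun x => hit x p)).card := sum_le_sum fun p _ => hnon p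
        _ = 2 * ∑ p, (X.filter (fun x => hit x p)).card := by rw [mul_sum]
        _ ≤ _ := by rw [hswap2]; omega
    have hup' : ∑ x ∈ X, ((univ.filter (fun p => bad x p)).card : ℝ) ≤
        2 * ((tlE1 S X g).card * d₂ + (tlE2 S X g h).card) := by exact_mod_cast hup
    by_contra hcon
    push Not at hcon
    obtain ⟨c1, c2⟩ := hcon
    have hd₂' : (0 : ℝ) < d₂ := by exact_mod_cast hd₂
    have c1' := mul_lt_mul_of_pos_right c1 hd₂'
    push_cast at *
    nlinarith

open Classical in
lemma tl_union {N B₁ d₁ B₂ d₂ : ℕ} (L₀ : ℕ) (ε ζ y : ℝ) (hε : 0 < ε) (hy : 0 ≤ y) (hd₂ : 0 < d₂)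
    (h1 : ∀ S X : Finset (Fin N), S.card ≤ L₀ → X ⊆ S → ε * S.card < X.card →
      ((univ.filter (fun g : Fin N → Fin d₁ → Fin B₁ =>
        ζ / 4 * (X.card * d₁ : ℕ) ≤ ((tlE1 S X g).card : ℝ))).card : ℝ) ≤
      y ^ S.card * Fintype.card (Fin N → Fin d₁ → Fin B₁))
    (h2 : ∀ S X : Finset (Fin N), S.card ≤ L₀ → X ⊆ S → ε * S.card < X.card →
      ∀ g : Fin N → Fin d₁ → Fin B₁,
      ((univ.filter (fun h : Fin d₁ → Fin d₂ → Fin B₁ → Fin B₂ =>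
        ζ / 4 * (X.card * (d₁ * d₂) : ℕ) ≤ ((tlE2 S X g h).card : ℝ))).card : ℝ) ≤
      y ^ S.card * Fintype.card (Fin d₁ → Fin d₂ → Fin B₁ → Fin B₂)) :
    ((univ.filter
      (fun gh : (Fin N → Fin d₁ → Fin B₁) × (Fin d₁ → Fin d₂ → Fin B₁ → Fin B₂) =>
        ¬ HasIsolation L₀ ε ζ (twoLayerNbr gh))).card : ℝ) ≤
      2 * ((1 + 2 * y) ^ N - 1) *
        Fintype.card ((Fin N → Fin d₁ → Fin B₁) × (Fin d₁ → Fin d₂ → Fin B₁ → Fin B₂)) := by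
  set G := Fin N → Fin d₁ → Fin B₁
  set H := Fin d₁ → Fin d₂ → Fin B₁ → Fin B₂
  let I : Finset (Finset (Fin N)) := univ.erase ∅
  let J : Finset (Fin N) → Finset (Finset (Fin N)) := fun S =>
    S.powerset.filter (fun X => S.card ≤ L₀ ∧ ε * S.card < X.card)
  let F1 : Finset (Fin N) → Finset (Fin N) → Finset (G × H) := fun S X =>
    univ.filter (fun gh => ζ / 4 * (X.card * d₁ : ℕ) ≤ ((tlE1 S X gh.1).card : ℝ))
  let F2 : Finset (Fin N) → Finset (Fin N) → Finset (G × H) := fun S X =>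
    univ.filter (fun gh => ζ / 4 * (X.card * (d₁ * d₂) : ℕ) ≤ ((tlE2 S X gh.1 gh.2).card : ℝ))
  have hsub : (univ.filter (fun gh : G × H => ¬ HasIsolation L₀ ε ζ (twoLayerNbr gh))) ⊆
      I.biUnion (fun S => (J S).biUnion (fun X => F1 S X ∪ F2 S X)) := by
    rintro ⟨g, h⟩ hgh
    simp only [mem_filter, mem_univ, true_and] at hgh
    obtain ⟨S, hS, X, hXS, hX, hor⟩ := tl_bad L₀ ε ζ g h hd₂ hgh
    simp only [mem_biUnion]
    refine ⟨S, ?_, X, ?_, ?_⟩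
    · simp only [I, mem_erase, mem_univ, and_true]
      rintro rfl
      have : X = ∅ := subset_empty.1 hXS
      rw [this] at hX
      simp at hX
    · simp only [J, mem_filter, mem_powerset]
      exact ⟨hXS, hS, hX⟩
    · simp only [F1, F2, mem_union, mem_filter, mem_univ, true_and]
      exact hor
  have hT : (Fintype.card (G × H) : ℝ) = Fintype.card G * Fintype.card H := by
    rw [Fintype.card_prod]; push_cast; rfl
  have hF1 : ∀ S X, X ∈ J S → ((F1 S X).card : ℝ) ≤ y ^ S.card * Fintype.card (G × H) := by
    intro S X hX
    simp only [J, mem_filter, mem_powerset] at hX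
    have := h1 S X hX.2.1 hX.1 hX.2.2
    have he : F1 S X = (univ.filter (fun g : G =>
        ζ / 4 * (X.card * d₁ : ℕ) ≤ ((tlE1 S X g).card : ℝ))) ×ˢ (univ : Finset H) := by
      ext ⟨g, h⟩
      simp [F1]
    rw [he, card_product, hT, card_univ]
    push_cast
    calc _ ≤ (y ^ S.card * Fintype.card G) * (Fintype.card H : ℝ) := by
          refine mul_le_mul_of_nonneg_right ?_ (Nat.cast_nonneg _)
          simpa only [Nat.cast_mul] using this
      _ = _ := by ring
  have hF2 : ∀ S X, X ∈ J S → ((F2 S X).card : ℝ) ≤ y ^ S.card * Fintype.card (G × H) := by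
    intro S X hX
    simp only [J, mem_filter, mem_powerset] at hX
    have := h2 S X hX.2.1 hX.1 hX.2.2
    have he : (F2 S X).card = ∑ g : G, (univ.filter (fun h : H =>
        ζ / 4 * (X.card * (d₁ * d₂) : ℕ) ≤ ((tlE2 S X g h).card : ℝ))).card := by
      simp only [F2, card_filter]
      rw [Fintype.sum_prod_type]
    rw [he, hT]
    push_cast
    calc _ ≤ ∑ g : G, y ^ S.card * (Fintype.card H : ℝ) := by
          refine sum_le_sum fun g _ => ?_
          simpa only [Nat.cast_mul] using this g
      _ = _ := by rw [sum_const, nsmul_eq_mul, card_univ]; ring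
  have hJ : ∀ S, ((J S).card : ℝ) ≤ 2 ^ S.card := by
    intro S
    have : (J S).card ≤ 2 ^ S.card := (card_filter_le _ _).trans (by rw [card_powerset])
    exact_mod_cast this
  have hsum : ∑ S ∈ I, (2 * y) ^ S.card = (1 + 2 * y) ^ N - 1 := by
    have h := Fintype.sum_pow_mul_eq_add_pow (Fin N) (2 * y) (1 : ℝ)
    simp only [one_pow, mul_one, Fintype.card_fin] at h
    have h' := add_sum_erase univ (fun S : Finset (Fin N) => (2 * y) ^ S.card) (mem_univ ∅)
    simp only [card_empty, pow_zero] at h'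
    rw [add_comm 1 (2 * y), ← h, ← h']
    ring
  have hc : ((univ.filter (fun gh : G × H => ¬ HasIsolation L₀ ε ζ (twoLayerNbr gh))).card : ℝ) ≤
      ∑ S ∈ I, ∑ X ∈ J S, (((F1 S X).card : ℝ) + (F2 S X).card) := by
    have : (univ.filter (fun gh : G × H => ¬ HasIsolation L₀ ε ζ (twoLayerNbr gh))).card ≤
      ∑ S ∈ I, ∑ X ∈ J S, ((F1 S X).card + (F2 S X).card) := by
      refine (card_le_card hsub).trans (card_biUnion_le.trans (sum_le_sum fun S _ => ?_))
      exact card_biUnion_le.trans (sum_le_sum fun X _ => card_union_le _ _)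
    exact_mod_cast this
  refine hc.trans ?_
  set T : ℝ := (Fintype.card (G × H) : ℝ)
  have hT0 : 0 ≤ T := Nat.cast_nonneg _
  calc _ ≤ ∑ S ∈ I, ∑ X ∈ J S, (2 * (y ^ S.card * T)) := by
        refine sum_le_sum fun S _ => sum_le_sum fun X hX => ?_
        have := hF1 S X hX
        have := hF2 S X hX
        linarith
    _ ≤ ∑ S ∈ I, 2 * T * (2 * y) ^ S.card := by
        refine sum_le_sum fun S _ => ?_
        rw [sum_const, nsmul_eq_mul, mul_pow]
        calc _ ≤ (2 : ℝ) ^ S.card * (2 * (y ^ S.card * T)) := by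
              gcongr
              exact hJ S
          _ = _ := by ring
    _ = _ := by rw [← mul_sum, hsum]; ring

lemma tl_num {N : ℕ} (hN : 2 ≤ N) (y : ℝ) (hy0 : 0 ≤ y) (hy : y ≤ 1 / (N : ℝ) ^ 5) :
    2 * ((1 + 2 * y) ^ N - 1) ≤ (N : ℝ) ^ (-(1 : ℝ)) := by
  rw [Real.rpow_neg_one]
  have hN' : (2 : ℝ) ≤ N := by exact_mod_cast hN
  have hNp : (0 : ℝ) < N := by linarith
  have hz : N * (2 * y) ≤ 1 / (4 * N) := by
    have : N * (2 * (1 / (N : ℝ) ^ 5)) ≤ 1 / (4 * N) := by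
      rw [show N * (2 * (1 / (N : ℝ) ^ 5)) = 2 / (N : ℝ) ^ 4 by field_simp,
        div_le_div_iff₀ (by positivity) (by positivity)]
      have : (8 : ℝ) ≤ (N : ℝ) ^ 3 := by
        calc (8 : ℝ) = 2 ^ 3 := by norm_num
          _ ≤ _ := by gcongr
      nlinarith
    refine le_trans ?_ this
    gcongr
  have h4 : 1 / (4 * (N : ℝ)) ≤ 1 := by
    rw [div_le_one (by positivity)]; linarith
  have h1 : (1 + 2 * y) ^ N ≤ Real.exp (N * (2 * y)) := by
    rw [Real.exp_nat_mul]
    gcongr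
    have := Real.add_one_le_exp (2 * y)
    linarith
  have h2 : Real.exp (N * (2 * y)) - 1 ≤ 2 * (N * (2 * y)) := by
    have hnn : 0 ≤ N * (2 * y) := by positivity
    have h := Real.abs_exp_sub_one_le (x := N * (2 * y)) (by rw [abs_of_nonneg hnn]; linarith)
    rw [abs_of_nonneg hnn] at h
    exact (le_abs_self _).trans h
  have : (N : ℝ)⁻¹ = 4 * (1 / (4 * N)) := by field_simp
  rw [this]
  linarith

open Classical in
lemma tl_fin {N B₁ d₁ B₂ d₂ : ℕ} (L₀ : ℕ) (ε ζ : ℝ)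
    (hbad : ((univ.filter
      (fun gh : (Fin N → Fin d₁ → Fin B₁) × (Fin d₁ → Fin d₂ → Fin B₁ → Fin B₂) =>
        ¬ HasIsolation L₀ ε ζ (twoLayerNbr gh))).card : ℝ) ≤ (N : ℝ) ^ (-(1 : ℝ)) *
        Fintype.card ((Fin N → Fin d₁ → Fin B₁) × (Fin d₁ → Fin d₂ → Fin B₁ → Fin B₂))) :
    ((univ.filter
      (fun gh : (Fin N → Fin d₁ → Fin B₁) × (Fin d₁ → Fin d₂ → Fin B₁ → Fin B₂) =>
        HasIsolation L₀ ε ζ (twoLayerNbr gh))).card : ℝ) ≥ (1 - (N : ℝ) ^ (-(1 : ℝ))) *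
        Fintype.card ((Fin N → Fin d₁ → Fin B₁) × (Fin d₁ → Fin d₂ → Fin B₁ → Fin B₂)) := by
  have h := card_filter_add_card_filter_not
    (s := (univ : Finset ((Fin N → Fin d₁ → Fin B₁) × (Fin d₁ → Fin d₂ → Fin B₁ → Fin B₂))))
    (fun gh => HasIsolation L₀ ε ζ (twoLayerNbr gh))
  rw [card_univ] at h
  have h' : ((univ.filter
      (fun gh : (Fin N → Fin d₁ → Fin B₁) × (Fin d₁ → Fin d₂ → Fin B₁ → Fin B₂) =>
        HasIsolation L₀ ε ζ (twoLayerNbr gh))).card : ℝ) + ((univ.filter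
      (fun gh : (Fin N → Fin d₁ → Fin B₁) × (Fin d₁ → Fin d₂ → Fin B₁ → Fin B₂) =>
        ¬ HasIsolation L₀ ε ζ (twoLayerNbr gh))).card : ℝ) =
      Fintype.card ((Fin N → Fin d₁ → Fin B₁) × (Fin d₁ → Fin d₂ → Fin B₁ → Fin B₂)) := by
    exact_mod_cast h
  linarith

lemma tl_exp1 (C a ζ ε ℓ s x D M : ℝ) (ha : 0 < a) (hζ : 0 < ζ) (hε : 0 < ε)
    (hs : 0 ≤ s) (hx : ε * s ≤ x) (hD : C * a * (1 / (ζ * ε)) * ℓ ≤ D) (hC : 0 < C)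
    (hℓ : 0 < ℓ) (h5 : 5 * M ≤ C / 4 * ℓ) :
    5 * s * M ≤ 1 / a * (ζ / 4) * x * D := by
  have hx0 : 0 ≤ x := le_trans (by positivity) hx
  calc 5 * s * M ≤ C / 4 * s * ℓ := by
        have := mul_le_mul_of_nonneg_left h5 hs
        linarith
    _ = 1 / a * (ζ / 4) * (ε * s) * (C * a * (1 / (ζ * ε)) * ℓ) := by field_simp
    _ ≤ _ := by gcongr

lemma tl_exp2 (C a ζ ε ℓ s x d₁ d₂ lb M : ℝ) (ha : 1 ≤ a) (hζ : 0 < ζ) (hζ1 : ζ < 1)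
    (hε : 0 < ε) (hs : 0 ≤ s) (hx : ε * s ≤ x) (hD : C * a * (1 / (ζ * ε)) * ℓ ≤ d₁ * lb)
    (hC : 40 ≤ C) (hℓ : 0 < ℓ) (hd₁ : 0 ≤ d₁) (hd₂ : C * (1 / ζ) * lb ≤ d₂)
    (h5 : 5 * M ≤ C / 4 * ℓ) :
    5 * s * M ≤ ζ / 4 * x * (d₁ * d₂) := by
  have hx0 : 0 ≤ x := le_trans (by positivity) hx
  have hC0 : 0 < C := by linarith
  have ha0 : 0 < a := by linarith
  calc 5 * s * M ≤ C / 4 * s * ℓ := by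
        have := mul_le_mul_of_nonneg_left h5 hs
        linarith
    _ ≤ (C * a / ζ) * (C / 4 * s * ℓ) := by
        apply le_mul_of_one_le_left (by positivity)
        rw [le_div_iff₀ hζ]
        nlinarith
    _ = ζ / 4 * (ε * s) * (C * a * (1 / (ζ * ε)) * ℓ * (C * (1 / ζ))) := by field_simp
    _ ≤ ζ / 4 * x * (d₁ * lb * (C * (1 / ζ))) := by gcongr
    _ = ζ / 4 * x * (d₁ * (C * (1 / ζ) * lb)) := by ring
    _ ≤ _ := by gcongr

end Aux

set_option maxHeartbeats 2000000 in
open Classical in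
/-- Two-layer isolation property (Lemma 3.4), stated by counting instances of the
two-layer hashing scheme. -/
theorem two_layer_isolation :
    ∀ ε₀ α A : ℝ, 0 < ε₀ → 1 < α → 1 ≤ A →
    ∃ C c : ℝ, 0 < C ∧ 0 < c ∧
      ∀ ε : ℝ, 0 < ε → ε < ε₀ →
      ∀ ζ : ℝ, 0 < ζ → ζ < 1 →
      ∀ k : ℕ, 1 ≤ k →
      ∃ N₀ : ℕ, ∀ N : ℕ, N₀ ≤ N →
      ∀ B₁ d₁ B₂ d₂ : ℕ,
        (B₁ : ℝ) ≥ C * k / (ζ ^ α * ε ^ (2 * α)) →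
        (d₁ : ℝ) ≥ C * (α / (α - 1)) * (1 / (ζ * ε)) *
            Real.log ((N : ℝ) / k) / Real.log ((B₁ : ℝ) / k) →
        (B₂ : ℝ) ≥ C * k / (ζ * ε) →
        (d₂ : ℝ) ≥ C * (1 / ζ) * Real.log ((B₁ : ℝ) / k) →
        ((Finset.univ.filter
            (fun gh : (Fin N → Fin d₁ → Fin B₁) × (Fin d₁ → Fin d₂ → Fin B₁ → Fin B₂) =>
              HasIsolation (Nat.ceil (A * k / ε)) ε ζ (twoLayerNbr gh))).card : ℝ)
          ≥ (1 - (N : ℝ) ^ (-c)) *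
            (Fintype.card ((Fin N → Fin d₁ → Fin B₁) × (Fin d₁ → Fin d₂ → Fin B₁ → Fin B₂))) := by
  intro ε₀ α A hε₀ hα hA
  have he0 : 0 < Real.exp 1 := Real.exp_pos 1
  refine ⟨(8 * Real.exp 1 * A) ^ α + 8 * Real.exp 1 ^ 2 * A + 40, 1, by positivity, one_pos, ?_⟩
  set C := (8 * Real.exp 1 * A) ^ α + 8 * Real.exp 1 ^ 2 * A + 40 with hCdef
  have hC1 : (8 * Real.exp 1 * A) ^ α ≤ C := by
    have : 0 ≤ 8 * Real.exp 1 ^ 2 * A := by positivity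
    linarith
  have hC2 : 8 * Real.exp 1 ^ 2 * A ≤ C := by
    have : 0 ≤ (8 * Real.exp 1 * A) ^ α := by positivity
    linarith
  have hC3 : 40 ≤ C := by
    have : 0 ≤ (8 * Real.exp 1 * A) ^ α := by positivity
    have : 0 ≤ 8 * Real.exp 1 ^ 2 * A := by positivity
    linarith
  clear_value C
  intro ε hε hεε₀ ζ hζ hζ1 k hk
  refine ⟨max (k ^ 2) 2, ?_⟩
  intro N hN B₁ d₁ B₂ d₂ hB₁ hd₁ hB₂ hd₂
  have hNk : k ^ 2 ≤ N := (le_max_left _ _).trans hN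
  have hN2 : 2 ≤ N := (le_max_right _ _).trans hN
  apply tl_fin
  rcases le_or_gt 1 ε with hε1 | hε1
  · have : (Finset.univ.filter
      (fun gh : (Fin N → Fin d₁ → Fin B₁) × (Fin d₁ → Fin d₂ → Fin B₁ → Fin B₂) =>
        ¬ HasIsolation (Nat.ceil (A * k / ε)) ε ζ (twoLayerNbr gh))) = ∅ := by
      apply Finset.filter_eq_empty_iff.2
      intro gh _
      rw [not_not]
      intro S _
      refine ⟨∅, Finset.empty_subset _, ?_, by simp⟩
      simp only [Finset.card_empty, Nat.cast_zero]
      exact mul_nonpos_of_nonpos_of_nonneg (by linarith) (Nat.cast_nonneg _)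
    rw [this]
    simp only [Finset.card_empty, Nat.cast_zero]
    positivity
  have hkr : (1 : ℝ) ≤ k := by exact_mod_cast hk
  have hk0 : (0 : ℝ) < k := by linarith
  have hNr : (2 : ℝ) ≤ N := by exact_mod_cast hN2
  have hN0 : (0 : ℝ) < N := by linarith
  have hC0 : 0 < C := by linarith
  -- first-layer parameters
  have hden : 0 < ζ ^ α * ε ^ (2 * α) := by positivity
  have hden' : ζ ^ α * ε ^ (2 * α) ≤ (ζ * ε) ^ α := by
    rw [Real.mul_rpow hζ.le hε.le]
    refine mul_le_mul_of_nonneg_left ?_ (by positivity)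
    exact Real.rpow_le_rpow_of_exponent_ge hε hε1.le (by linarith)
  have hζε : 0 < ζ * ε := by positivity
  have hζε1 : ζ * ε ≤ 1 := by nlinarith
  set β : ℝ := (B₁ : ℝ) / k with hβ
  have hβB : (B₁ : ℝ) = β * k := by rw [hβ]; field_simp
  have hβ1 : C / (ζ * ε) ^ α ≤ β := by
    rw [hβ, le_div_iff₀ hk0]
    refine le_trans ?_ hB₁
    rw [div_mul_eq_mul_div]
    gcongr
  have hpow1 : (ζ * ε) ^ α ≤ 1 := Real.rpow_le_one hζε.le hζε1 (by linarith)
  have hpow0 : 0 < (ζ * ε) ^ α := by positivity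
  have hβC : C ≤ β := by
    refine le_trans ?_ hβ1
    rw [le_div_iff₀ hpow0]
    nlinarith
  have hβ0 : 0 < β := by linarith
  have hlogβ : 0 < Real.log β := Real.log_pos (by linarith)
  have hbase : 8 * Real.exp 1 * A / (ζ * ε) ≤ β ^ (1 / α) := by
    have h1 : (8 * Real.exp 1 * A / (ζ * ε)) ^ α ≤ β := by
      rw [Real.div_rpow (by positivity) hζε.le]
      refine le_trans ?_ hβ1
      gcongr
    have h2 := Real.rpow_le_rpow (by positivity) h1 (show 0 ≤ 1 / α by positivity)
    rwa [← Real.rpow_mul (by positivity), mul_one_div_cancel (by linarith), Real.rpow_one] at h2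
  have hlogN : 0 < Real.log N := Real.log_pos (by linarith)
  have hℓ : Real.log N / 2 ≤ Real.log ((N : ℝ) / k) := by
    rw [Real.log_div (by positivity) (by positivity)]
    have h1 : Real.log ((k : ℝ) ^ 2) ≤ Real.log N :=
      Real.log_le_log (by positivity) (by exact_mod_cast hNk)
    rw [Real.log_pow] at h1
    push_cast at h1
    linarith
  set ℓ := Real.log ((N : ℝ) / k)
  have hℓ0 : 0 < ℓ := by linarith
  have ha : 1 ≤ α / (α - 1) := by
    rw [le_div_iff₀ (by linarith)]; linarith
  set a := α / (α - 1) with hadef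
  have ha0 : 0 < a := by linarith
  have haα : 1 - 1 / α = 1 / a := by
    have : α - 1 ≠ 0 := by linarith
    rw [hadef]; field_simp
  have hd₁' : C * a * (1 / (ζ * ε)) * ℓ ≤ d₁ * Real.log β := by
    have := (div_le_iff₀ hlogβ).1 hd₁
    exact this
  have hd₂pos : 0 < d₂ := by
    have : (0 : ℝ) < d₂ := lt_of_lt_of_le (by positivity) hd₂
    exact_mod_cast this
  have hB₁pos : 0 < B₁ := by
    have : (0 : ℝ) < B₁ := lt_of_lt_of_le (by positivity) hB₁
    exact_mod_cast this
  have hB₂pos : 0 < B₂ := by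
    have : (0 : ℝ) < B₂ := lt_of_lt_of_le (by positivity) hB₂
    exact_mod_cast this
  have hceil : ((Nat.ceil (A * k / ε) : ℕ) : ℝ) ≤ 2 * A * k / ε := by
    have h1 : 1 ≤ A * k / ε := by
      rw [le_div_iff₀ hε]; nlinarith
    have h2 := Nat.ceil_lt_add_one (show 0 ≤ A * k / ε by positivity)
    have : 2 * A * k / ε = 2 * (A * k / ε) := by ring
    linarith
  have hy : ∀ s : ℕ, (1 / (N : ℝ) ^ 5) ^ s = Real.exp (-(5 * s * Real.log N)) := by
    intro s
    have : (1 / (N : ℝ) ^ 5) = Real.exp (-(5 * Real.log N)) := by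
      rw [Real.exp_neg, one_div, show (5 : ℝ) * Real.log N = (5 : ℕ) * Real.log N by norm_num,
        Real.exp_nat_mul, Real.exp_log hN0]
    rw [this, ← Real.exp_nat_mul]
    congr 1
    ring
  have h5 : 5 * Real.log N ≤ C / 4 * ℓ := by nlinarith
  have hmain := tl_union (N := N) (B₁ := B₁) (d₁ := d₁) (B₂ := B₂) (d₂ := d₂)
    (Nat.ceil (A * k / ε)) ε ζ (1 / (N : ℝ) ^ 5) hε (by positivity) hd₂pos ?_ ?_
  · refine hmain.trans ?_
    refine mul_le_mul_of_nonneg_right ?_ (Nat.cast_nonneg _)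
    exact tl_num hN2 _ (by positivity) le_rfl
  · intro S X hS hXS hX
    have hSr : (S.card : ℝ) ≤ 2 * A * k / ε := le_trans (by exact_mod_cast hS) hceil
    refine (tl_layer1 S X (ζ / 4) (β ^ (1 / α - 1)) (by positivity) (by positivity) ?_ hB₁pos
      ?_).trans ?_
    · refine Real.rpow_le_one_of_one_le_of_nonpos (by linarith) ?_
      rw [show 1 / α - 1 = -(1 - 1 / α) by ring, haα]
      have : 0 < 1 / a := by positivity
      linarith
    · have h1 : β ^ (1 / α - 1) * β = β ^ (1 / α) := by
        rw [← Real.rpow_add_one hβ0.ne']; congr 1; ring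
      calc Real.exp 1 * S.card ≤ Real.exp 1 * (2 * A * k / ε) := by gcongr
        _ = (8 * Real.exp 1 * A / (ζ * ε)) * (ζ / 4 * k) := by field_simp; ring
        _ ≤ β ^ (1 / α) * (ζ / 4 * k) := by gcongr
        _ = β ^ (1 / α - 1) * (ζ / 4) * B₁ := by rw [← h1, hβB]; ring
    · refine mul_le_mul_of_nonneg_right ?_ (Nat.cast_nonneg _)
      rw [hy, ← Real.rpow_mul hβ0.le, Real.rpow_def_of_pos hβ0]
      apply Real.exp_le_exp.2
      rw [show 1 / α - 1 = -(1 - 1 / α) by ring, haα]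
      push_cast
      have := tl_exp1 C a ζ ε ℓ S.card X.card (d₁ * Real.log β) (Real.log N) ha0 hζ hε
        (Nat.cast_nonneg _) hX.le hd₁' hC0 hℓ0 h5
      linarith
  · intro S X hS hXS hX g
    have hSr : (S.card : ℝ) ≤ 2 * A * k / ε := le_trans (by exact_mod_cast hS) hceil
    refine (tl_layer2 S X hXS g (ζ / 4) (Real.exp (-1)) (by positivity) (by positivity) ?_ hB₂pos
      ?_).trans ?_
    · rw [Real.exp_le_one_iff]; norm_num
    · calc Real.exp 1 * S.card ≤ Real.exp 1 * (2 * A * k / ε) := by gcongr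
        _ = (Real.exp 1)⁻¹ * (ζ / 4) * ((8 * Real.exp 1 ^ 2 * A) * k / (ζ * ε)) := by
            field_simp; ring
        _ ≤ (Real.exp 1)⁻¹ * (ζ / 4) * (C * k / (ζ * ε)) := by gcongr
        _ ≤ (Real.exp 1)⁻¹ * (ζ / 4) * B₂ := by gcongr
        _ = _ := by rw [Real.exp_neg]
    · refine mul_le_mul_of_nonneg_right ?_ (Nat.cast_nonneg _)
      rw [hy, ← Real.exp_mul]
      apply Real.exp_le_exp.2
      push_cast
      have := tl_exp2 C a ζ ε ℓ S.card X.card d₁ d₂ (Real.log β) (Real.log N) ha hζ hζ1 hε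
        (Nat.cast_nonneg _) hX.le hd₁' hC3 hℓ0 (Nat.cast_nonneg _) hd₂ h5
      linarith
end

section
/- Noise lemma (Lemma A.1): Let a and t be positive integers with t > a ≥ 1, let ε ∈ (0, 1/2), and let Φ ∈ {0,1}^{m×n} be the adjacency matrix of an (n, m, d, 2a, ε)-bipartite expander (left part [n], right part [m]). Let x ∈ ℝⁿ satisfy |x₁| ≥ |x₂| ≥ ⋯ ≥ |xₙ| and let I = {1, …, a}. Then ‖(Φ(x − x_[t]))_{Γ(I)}‖₁ ≤ 4εd·(‖x − x_[t]‖₁ + a·|x_{t+1}|), where x_[t] is x with all but its first t entries zeroed, Γ(I) ⊆ [m] is the set of neighbours of I, and (v)_{Γ(I)} denotes the restriction of v ∈ ℝ^m to the coordinates in Γ(I) (zero elsewhere). -/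
theorem block_sum (c y : ℕ → ℝ) (K : ℝ) (a t : ℕ) (hK : 0 ≤ K)
    (hy : ∀ i, 0 ≤ y i) (hmono : Antitone y) (hc : ∀ i, 0 ≤ c i)
    (hw : ∀ s, t ≤ s → ∑ i ∈ Finset.Ico s (s + a), c i ≤ K * a) (k : ℕ) :
    ∀ s, t ≤ s → ∑ i ∈ Finset.Ico s (s + k * a), c i * y i
      ≤ K * (∑ i ∈ Finset.Ico s (s + k * a), y i + a * y s) := by
  induction k with
  | zero =>
    intro s _
    have := hy s
    simp only [Nat.zero_mul, Nat.add_zero, Finset.Ico_self, Finset.sum_empty]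
    positivity
  | succ k ih =>
    intro s hs
    have e : s + (k + 1) * a = (s + a) + k * a := by ring
    rw [e, ← Finset.sum_Ico_consecutive (fun i => c i * y i) (Nat.le_add_right s a) (Nat.le_add_right (s + a) (k * a)),
      ← Finset.sum_Ico_consecutive y (Nat.le_add_right s a) (Nat.le_add_right (s + a) (k * a))]
    have h1 := ih (s + a) (by omega)
    have h2 : ∑ i ∈ Finset.Ico s (s + a), c i * y i ≤ K * a * y s := by
      calc _ ≤ ∑ i ∈ Finset.Ico s (s + a), c i * y s := by
            apply Finset.sum_le_sum
            intro i hi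
            exact mul_le_mul_of_nonneg_left (hmono (Finset.mem_Ico.1 hi).1) (hc i)
        _ = (∑ i ∈ Finset.Ico s (s + a), c i) * y s := by rw [Finset.sum_mul]
        _ ≤ _ := mul_le_mul_of_nonneg_right (hw s hs) (hy s)
    have h3 : (a : ℝ) * y (s + a) ≤ ∑ i ∈ Finset.Ico s (s + a), y i := by
      have : ∑ i ∈ Finset.Ico s (s + a), y (s + a) ≤ ∑ i ∈ Finset.Ico s (s + a), y i := by
        apply Finset.sum_le_sum
        intro i hi
        exact hmono (Finset.mem_Ico.1 hi).2.le
      simpa using this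
    have h4 := mul_le_mul_of_nonneg_left h3 hK
    linarith

theorem sum_Ico_fin (n s e : ℕ) (f : ℕ → ℝ) (hf : ∀ i, n ≤ i → f i = 0) :
    ∑ i ∈ Finset.Ico s e, f i = ∑ i : Fin n, if s ≤ (i : ℕ) ∧ (i : ℕ) < e then f i else 0 := by
  rw [Fin.sum_univ_eq_sum_range (fun i => if s ≤ i ∧ i < e then f i else 0) n,
    ← Finset.sum_filter]
  symm
  apply Finset.sum_subset
  · intro i hi
    simp at hi ⊢
    omega
  · intro i hi hi'
    apply hf
    simp at hi hi'
    by_contra h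
    omega

theorem nbrSet_eq {L R D : Type*} [Fintype D] [DecidableEq R] (nbr : L → D → R) (S : Finset L) :
    nbrSet nbr S = S.biUnion (fun i => Finset.image (nbr i) Finset.univ) := by
  ext u
  simp [nbrSet]

open Classical in
theorem overlap_bound (n m d a : ℕ) (ε : ℝ) (hε : 0 < ε)
    (nbr : Fin n → Fin d → Fin m) (hexp : IsExpander (2 * a : ℝ) ε nbr)
    (I B : Finset (Fin n)) (hI : I.card ≤ a) (hB : B.card ≤ a) (hd : Disjoint I B) :
    ∑ i ∈ B, (((nbrSet nbr I).filter (fun u => ∃ j, nbr i j = u)).card : ℝ) ≤ 2 * ε * d * a := by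
  have hI' : (I.card : ℝ) ≤ a := by exact_mod_cast hI
  have hB' : (B.card : ℝ) ≤ a := by exact_mod_cast hB
  have h1 := hexp (I ∪ B) (by
    rw [Finset.card_union_of_disjoint hd]; push_cast; linarith)
  rw [Finset.card_union_of_disjoint hd, Fintype.card_fin] at h1
  push_cast at h1
  have himg : ∀ i, (Finset.image (nbr i) Finset.univ).card ≤ d := fun i =>
    Finset.card_image_le.trans (by simp)
  have h2 : (nbrSet nbr I).card ≤ I.card * d := by
    rw [nbrSet_eq]
    exact Finset.card_biUnion_le_card_mul _ _ _ (fun i _ => himg i)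
  have h3 : (nbrSet nbr (I ∪ B)).card ≤ (nbrSet nbr I).card
      + ∑ i ∈ B, (Finset.image (nbr i) Finset.univ \ nbrSet nbr I).card := by
    refine le_trans (Finset.card_le_card ?_) ((Finset.card_union_le (nbrSet nbr I)
      (B.biUnion fun i => Finset.image (nbr i) Finset.univ \ nbrSet nbr I)).trans
        (Nat.add_le_add_left Finset.card_biUnion_le _))
    intro u hu
    by_cases hu' : u ∈ nbrSet nbr I
    · exact Finset.mem_union_left _ hu'
    · apply Finset.mem_union_right
      obtain ⟨i, hi, hiu⟩ := Finset.mem_biUnion.1 (nbrSet_eq nbr (I ∪ B) ▸ hu)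
      rcases Finset.mem_union.1 hi with h | h
      · exact absurd (by rw [nbrSet_eq]; exact Finset.mem_biUnion.2 ⟨i, h, hiu⟩) hu'
      · exact Finset.mem_biUnion.2 ⟨i, h, Finset.mem_sdiff.2 ⟨hiu, hu'⟩⟩
  have h4 : ∑ i ∈ B, (Finset.image (nbr i) Finset.univ \ nbrSet nbr I).card
      + ∑ i ∈ B, ((nbrSet nbr I).filter (fun u => ∃ j, nbr i j = u)).card ≤ B.card * d := by
    rw [← Finset.sum_add_distrib, ← smul_eq_mul]
    apply Finset.sum_le_card_nsmul
    intro i _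
    have : (nbrSet nbr I).filter (fun u => ∃ j, nbr i j = u)
        = Finset.image (nbr i) Finset.univ ∩ nbrSet nbr I := by
      ext u; simp [and_comm]
    rw [this, Finset.card_sdiff_add_card_inter]
    exact himg i
  have h5 : (nbrSet nbr (I ∪ B)).card + ∑ i ∈ B, ((nbrSet nbr I).filter (fun u => ∃ j, nbr i j = u)).card
      ≤ I.card * d + B.card * d := by omega
  have h6 : ((nbrSet nbr (I ∪ B)).card : ℝ) + ∑ i ∈ B, (((nbrSet nbr I).filter (fun u => ∃ j, nbr i j = u)).card : ℝ)
      ≤ I.card * d + B.card * d := by exact_mod_cast h5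
  have h7 : ε * d * (I.card + B.card) ≤ ε * d * (2 * a) :=
    mul_le_mul_of_nonneg_left (by linarith) (by positivity)
  linarith

open Classical in
theorem bucket_bound (n m d : ℕ) (nbr : Fin n → Fin d → Fin m) (z : Fin n → ℝ)
    (U : Finset (Fin m)) :
    ∑ u ∈ U, |bucketSum nbr z u|
      ≤ ∑ i, ((U.filter (fun u => ∃ j, nbr i j = u)).card : ℝ) * |z i| := by
  calc _ ≤ ∑ u ∈ U, ∑ i, if ∃ j, nbr i j = u then |z i| else 0 := by
        apply Finset.sum_le_sum
        intro u _
        rw [← Finset.sum_filter]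
        unfold bucketSum
        have h := Finset.abs_sum_le_sum_abs z (Finset.univ.filter (fun i => ∃ j, nbr i j = u))
        refine le_trans (le_of_eq ?_) (h.trans (le_of_eq ?_))
        · congr 2
          ext i; simp
        · apply Finset.sum_congr _ (fun _ _ => rfl)
          ext i; simp
    _ = _ := by
        rw [Finset.sum_comm]
        apply Finset.sum_congr rfl
        intro i _
        rw [← Finset.sum_filter, Finset.sum_const, nsmul_eq_mul]

open Classical in
/-- Noise lemma (Lemma A.1).  Here `x - x_[t]` is the vector `x` with its first `t`
entries (1-based) zeroed out, `I = {1, …, a}` and `x_{t+1}` is the entry `x ⟨t, _⟩`. -/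
theorem noise_lemma
    (n m d a t : ℕ) (ε : ℝ)
    (nbr : Fin n → Fin d → Fin m)
    (ha : 1 ≤ a) (hat : a < t) (htn : t < n)
    (hε : 0 < ε) (hε2 : ε < 1/2)
    (hexp : IsExpander (2 * a : ℝ) ε nbr)
    (x : Fin n → ℝ)
    (hsort : ∀ i j : Fin n, i ≤ j → |x j| ≤ |x i|) :
    ∑ u ∈ nbrSet nbr (Finset.univ.filter (fun i : Fin n => (i : ℕ) < a)),
        |bucketSum nbr (fun i => if (i : ℕ) < t then 0 else x i) u|
      ≤ 4 * ε * d *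
          (l1 (fun i => if (i : ℕ) < t then 0 else x i) + a * |x ⟨t, htn⟩|) := by
  set I := Finset.univ.filter (fun i : Fin n => (i : ℕ) < a) with hIdef
  have hcard : ∀ s, (Finset.univ.filter (fun i : Fin n => s ≤ (i : ℕ) ∧ (i : ℕ) < s + a)).card ≤ a := by
    intro s
    have : (Finset.univ.filter (fun i : Fin n => s ≤ (i : ℕ) ∧ (i : ℕ) < s + a)).card
        ≤ (Finset.Ico s (s + a)).card := by
      apply Finset.card_le_card_of_injOn (fun i : Fin n => (i : ℕ))
      · intro i hi
        simpa using hi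
      · intro i _ j _ h
        exact Fin.ext h
    simpa using this
  have hI : I.card ≤ a := by simpa using hcard 0
  set g : Fin n → ℝ := fun i => (((nbrSet nbr I).filter (fun u => ∃ j, nbr i j = u)).card : ℝ) with hg
  have hg0 : ∀ i, 0 ≤ g i := fun i => Nat.cast_nonneg _
  let c : ℕ → ℝ := fun i => if h : i < n then g ⟨i, h⟩ else 0
  let y : ℕ → ℝ := fun i => if h : i < n then |x ⟨i, h⟩| else 0
  have hcf : ∀ i : Fin n, c i = g i := fun i => by simp [c]
  have hyf : ∀ i : Fin n, y i = |x i| := fun i => by simp [y]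
  have hcn : ∀ i, n ≤ i → c i = 0 := fun i hi => by simp [c, hi]
  have hyn : ∀ i, n ≤ i → y i = 0 := fun i hi => by simp [y, hi]
  have hy : ∀ i, 0 ≤ y i := fun i => by
    simp only [y]; split_ifs <;> positivity
  have hc : ∀ i, 0 ≤ c i := fun i => by
    simp only [c]; split_ifs
    · exact hg0 _
    · exact le_rfl
  have hmono : Antitone y := by
    intro i j hij
    by_cases hj : j < n
    · have hi : i < n := by omega
      simp only [y, hi, hj, dif_pos]
      exact hsort _ _ hij
    · rw [hyn j (by omega)]
      exact hy i
  have hw : ∀ s, t ≤ s → ∑ i ∈ Finset.Ico s (s + a), c i ≤ (2 * ε * d) * a := by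
    intro s hs
    rw [sum_Ico_fin n s (s + a) c hcn, ← Finset.sum_filter]
    simp only [hcf]
    apply overlap_bound n m d a ε hε nbr hexp I _ hI (hcard s)
    rw [Finset.disjoint_left]
    intro i hi hi'
    simp [hIdef] at hi hi'
    omega
  have hK : 0 ≤ 2 * ε * d := by positivity
  have key := block_sum c y (2 * ε * d) a t hK hy hmono hc hw n t le_rfl
  rw [sum_Ico_fin n _ _ (fun i => c i * y i) (fun i hi => by simp [hyn i hi]),
    sum_Ico_fin n _ _ y hyn] at key
  have hlt : ∀ i : Fin n, (i : ℕ) < t + n * a := fun i => by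
    have := i.2
    nlinarith
  have hyt : y t = |x ⟨t, htn⟩| := hyf ⟨t, htn⟩
  simp only [hlt, and_true, hcf, hyf, hyt] at key
  have hl : l1 (fun i : Fin n => if (i : ℕ) < t then 0 else x i)
      = ∑ i : Fin n, if t ≤ (i : ℕ) then |x i| else 0 := by
    unfold l1
    apply Finset.sum_congr rfl
    intro i _
    by_cases h : (i : ℕ) < t
    · simp [h, not_le.2 h]
    · simp [h, not_lt.1 h]
  have hb := bucket_bound n m d nbr (fun i => if (i : ℕ) < t then 0 else x i) (nbrSet nbr I)
  have hb' : ∑ i : Fin n, g i * |if (i : ℕ) < t then 0 else x i|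
      = ∑ i : Fin n, if t ≤ (i : ℕ) then g i * |x i| else 0 := by
    apply Finset.sum_congr rfl
    intro i _
    by_cases h : (i : ℕ) < t
    · simp [h, not_le.2 h]
    · simp [h, not_lt.1 h]
  have hl0 : 0 ≤ l1 (fun i : Fin n => if (i : ℕ) < t then 0 else x i) :=
    Finset.sum_nonneg (fun i _ => abs_nonneg _)
  rw [← hl] at key
  have h0 : 0 ≤ 2 * ε * d * (l1 (fun i : Fin n => if (i : ℕ) < t then 0 else x i) + a * |x ⟨t, htn⟩|) := by
    positivity
  refine (hb.trans (hb'.le.trans key)).trans ?_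
  linarith
end

section
/- Decoys lemma (Lemma A.2): Let s be a positive integer, ε ∈ (0,1), and β, ζ > 0 with 1/2 − ζ > 576β. Let G be a d-left-regular bipartite graph with left part [n] and right part [m] that is an (n, m, d, 4s, ε/512)-bipartite expander and satisfies the (⌈9s/ε⌉, β·ε, ζ)-isolation property, and let Φ ∈ {0,1}^{m×n} be its adjacency matrix. Let x ∈ ℝⁿ admit a decomposition x = y + z with |supp(y)| ≤ s and ‖z‖₁ ≤ 3/2, and for each i ∈ [n] define x'_i as the median over the d neighbours u ∈ Γ({i}) of the bucket sums (Φx)_u. Then the set D = {i ∈ [n] : |x_i − x'_i| ≥ ε/(4s)} satisfies |D| < s/8. -/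
lemma median_aux {d : ℕ} (hd : 0 < d) (v : Fin d → ℝ) (a t : ℝ)
    (h : t ≤ |a - medianVal v|) :
    d ≤ 2 * (Finset.univ.filter (fun j => t ≤ |a - v j|)).card := by
  classical
  set l := (Multiset.map v Finset.univ.val).sort (· ≤ ·) with hl
  have hlen : l.length = d := by simp [hl]
  have hq : (d + 1) / 2 - 1 < l.length := by omega
  have hmed : medianVal v = l[(d + 1) / 2 - 1] := by
    unfold medianVal
    rw [← hl, List.getD_eq_getElem _ _ hq]
  have hcard : (Finset.univ.filter (fun j => t ≤ |a - v j|)).card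
      = l.countP (fun r => decide (t ≤ |a - r|)) := by
    have h1 : (l : Multiset ℝ) = Multiset.map v Finset.univ.val := by
      rw [hl, Multiset.sort_eq]
    have h2 : Multiset.countP (fun r => t ≤ |a - r|) (l : Multiset ℝ)
        = (Finset.univ.filter (fun j => t ≤ |a - v j|)).card := by
      rw [h1, Multiset.countP_map]; rfl
    rw [← h2, Multiset.coe_countP]
  have hsort : l.Pairwise (· ≤ ·) := Multiset.pairwise_sort _ _
  have hmono : ∀ i j (hi : i < l.length) (hj : j < l.length), i ≤ j → l[i] ≤ l[j] := by
    intro i j hi hj hij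
    rcases hij.lt_or_eq with h | h
    · exact List.pairwise_iff_getElem.1 hsort i j hi hj h
    · subst h; exact le_rfl
  rw [hcard]
  rw [hmed] at h
  rcases le_abs'.1 h with h | h
  · have hall : ∀ r ∈ l.drop ((d+1)/2-1), decide (t ≤ |a - r|) = true := by
      intro r hr
      obtain ⟨i, hi, rfl⟩ := List.mem_iff_getElem.1 hr
      rw [List.getElem_drop]
      have := hmono ((d+1)/2-1) ((d+1)/2-1+i) hq (by simp at hi; omega) (by omega)
      simp only [decide_eq_true_eq]
      apply le_abs'.2; left; linarith
    have h1 := (List.drop_sublist ((d+1)/2-1) l).countP_le (p := fun r => decide (t ≤ |a - r|))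
    rw [List.countP_eq_length.2 hall, List.length_drop, hlen] at h1
    omega
  · have hall : ∀ r ∈ l.take ((d+1)/2-1+1), decide (t ≤ |a - r|) = true := by
      intro r hr
      obtain ⟨i, hi, rfl⟩ := List.mem_iff_getElem.1 hr
      rw [List.getElem_take]
      have := hmono i ((d+1)/2-1) (by simp at hi; omega) hq (by simp at hi; omega)
      simp only [decide_eq_true_eq]
      apply le_abs'.2; right; linarith
    have h1 := (List.take_sublist ((d+1)/2-1+1) l).countP_le (p := fun r => decide (t ≤ |a - r|))
    rw [List.countP_eq_length.2 hall, List.length_take, hlen] at h1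
    omega

lemma top_aux {α : Type*} [DecidableEq α] (w : α → ℝ) (A : Finset α) (k : ℕ) (hk : k ≤ A.card) :
    ∃ B ⊆ A, B.card = k ∧ ∀ a ∈ A \ B, ∀ b ∈ B, w a ≤ w b := by
  induction k with
  | zero => exact ⟨∅, by simp, by simp, by simp⟩
  | succ k ih =>
    obtain ⟨B, hBA, hB, hw⟩ := ih (by omega)
    have hne : (A \ B).Nonempty := by
      rw [← Finset.card_pos, Finset.card_sdiff_of_subset hBA]; omega
    obtain ⟨c, hc, hmax⟩ := Finset.exists_max_image (A \ B) w hne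
    have hc' := Finset.mem_sdiff.1 hc
    refine ⟨insert c B, ?_, ?_, ?_⟩
    · exact Finset.insert_subset hc'.1 hBA
    · rw [Finset.card_insert_of_notMem hc'.2, hB]
    · intro a ha b hb
      have ha' : a ∈ A \ B := by
        simp only [Finset.mem_sdiff, Finset.mem_insert, not_or] at ha ⊢
        exact ⟨ha.1, ha.2.2⟩
      rcases Finset.mem_insert.1 hb with rfl | hb
      · exact hmax a ha'
      · exact hw a ha' b hb

/-- top block: what is outside is at most the average of the block -/
lemma top_avg {α : Type*} [DecidableEq α] (w : α → ℝ) (A : Finset α) (s : ℕ) :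
    ∃ B ⊆ A, B.card ≤ s ∧ (A.Nonempty → 0 < s → B.Nonempty) ∧
      ∀ a ∈ A \ B, w a * s ≤ ∑ b ∈ B, w b := by
  by_cases h : A.card ≤ s
  · exact ⟨A, subset_rfl, h, fun h _ => h, by simp⟩
  · obtain ⟨B, hBA, hB, hw⟩ := top_aux w A s (by omega)
    refine ⟨B, hBA, hB.le, fun _ hs => Finset.card_pos.1 (by omega), ?_⟩
    intro a ha
    have := Finset.card_nsmul_le_sum B w (w a) (fun b hb => hw a ha b hb)
    rw [hB, nsmul_eq_mul] at this
    linarith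

lemma block_aux {α : Type*} [DecidableEq α] (w c : α → ℝ) (s : ℕ) (hs : 0 < s) (K : ℝ)
    (hw : ∀ a, 0 ≤ w a) (hc : ∀ a, 0 ≤ c a) (hK : 0 ≤ K) (A : Finset α) :
    ∀ M : ℝ, 0 ≤ M → (∀ B ⊆ A, B.card ≤ s → ∑ b ∈ B, c b ≤ K) →
      (∀ a ∈ A, w a * s ≤ M) →
      (∑ a ∈ A, w a * c a) * s ≤ K * (M + ∑ a ∈ A, w a) := by
  induction A using Finset.strongInduction with
  | H A ih =>
    intro M hM hB hwM
    rcases A.eq_empty_or_nonempty with rfl | hne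
    · simp; positivity
    obtain ⟨B, hBA, hBs, hBne, hBw⟩ := top_avg w A s
    have hBne := hBne hne hs
    have hss : A \ B ⊂ A := Finset.sdiff_ssubset hBA hBne
    have h1 := ih (A \ B) hss (∑ b ∈ B, w b) (Finset.sum_nonneg fun b _ => hw b)
      (fun C hC => hB C (hC.trans Finset.sdiff_subset)) hBw
    have h2 : (∑ b ∈ B, w b * c b) * s ≤ M * K := by
      calc (∑ b ∈ B, w b * c b) * s = ∑ b ∈ B, (w b * s) * c b := by
            rw [Finset.sum_mul]; exact Finset.sum_congr rfl fun _ _ => by ring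
        _ ≤ ∑ b ∈ B, M * c b := Finset.sum_le_sum fun b hb =>
            mul_le_mul_of_nonneg_right (hwM b (hBA hb)) (hc b)
        _ = M * ∑ b ∈ B, c b := by rw [Finset.mul_sum]
        _ ≤ M * K := mul_le_mul_of_nonneg_left (hB B hBA hBs) hM
    rw [← Finset.sum_sdiff hBA, ← Finset.sum_sdiff (f := w) hBA]
    nlinarith

/-- the number of edges of `S` that are alone at their right endpoint -/
lemma clean_aux {α β : Type*} [DecidableEq α] [DecidableEq β] (E : Finset α) (f : α → β) :
    2 * (E.image f).card ≤ E.card + (E.filter (fun e => ∀ e' ∈ E, f e' = f e → e' = e)).card := by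
  set C := E.filter (fun e => ∀ e' ∈ E, f e' = f e → e' = e) with hC
  have h1 : (C.image f).card = C.card := by
    apply Finset.card_image_of_injOn
    intro a ha b hb hab
    have ha := Finset.mem_filter.1 ha
    have hb := Finset.mem_filter.1 hb
    exact hb.2 a ha.1 hab
  have hE := Finset.card_eq_sum_card_image f E
  have hsub : C.image f ⊆ E.image f := Finset.image_subset_image (Finset.filter_subset _ _)
  have h2 : 2 * (E.image f \ C.image f).card ≤ ∑ b ∈ E.image f \ C.image f, (E.filter (fun a => f a = b)).card := by
    rw [mul_comm, ← smul_eq_mul]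
    apply Finset.card_nsmul_le_sum
    intro b hb
    obtain ⟨hb1, hb2⟩ := Finset.mem_sdiff.1 hb
    obtain ⟨e, he, rfl⟩ := Finset.mem_image.1 hb1
    have : e ∉ C := fun h => hb2 (Finset.mem_image_of_mem f h)
    simp only [hC, Finset.mem_filter, not_and, not_forall] at this
    obtain ⟨e', he', h1, h2⟩ := this he
    exact Finset.one_lt_card.2 ⟨e', by simp [he', h1], e, by simp [he], h2⟩
  have h3 : (C.image f).card ≤ ∑ b ∈ C.image f, (E.filter (fun a => f a = b)).card := by
    rw [Finset.card_eq_sum_ones]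
    apply Finset.sum_le_sum
    intro b hb
    obtain ⟨e, he, rfl⟩ := Finset.mem_image.1 (hsub hb)
    exact Finset.card_pos.2 ⟨e, by simp [he]⟩
  rw [← Finset.sum_sdiff hsub] at hE
  have h4 := Finset.card_sdiff_add_card_eq_card hsub
  omega

open Classical in
/-- Decoys lemma (Lemma A.2).  `x'_i` is the median of the bucket sums over the `d`
neighbours of `i`, and the set of decoys `D = {i : |x_i - x'_i| ≥ ε/(4s)}` has fewer than
`s/8` elements. -/
theorem decoys_lemma
    (n m d s : ℕ) (ε β ζ : ℝ)
    (hs : 0 < s) (hd : 0 < d)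
    (hε : 0 < ε) (hε1 : ε < 1)
    (hβ : 0 < β) (hζ : 0 < ζ) (hζβ : 1/2 - ζ > 576 * β)
    (nbr : Fin n → Fin d → Fin m)
    (hexp : IsExpander (4 * s : ℝ) (ε / 512) nbr)
    (hiso : HasIsolation (Nat.ceil ((9 * s : ℝ) / ε)) (β * ε) ζ nbr)
    (x y z : Fin n → ℝ)
    (hxyz : x = y + z) (hy : (fsupp y).card ≤ s) (hz : l1 z ≤ 3/2) :
    ((Finset.univ.filter (fun i : Fin n =>
        ε / (4 * s) ≤ |x i - medianVal (fun j => bucketSum nbr x (nbr i j))|)).card : ℝ)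
      < (s : ℝ) / 8 := by
  classical
  by_contra hcon
  push Not at hcon
  set D := (Finset.univ.filter (fun i : Fin n =>
        ε / (4 * s) ≤ |x i - medianVal (fun j => bucketSum nbr x (nbr i j))|)) with hD
  have hsR : (0 : ℝ) < s := by exact_mod_cast hs
  have hdR : (0 : ℝ) < d := by exact_mod_cast hd
  have hk : (s + 7) / 8 ≤ D.card := by
    have h8 : (s : ℝ) ≤ ((8 * D.card : ℕ) : ℝ) := by push_cast; linarith
    have := Nat.cast_le.1 h8
    omega
  obtain ⟨D', hD'D, hD'card⟩ := Finset.exists_subset_card_eq hk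
  have hD's : D'.card ≤ s := by omega
  have hD'8 : (s : ℝ) ≤ 8 * D'.card := by
    have : s ≤ 8 * D'.card := by omega
    exact_mod_cast this
  set w : Fin n → ℝ := fun l => |z l| with hw
  have hw0 : ∀ a, 0 ≤ w a := fun a => abs_nonneg _
  obtain ⟨H, -, hHs, -, hHw⟩ := top_avg w Finset.univ s
  set S := D' ∪ fsupp y ∪ H with hS
  have hScard : S.card ≤ 3 * s := by
    have h1 := Finset.card_union_le (D' ∪ fsupp y) H
    have h2 := Finset.card_union_le D' (fsupp y)
    rw [hS]
    omega
  set A := Finset.univ \ S with hA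
  set Γ := nbrSet nbr D' with hΓ
  set c : Fin n → ℝ := fun l => ((Finset.univ.filter (fun j => nbr l j ∈ Γ)).card : ℝ) with hc
  have hc0 : ∀ a, 0 ≤ c a := fun a => Nat.cast_nonneg _
  have hD'R : (D'.card : ℝ) ≤ s := by exact_mod_cast hD's
  -- upper bound
  have hcB : ∀ B ⊆ A, B.card ≤ s → ∑ b ∈ B, c b ≤ ε / 512 * d * (2 * s) := by
    intro B hBA hBs
    have hBR : (B.card : ℝ) ≤ s := by exact_mod_cast hBs
    have hdisj : Disjoint B D' := by
      rw [Finset.disjoint_left]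
      intro a ha ha'
      have := hBA ha
      simp [hA, hS, ha'] at this
    have hcard : (B ∪ D').card = B.card + D'.card := Finset.card_union_of_disjoint hdisj
    have h1 := hexp (B ∪ D') (by rw [hcard]; push_cast; linarith)
    rw [hcard, Fintype.card_fin] at h1
    have hΓD : Γ.card ≤ D'.card * d := by
      have himg : Γ = (D' ×ˢ (Finset.univ : Finset (Fin d))).image (fun p => nbr p.1 p.2) := by
        ext u
        simp [hΓ, nbrSet]
      rw [himg]
      exact Finset.card_image_le.trans (by simp)
    have hsub : nbrSet nbr (B ∪ D') ⊆ Γ ∪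
        B.biUnion (fun l => Finset.image (nbr l) (Finset.univ.filter (fun j => nbr l j ∉ Γ))) := by
      intro u hu
      by_cases huΓ : u ∈ Γ
      · exact Finset.mem_union_left _ huΓ
      · apply Finset.mem_union_right
        simp only [nbrSet, Finset.mem_biUnion, Finset.mem_union, Finset.mem_image,
          Finset.mem_univ, true_and] at hu
        obtain ⟨l, hl, j, rfl⟩ := hu
        rcases hl with hl | hl
        · simp only [Finset.mem_biUnion, Finset.mem_image, Finset.mem_filter, Finset.mem_univ,
            true_and]
          exact ⟨l, hl, j, huΓ, rfl⟩
        · exfalso; apply huΓ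
          simp only [hΓ, nbrSet, Finset.mem_biUnion, Finset.mem_image,
            Finset.mem_univ, true_and]
          exact ⟨l, hl, j, rfl⟩
    have h2 : (nbrSet nbr (B ∪ D')).card ≤ D'.card * d +
        ∑ l ∈ B, (Finset.univ.filter (fun j => nbr l j ∉ Γ)).card := by
      refine (Finset.card_le_card hsub).trans ((Finset.card_union_le _ _).trans ?_)
      refine add_le_add hΓD (Finset.card_biUnion_le.trans ?_)
      exact Finset.sum_le_sum fun l _ => Finset.card_image_le
    have h3 : ∑ l ∈ B, (Finset.univ.filter (fun j => nbr l j ∈ Γ)).card +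
        ∑ l ∈ B, (Finset.univ.filter (fun j => nbr l j ∉ Γ)).card = B.card * d := by
      rw [← Finset.sum_add_distrib, ← smul_eq_mul, ← Finset.sum_const]
      refine Finset.sum_congr rfl fun l _ => ?_
      rw [Finset.card_filter_add_card_filter_not]; simp
    have h4 : ∑ b ∈ B, c b = ((∑ l ∈ B, (Finset.univ.filter (fun j => nbr l j ∈ Γ)).card : ℕ) : ℝ) := by
      simp [hc]
    have h5 : ((nbrSet nbr (B ∪ D')).card : ℝ) + ∑ b ∈ B, c b ≤ D'.card * d + B.card * d := by
      rw [h4]; exact_mod_cast (by omega)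
    push_cast at h1
    have h6 : ε / 512 * d * (B.card + D'.card) ≤ ε / 512 * d * (2 * s) := by
      apply mul_le_mul_of_nonneg_left _ (by positivity); linarith
    linarith
  have hup := block_aux w c s hs (ε / 512 * d * (2 * s)) hw0 hc0 (by positivity) A
    (∑ b ∈ H, w b) (Finset.sum_nonneg fun b _ => hw0 b) hcB (by
      intro a ha
      apply hHw
      simp only [hA, hS, Finset.mem_sdiff, Finset.mem_univ, true_and, Finset.mem_union, not_or] at ha ⊢
      exact ha.2)
  have hHA : ∑ b ∈ H, w b + ∑ a ∈ A, w a ≤ 3 / 2 := by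
    have hdisj : Disjoint H A := by
      rw [Finset.disjoint_left]
      intro a ha ha'
      simp [hA, hS, ha] at ha'
    rw [← Finset.sum_union hdisj]
    refine le_trans ?_ hz
    exact Finset.sum_le_sum_of_subset_of_nonneg (Finset.subset_univ _) fun i _ _ => hw0 i
  have hup2 : (∑ a ∈ A, w a * c a) * s ≤ ε / 512 * d * (2 * s) * (3 / 2) :=
    hup.trans (mul_le_mul_of_nonneg_left hHA (by positivity))
  -- lower bound
  set E : Finset (Fin n × Fin d) := S ×ˢ Finset.univ with hE
  set f : Fin n × Fin d → Fin m := fun p => nbr p.1 p.2 with hf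
  set C := E.filter (fun e => ∀ e' ∈ E, f e' = f e → e' = e) with hC
  have hclean : 2 * (E.image f).card ≤ E.card + C.card := by
    convert clean_aux E f
  have himg : nbrSet nbr S = E.image f := by
    ext u
    simp [nbrSet, hE, hf]
  have hEcard : E.card = S.card * d := by simp [hE]
  have hSR : (S.card : ℝ) ≤ 3 * s := by exact_mod_cast hScard
  have hexpS := hexp S (by linarith)
  rw [himg, Fintype.card_fin] at hexpS
  set P := (D' ×ˢ (Finset.univ : Finset (Fin d))).filter
    (fun p => ε / (4 * s) ≤ |x p.1 - bucketSum nbr x (nbr p.1 p.2)|) with hP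
  have hPcard : D'.card * d ≤ 2 * P.card := by
    have : P.card = ∑ i ∈ D', (Finset.univ.filter (fun j =>
        ε / (4 * s) ≤ |x i - bucketSum nbr x (nbr i j)|)).card := by
      rw [hP, Finset.card_filter, Finset.sum_product]
      refine Finset.sum_congr rfl fun i _ => ?_
      rw [Finset.card_filter]
    rw [this, Finset.mul_sum, ← smul_eq_mul, ← Finset.sum_const]
    apply Finset.sum_le_sum
    intro i hi
    have := (Finset.mem_filter.1 (hD'D hi)).2
    exact median_aux hd _ _ _ this
  have hPE : P ⊆ E := by
    intro p hp
    have := Finset.mem_product.1 (Finset.mem_filter.1 hp).1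
    simp [hE, hS, this.1]
  have hPC : P.card + C.card ≤ (P ∩ C).card + E.card := by
    rw [← Finset.card_union_add_card_inter, add_comm]
    exact Nat.add_le_add_left (Finset.card_le_card (Finset.union_subset hPE (Finset.filter_subset _ _))) _
  have hPCR : 13 * (d * s : ℝ) ≤ 256 * (P ∩ C).card := by
    have e1 : (P.card : ℝ) + C.card ≤ (P ∩ C).card + S.card * d := by
      rw [hEcard] at hPC; exact_mod_cast hPC
    have e2 : 2 * ((E.image f).card : ℝ) ≤ S.card * d + C.card := by
      rw [hEcard] at hclean; exact_mod_cast hclean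
    have e3 : (D'.card : ℝ) * d ≤ 2 * P.card := by exact_mod_cast hPcard
    have e4 : (s : ℝ) * d ≤ 8 * D'.card * d := mul_le_mul_of_nonneg_right hD'8 hdR.le
    have e5 : ε / 512 * (d * S.card) ≤ 1 / 512 * (d * (3 * s)) := by
      apply mul_le_mul (by linarith) _ (by positivity) (by norm_num)
      exact mul_le_mul_of_nonneg_left hSR hdR.le
    linarith
  set g : Fin m → ℝ := fun u => ∑ l ∈ A.filter (fun l => ∃ j, nbr l j = u), w l with hg
  have hg0 : ∀ u, 0 ≤ g u := fun u => Finset.sum_nonneg fun l _ => hw0 l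
  have hbad : ∀ p ∈ P ∩ C, ε / (4 * s) ≤ g (f p) := by
    intro p hp
    obtain ⟨hpP, hpC⟩ := Finset.mem_inter.1 hp
    obtain ⟨hpD, hpb⟩ := Finset.mem_filter.1 hpP
    obtain ⟨hpE, hpc⟩ := Finset.mem_filter.1 hpC
    refine hpb.trans ?_
    have hpS : p.1 ∈ S := (Finset.mem_product.1 hpE).1
    have hset : Finset.univ.filter (fun i => ∃ j, nbr i j = nbr p.1 p.2)
        = insert p.1 (A.filter (fun l => ∃ j, nbr l j = f p)) := by
      ext l
      simp only [Finset.mem_filter, Finset.mem_univ, true_and, Finset.mem_insert, hA,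
        Finset.mem_sdiff]
      constructor
      · rintro ⟨j, hj⟩
        by_cases hl : l ∈ S
        · left
          have := hpc (l, j) (by simp [hE, hl]) hj
          rw [← this]
        · exact Or.inr ⟨hl, j, hj⟩
      · rintro (rfl | ⟨_, h⟩)
        · exact ⟨_, rfl⟩
        · exact h
    have hsum : bucketSum nbr x (nbr p.1 p.2)
        = x p.1 + ∑ l ∈ A.filter (fun l => ∃ j, nbr l j = f p), x l := by
      unfold bucketSum
      rw [← Finset.sum_insert (by simp [hA, hpS]), ← hset]
      congr!
    rw [hsum, sub_add_cancel_left, abs_neg]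
    refine (Finset.abs_sum_le_sum_abs _ _).trans (Finset.sum_le_sum fun l hl => ?_)
    have hlS : l ∉ S := by
      have := (Finset.mem_filter.1 hl).1
      simpa [hA] using this
    have hyl : y l = 0 := by
      by_contra h
      apply hlS
      simp [hS, fsupp, h]
    simp [hw, hxyz, hyl]
  have hlow : ((P ∩ C).card : ℝ) * (ε / (4 * s)) ≤ ∑ a ∈ A, w a * c a := by
    calc ((P ∩ C).card : ℝ) * (ε / (4 * s)) ≤ ∑ p ∈ P ∩ C, g (f p) := by
          rw [← nsmul_eq_mul]; exact Finset.card_nsmul_le_sum _ _ _ hbad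
      _ = ∑ u ∈ (P ∩ C).image f, g u := by
          rw [Finset.sum_image]
          intro a ha b hb hab
          have ha := Finset.mem_filter.1 (Finset.mem_inter.1 ha).2
          have hb := Finset.mem_filter.1 (Finset.mem_inter.1 hb).2
          exact hb.2 a ha.1 hab
      _ ≤ ∑ u ∈ Γ, g u := by
          apply Finset.sum_le_sum_of_subset_of_nonneg _ fun u _ _ => hg0 u
          intro u hu
          obtain ⟨p, hp, rfl⟩ := Finset.mem_image.1 hu
          have := (Finset.mem_product.1 (Finset.mem_filter.1 (Finset.mem_inter.1 hp).1).1).1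
          simp only [hΓ, nbrSet, Finset.mem_biUnion, Finset.mem_image, Finset.mem_univ, true_and]
          exact ⟨p.1, this, p.2, rfl⟩
      _ = ∑ l ∈ A, ∑ u ∈ Γ, if ∃ j, nbr l j = u then w l else 0 := by
          rw [Finset.sum_comm]
          refine Finset.sum_congr rfl fun u _ => ?_
          simp only [hg, Finset.sum_filter]
      _ ≤ ∑ a ∈ A, w a * c a := by
          refine Finset.sum_le_sum fun l _ => ?_
          rw [← Finset.sum_filter, Finset.sum_const, nsmul_eq_mul, mul_comm]
          apply mul_le_mul_of_nonneg_left _ (hw0 l)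
          simp only [hc]
          have hsub : Γ.filter (fun u => ∃ j, nbr l j = u) ⊆
              (Finset.univ.filter (fun j => nbr l j ∈ Γ)).image (nbr l) := by
            intro u hu
            obtain ⟨hu, j, rfl⟩ := Finset.mem_filter.1 hu
            exact Finset.mem_image_of_mem _ (by simp [hu])
          exact_mod_cast (Finset.card_le_card hsub).trans Finset.card_image_le
  have h1 : ((P ∩ C).card : ℝ) * (ε / 4) ≤ ε / 512 * d * (2 * s) * (3 / 2) := by
    refine le_trans ?_ hup2
    have := mul_le_mul_of_nonneg_right hlow hsR.le
    have e : ((P ∩ C).card : ℝ) * (ε / (4 * s)) * s = ((P ∩ C).card : ℝ) * (ε / 4) := by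
      field_simp
    rwa [e] at this
  have h2 : 13 * (d * s : ℝ) * ε ≤ 256 * (P ∩ C).card * ε :=
    mul_le_mul_of_nonneg_right hPCR hε.le
  have h3 : 0 < (d : ℝ) * s * ε := by positivity
  linarith
end
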